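/- arXiv:1509.03447 — 2 statements merged into one kernel-verified Lean document; each statement's English description precedes it below -/
import Mathlib

section
/- There exist maximal outer 1-planar graphs on n vertices with exactly (11/5)n − 18/5 edges, and this is the minimum number of edges of a maximal outer 1-planar graph (the bound is tight). -/
open Set

noncomputable section

/-- The Euclidean plane, where graphs are drawn. -/
abbrev Plane : Type := ℝ × ℝ

/-- A drawing of a multigraph on vertex type `V` with edges indexed by `E`,
`ends e` being the (unordered) pair of endpoints of `e`.  Vertices are distinct
points, edges are simple Jordan arcs joining their endpoints, arcs avoid vertices
in their interior, and edges sharing an endpoint do not cross. -/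
structure MultiDrawing (V E : Type) (ends : E → Sym2 V) where
  pos : V → Plane
  pos_inj : Function.Injective pos
  arc : E → ℝ → Plane
  arc_cont : ∀ e, ContinuousOn (arc e) (Icc (0:ℝ) 1)
  arc_inj : ∀ e, InjOn (arc e) (Icc (0:ℝ) 1)
  arc_ends : ∀ e, ∃ u v : V, ends e = s(u, v) ∧ arc e 0 = pos u ∧ arc e 1 = pos v
  arc_avoid : ∀ e, ∀ w : V, pos w ∉ arc e '' Ioo (0:ℝ) 1
  no_incident_cross : ∀ e f, e ≠ f →
    (arc e '' Ioo (0:ℝ) 1 ∩ arc f '' Ioo (0:ℝ) 1).Nonempty →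
    ∀ x : V, ¬(x ∈ ends e ∧ x ∈ ends f)

namespace MultiDrawing

variable {V E : Type} {ends : E → Sym2 V}

/-- The interior (open part) of the arc of edge `e`. -/
def inter (D : MultiDrawing V E ends) (e : E) : Set Plane := D.arc e '' Ioo (0:ℝ) 1

/-- The crossings of edge `e`: pairs of another edge and a common interior point. -/
def crossSet (D : MultiDrawing V E ends) (e : E) : Set (E × Plane) :=
  {fp | fp.1 ≠ e ∧ fp.2 ∈ D.inter e ∩ D.inter fp.1}

/-- A planar drawing: no edge is crossed. -/
def IsPlanarD (D : MultiDrawing V E ends) : Prop := ∀ e, D.crossSet e = ∅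

/-- A 1-planar drawing: each edge is crossed at most once. -/
def IsOnePlanarD (D : MultiDrawing V E ends) : Prop := ∀ e, (D.crossSet e).Subsingleton

/-- The point set occupied by the drawing. -/
def image (D : MultiDrawing V E ends) : Set Plane :=
  range D.pos ∪ ⋃ e, D.arc e '' Icc (0:ℝ) 1

/-- A face of a drawing: a connected component of the complement of its image. -/
def IsFace (D : MultiDrawing V E ends) (F : Set Plane) : Prop :=
  ∃ p, p ∉ D.image ∧ F = connectedComponentIn D.imageᶜ p

/-- A triangulated drawing: the boundary of each face meets (segments of) exactly
three edges. -/
def IsTriangulated (D : MultiDrawing V E ends) : Prop :=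
  ∀ F : Set Plane, D.IsFace F →
    {e : E | (frontier F ∩ D.arc e '' Icc (0:ℝ) 1).Nonempty}.ncard = 3

end MultiDrawing

/-- A drawing of a simple graph: arcs indexed by its edge set. -/
abbrev SimpleGraph.Drawing {V : Type} (G : SimpleGraph V) : Type :=
  MultiDrawing V ↥G.edgeSet (fun e => (e : Sym2 V))

/-- A graph is 1-planar if it has a drawing with at most one crossing per edge. -/
def SimpleGraph.IsOnePlanar {V : Type} (G : SimpleGraph V) : Prop :=
  ∃ D : G.Drawing, D.IsOnePlanarD

/-- A graph is planar if it has a crossing-free drawing. -/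
def SimpleGraph.IsPlanarGraph {V : Type} (G : SimpleGraph V) : Prop :=
  ∃ D : G.Drawing, D.IsPlanarD

/-- Points of the sphere. -/
abbrev SpherePt : Type := ↥(Metric.sphere (0 : EuclideanSpace ℝ (Fin 3)) 1)

/-- A subset of the sphere that is homeomorphic to a closed disk. -/
def IsClosedDisk (s : Set SpherePt) : Prop :=
  Nonempty (↥s ≃ₜ ↥(Metric.closedBall (0 : Plane) 1))

/-- A map: a partition of the sphere into closed-disk regions with pairwise
disjoint interiors, some of which are labeled as countries. -/
structure SphereMap (C : Type) where
  region : C → Set SpherePt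
  country : C → Prop
  disk : ∀ c, IsClosedDisk (region c)
  int_disjoint : ∀ c d : C, c ≠ d → interior (region c) ∩ interior (region d) = ∅
  cover : ⋃ c, region c = Set.univ

/-- A `k`-map: at most `k` regions meet at any point. -/
def SphereMap.IsKMap {C : Type} (M : SphereMap C) (k : ℕ) : Prop :=
  ∀ p : SpherePt, {c : C | p ∈ M.region c}.ncard ≤ k

/-- A hole-free map: every region is a country. -/
def SphereMap.HoleFree {C : Type} (M : SphereMap C) : Prop := ∀ c, M.country c

/-- `G` is the map graph of `M`: its vertices correspond to the countries of `M`,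
with edges given by touching countries. -/
def IsMapGraphOf {V C : Type} (G : SimpleGraph V) (M : SphereMap C) : Prop :=
  ∃ φ : V ≃ {c : C // M.country c},
    ∀ u v : V, G.Adj u v ↔ u ≠ v ∧ (M.region (φ u) ∩ M.region (φ v)).Nonempty

/-- `G` is a map graph. -/
def IsMapGraph {V : Type} (G : SimpleGraph V) : Prop :=
  ∃ (C : Type) (_ : Finite C) (M : SphereMap C), IsMapGraphOf G M

/-- `G` is a `k`-map graph. -/
def IsKMapGraph {V : Type} (G : SimpleGraph V) (k : ℕ) : Prop :=
  ∃ (C : Type) (_ : Finite C) (M : SphereMap C), M.IsKMap k ∧ IsMapGraphOf G M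

/-- `G` is a hole-free `k`-map graph. -/
def IsHoleFreeKMapGraph {V : Type} (G : SimpleGraph V) (k : ℕ) : Prop :=
  ∃ (C : Type) (_ : Finite C) (M : SphereMap C),
    M.HoleFree ∧ M.IsKMap k ∧ IsMapGraphOf G M
/-- An outer 1-planar graph: it has a 1-planar drawing with all vertices on the
outer (unbounded) face. -/
def OuterOnePlanar {V : Type} (G : SimpleGraph V) : Prop :=
  ∃ D : G.Drawing, D.IsOnePlanarD ∧
    ∃ F : Set Plane, D.IsFace F ∧ ¬Bornology.IsBounded F ∧ ∀ v : V, D.pos v ∈ closure F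

/-- A maximal outer 1-planar graph: adding any edge destroys outer
1-planarity. -/
def MaximalOuterOnePlanar {V : Type} (G : SimpleGraph V) : Prop :=
  OuterOnePlanar G ∧ ∀ H : SimpleGraph V, G < H → ¬OuterOnePlanar H

/-- Ordered chords `(a,b)` and `(c,d)` alternate. -/
def XX (a b c d : ℕ) : Prop := (a < c ∧ c < b ∧ b < d) ∨ (c < a ∧ a < d ∧ d < b)

/-- Number of ordered chords inside the interval `[i,j]`. -/
def cntE (R : ℕ → ℕ → Prop) (i j : ℕ) : ℕ := by
  classical exact ((Finset.Icc i j ×ˢ Finset.Icc i j).filter (fun p => R p.1 p.2)).card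

/-- An uncrossed chord of the graph. -/
def Unc (R : ℕ → ℕ → Prop) (i j : ℕ) : Prop := R i j ∧ ∀ c d, R c d → ¬ XX i j c d

lemma tri_or_quad {n : ℕ} {R : ℕ → ℕ → Prop}
    (hR : ∀ a b, R a b → a < b ∧ b < n)
    (H1 : ∀ a b c d c' d', R a b → R c d → R c' d' → XX a b c d → XX a b c' d' → c = c' ∧ d = d')
    (M0 : ∀ u v, u < v → v < n → (∀ c d, R c d → ¬ XX u v c d) → R u v)
    (i j : ℕ) (h : Unc R i j) (hij : i + 2 ≤ j) :
    (∃ k, i < k ∧ k < j ∧ Unc R i k ∧ Unc R k j) ∨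
    (∃ k l, i < k ∧ k < l ∧ l < j ∧ Unc R i k ∧ Unc R k l ∧ Unc R l j ∧ R i l ∧ R k j) := by
  classical
  obtain ⟨hRij, hU⟩ := h
  have hjn := (hR i j hRij).2
  have h1 : R i (i+1) := by
    apply M0 _ _ (by omega) (by omega)
    intro c d _; unfold XX; omega
  -- largest neighbour
  obtain ⟨k, hik, hkj, hRk, hmax⟩ : ∃ k, i < k ∧ k < j ∧ R i k ∧ ∀ k', k' < j → R i k' → k' ≤ k := by
    have hne : ((Finset.range j).filter (fun k => R i k)).Nonempty :=
      ⟨i+1, by simp; exact ⟨by omega, h1⟩⟩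
    obtain ⟨k, hk, hk2⟩ := Finset.exists_max_image _ id hne
    simp at hk hk2
    exact ⟨k, (hR _ _ hk.2).1, hk.1, hk.2, fun k' a b => hk2 k' a b⟩
  by_cases hc : ∀ c d, R c d → ¬ XX i k c d
  · left
    refine ⟨k, hik, hkj, ⟨hRk, hc⟩, ?_⟩
    have : ∀ c d, R c d → ¬ XX k j c d := by
      intro c d hcd hx
      have a1 := hU c d hcd
      have a2 := hc c d hcd
      have a3 := (hR c d hcd).1
      have a4 : c = i → d < j → d ≤ k := fun e hd => hmax d hd (e ▸ hcd)
      unfold XX at *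
      omega
    exact ⟨M0 _ _ hkj hjn this, this⟩
  · right
    push Not at hc
    obtain ⟨x, y, hxy, hX⟩ := hc
    have b1 := hU x y hxy
    have b0 := hR x y hxy
    have hlt : i < x ∧ x < k ∧ k < y ∧ y ≤ j := by unfold XX at *; omega
    have only1 : ∀ c d, R c d → XX i k c d → c = x ∧ d = y := fun c d hcd hx =>
      H1 i k c d x y hRk hcd hxy hx hX
    have only2 : ∀ c d, R c d → XX x y c d → c = i ∧ d = k := fun c d hcd hx =>
      H1 x y c d i k hxy hcd hRk hx (by unfold XX at *; omega)
    have hiy : R i y := by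
      apply M0 _ _ (by omega) (by omega)
      intro c d hcd hx
      have a1 := hU c d hcd
      have a2 := only1 c d hcd
      have a3 := only2 c d hcd
      have a4 := hR c d hcd
      unfold XX at *
      omega
    have hyj : y = j := by
      by_contra hne
      have := hmax y (by omega) hiy
      omega
    subst hyj
    have key : ∀ u v, u < v → v < n → (∀ c d, R c d → ¬ XX u v c d) → Unc R u v :=
      fun u v a b c => ⟨M0 u v a b c, c⟩
    refine ⟨x, k, hlt.1, hlt.2.1, hkj, ?_, ?_, ?_, hRk, hxy⟩ <;>
    · apply key _ _ (by omega) (by omega)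
      intro c d hcd hx
      have a1 := hU c d hcd
      have a2 := only1 c d hcd
      have a3 := only2 c d hcd
      have a4 := hR c d hcd
      unfold XX at *
      omega

lemma no_tri_left {n : ℕ} {R : ℕ → ℕ → Prop}
    (hR : ∀ a b, R a b → a < b ∧ b < n)
    (M1 : ∀ u v e f, u < v → v < n → R e f → (∀ c d, R c d → XX u v c d → c = e ∧ d = f) →
      (∀ c d, R c d → ¬ XX e f c d) → R u v)
    (i j k h : ℕ) (u : Unc R i j) (hik : i < k) (hkj : k < j) (h1 : Unc R i k)
    (h2 : Unc R k j) (hih : i < h) (hhk : h < k) (h3 : Unc R i h) (h4 : Unc R h k) : False := by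
  have hjn := (hR i j u.1).2
  have : R h j := by
    apply M1 h j i k (by omega) hjn h1.1 _ h1.2
    intro c d hcd hx
    have a1 := u.2 c d hcd
    have a2 := h1.2 c d hcd
    have a3 := h2.2 c d hcd
    have a4 := h3.2 c d hcd
    have a5 := h4.2 c d hcd
    have a6 := hR c d hcd
    unfold XX at *
    omega
  exact h1.2 h j this (by unfold XX; omega)

lemma no_tri_right {n : ℕ} {R : ℕ → ℕ → Prop}
    (hR : ∀ a b, R a b → a < b ∧ b < n)
    (M1 : ∀ u v e f, u < v → v < n → R e f → (∀ c d, R c d → XX u v c d → c = e ∧ d = f) →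
      (∀ c d, R c d → ¬ XX e f c d) → R u v)
    (i j k h : ℕ) (u : Unc R i j) (hik : i < k) (hkj : k < j) (h1 : Unc R i k)
    (h2 : Unc R k j) (hih : k < h) (hhk : h < j) (h3 : Unc R k h) (h4 : Unc R h j) : False := by
  have hjn := (hR i j u.1).2
  have : R i h := by
    apply M1 i h k j (by omega) (by omega) h2.1 _ h2.2
    intro c d hcd hx
    have a1 := u.2 c d hcd
    have a2 := h1.2 c d hcd
    have a3 := h2.2 c d hcd
    have a4 := h3.2 c d hcd
    have a5 := h4.2 c d hcd
    have a6 := hR c d hcd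
    unfold XX at *
    omega
  exact h2.2 i h this (by unfold XX; omega)

lemma cnt_tri {n : ℕ} {R : ℕ → ℕ → Prop}
    (hR : ∀ a b, R a b → a < b ∧ b < n)
    (i k j : ℕ) (hik : i < k) (hkj : k < j) (h : R i j) :
    cntE R i k + cntE R k j + 1 ≤ cntE R i j := by
  classical
  unfold cntE
  set A := (Finset.Icc i k ×ˢ Finset.Icc i k).filter (fun p : ℕ × ℕ => R p.1 p.2)
  set B := (Finset.Icc k j ×ˢ Finset.Icc k j).filter (fun p : ℕ × ℕ => R p.1 p.2)
  have d1 : Disjoint A B := by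
    rw [Finset.disjoint_left]
    rintro ⟨a, b⟩ h1 h2
    simp [A, B] at h1 h2
    have := hR a b h1.2
    omega
  have d2 : Disjoint (A ∪ B) {(i, j)} := by
    rw [Finset.disjoint_singleton_right]
    simp [A, B]
    constructor <;> intros <;> omega
  rw [← Finset.card_union_of_disjoint d1, ← Finset.card_singleton (i, j),
    ← Finset.card_union_of_disjoint d2]
  apply Finset.card_le_card
  rintro ⟨a, b⟩ hab
  simp [A, B] at hab ⊢
  rcases hab with hab | hab | hab <;>
  first
  | exact ⟨by omega, hab.2⟩
  | (obtain ⟨rfl, rfl⟩ := hab; exact ⟨by omega, by assumption⟩)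

lemma cnt_quad {n : ℕ} {R : ℕ → ℕ → Prop}
    (hR : ∀ a b, R a b → a < b ∧ b < n)
    (i k l j : ℕ) (hik : i < k) (hkl : k < l) (hlj : l < j) (h : R i j) (h1 : R i l)
    (h2 : R k j) :
    cntE R i k + cntE R k l + cntE R l j + 3 ≤ cntE R i j := by
  classical
  unfold cntE
  set A := (Finset.Icc i k ×ˢ Finset.Icc i k).filter (fun p : ℕ × ℕ => R p.1 p.2)
  set B := (Finset.Icc k l ×ˢ Finset.Icc k l).filter (fun p : ℕ × ℕ => R p.1 p.2)
  set C := (Finset.Icc l j ×ˢ Finset.Icc l j).filter (fun p : ℕ × ℕ => R p.1 p.2)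
  have d1 : Disjoint A B := by
    rw [Finset.disjoint_left]
    rintro ⟨a, b⟩ h1 h2
    simp [A, B] at h1 h2
    have := hR a b h1.2
    omega
  have d2 : Disjoint (A ∪ B) C := by
    rw [Finset.disjoint_left]
    rintro ⟨a, b⟩ h1 h2
    simp [A, B, C] at h1 h2
    have := hR a b h2.2
    omega
  have d3 : Disjoint (A ∪ B ∪ C) {(i, j), (i, l), (k, j)} := by
    rw [Finset.disjoint_left]
    rintro ⟨a, b⟩ h1 h2
    simp [A, B, C] at h1 h2
    omega
  have c3 : ({(i, j), (i, l), (k, j)} : Finset (ℕ × ℕ)).card = 3 := by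
    rw [Finset.card_eq_three]
    exact ⟨_, _, _, by simp; omega, by simp; omega, by simp; omega, rfl⟩
  rw [← Finset.card_union_of_disjoint d1, ← Finset.card_union_of_disjoint d2, ← c3,
    ← Finset.card_union_of_disjoint d3]
  apply Finset.card_le_card
  rintro ⟨a, b⟩ hab
  simp [A, B, C] at hab ⊢
  rcases hab with hab | hab | hab | hab | hab | hab <;>
  first
  | exact ⟨by omega, hab.2⟩
  | (obtain ⟨rfl, rfl⟩ := hab; exact ⟨by omega, by assumption⟩)

lemma lower_interval {n : ℕ} {R : ℕ → ℕ → Prop}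
    (hR : ∀ a b, R a b → a < b ∧ b < n)
    (H1 : ∀ a b c d c' d', R a b → R c d → R c' d' → XX a b c d → XX a b c' d' → c = c' ∧ d = d')
    (M0 : ∀ u v, u < v → v < n → (∀ c d, R c d → ¬ XX u v c d) → R u v)
    (M1 : ∀ u v e f, u < v → v < n → R e f → (∀ c d, R c d → XX u v c d → c = e ∧ d = f) →
      (∀ c d, R c d → ¬ XX e f c d) → R u v)
    (m : ℕ) : ∀ i j : ℕ, j = i + m → Unc R i j →
    11 * (m + 1) ≤ 5 * cntE R i j + 18 ∧
    ((¬ ∃ k, i < k ∧ k < j ∧ Unc R i k ∧ Unc R k j) → 11 * (m + 1) + 1 ≤ 5 * cntE R i j + 18) := by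
  induction m using Nat.strong_induction_on with
  | _ m ih =>
  intro i j hj hu
  have hlt := hR i j hu.1
  by_cases h2 : i + 2 ≤ j
  · rcases tri_or_quad hR H1 M0 i j hu h2 with ⟨k, hik, hkj, u1, u2⟩ | ⟨k, l, hik, hkl, hlj, u1, u2, u3, r1, r2⟩
    · have A := (ih (k - i) (by omega) i k (by omega) u1).2 (by
        rintro ⟨h, a, b, c, d⟩
        exact no_tri_left hR M1 i j k h hu hik hkj u1 u2 a b c d)
      have B := (ih (j - k) (by omega) k j (by omega) u2).2 (by
        rintro ⟨h, a, b, c, d⟩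
        exact no_tri_right hR M1 i j k h hu hik hkj u1 u2 a b c d)
      have := cnt_tri hR i k j hik hkj hu.1
      refine ⟨by omega, fun hn => absurd ⟨k, hik, hkj, u1, u2⟩ hn⟩
    · have A := (ih (k - i) (by omega) i k (by omega) u1).1
      have B := (ih (l - k) (by omega) k l (by omega) u2).1
      have C := (ih (j - l) (by omega) l j (by omega) u3).1
      have := cnt_quad hR i k l j hik hkl hlj hu.1 r1 r2
      constructor
      · omega
      · intro; omega
  · have : 1 ≤ cntE R i j := by
      classical
      unfold cntE
      apply Finset.card_pos.mpr
      exact ⟨(i, j), by simp; exact ⟨by omega, hu.1⟩⟩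
    constructor
    · omega
    · intro; omega

lemma lower_nat {n : ℕ} {R : ℕ → ℕ → Prop}
    (hR : ∀ a b, R a b → a < b ∧ b < n)
    (H1 : ∀ a b c d c' d', R a b → R c d → R c' d' → XX a b c d → XX a b c' d' → c = c' ∧ d = d')
    (M0 : ∀ u v, u < v → v < n → (∀ c d, R c d → ¬ XX u v c d) → R u v)
    (M1 : ∀ u v e f, u < v → v < n → R e f → (∀ c d, R c d → XX u v c d → c = e ∧ d = f) →
      (∀ c d, R c d → ¬ XX e f c d) → R u v)
    (hn : 2 ≤ n) : 11 * n ≤ 5 * cntE R 0 (n - 1) + 18 := by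
  have hu : ∀ c d, R c d → ¬ XX 0 (n - 1) c d := by
    intro c d h
    have := hR c d h
    unfold XX; omega
  have := (lower_interval hR H1 M0 M1 (n - 1) 0 (n - 1) (by omega)
    ⟨M0 _ _ (by omega) (by omega) hu, hu⟩).1
  omega

/-- `r` lies strictly between `p` and `q`. -/
def btwn {α : Type} [LinearOrder α] (p q r : α) : Prop := (p < r ∧ r < q) ∨ (q < r ∧ r < p)

/-- The chords `pq` and `rs` alternate. -/
def altn {α : Type} [LinearOrder α] (p q r s : α) : Prop :=
  (btwn p q r ∧ ¬ btwn p q s ∧ s ≠ p ∧ s ≠ q) ∨ (btwn p q s ∧ ¬ btwn p q r ∧ r ≠ p ∧ r ≠ q)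

/-- Every edge alternates with at most one other edge in the order given by `x`. -/
def GoodOrd {V α : Type} [LinearOrder α] (G : SimpleGraph V) (x : V → α) : Prop :=
  ∀ a b c d c' d', G.Adj a b → G.Adj c d → G.Adj c' d' →
    altn (x a) (x b) (x c) (x d) → altn (x a) (x b) (x c') (x d') → s(c, d) = s(c', d')

/-- Combinatorial outer 1-planarity. -/
def CombO1P {V : Type} (G : SimpleGraph V) : Prop :=
  ∃ x : V → ℝ, Function.Injective x ∧ GoodOrd G x

/-- ordered edges -/
def RG {V : Type} (G : SimpleGraph V) (g : V → ℕ) (a b : ℕ) : Prop :=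
  a < b ∧ ∃ u v, G.Adj u v ∧ g u = a ∧ g v = b

lemma XX_symm {a b c d : ℕ} (h : XX a b c d) : XX c d a b := by
  unfold XX at *; omega

lemma alt_nat {a b c d : ℕ} (h1 : a < b) (h2 : c < d) : altn a b c d ↔ XX a b c d := by
  unfold altn XX btwn; omega

lemma altn_symm_right {α : Type} [LinearOrder α] {p q r s : α} : altn p q r s ↔ altn p q s r := by
  unfold altn; tauto

lemma altn_symm_left {α : Type} [LinearOrder α] {p q r s : α} : altn p q r s ↔ altn q p r s := by
  have h : ∀ t, btwn p q t ↔ btwn q p t := fun t => by unfold btwn; exact or_comm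
  unfold altn
  rw [h r, h s, and_comm (a := s ≠ p), and_comm (a := r ≠ p)]

lemma goodOrd_iff {V : Type} (G : SimpleGraph V) (g : V → ℕ) (hg : Function.Injective g) :
    GoodOrd G g ↔ ∀ a b c d c' d', RG G g a b → RG G g c d → RG G g c' d' →
      XX a b c d → XX a b c' d' → c = c' ∧ d = d' := by
  constructor
  · rintro h _ _ _ _ _ _ ⟨l1, a, b, hab, rfl, rfl⟩ ⟨l2, c, d, hcd, rfl, rfl⟩ ⟨l3, c', d', hcd', rfl, rfl⟩ x1 x2
    have := h a b c d c' d' hab hcd hcd' ((alt_nat l1 l2).2 x1) ((alt_nat l1 l3).2 x2)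
    rw [Sym2.eq_iff] at this
    rcases this with ⟨rfl, rfl⟩ | ⟨rfl, rfl⟩
    · simp
    · omega
  · intro h a b c d c' d' hab hcd hcd' x1 x2
    have key : ∀ u v, G.Adj u v → ∃ u' v', G.Adj u' v' ∧ g u' < g v' ∧ ((u' = u ∧ v' = v) ∨ (u' = v ∧ v' = u)) := by
      intro u v huv
      rcases lt_trichotomy (g u) (g v) with h | h | h
      · exact ⟨u, v, huv, h, Or.inl ⟨rfl, rfl⟩⟩
      · exact absurd (hg h) huv.ne
      · exact ⟨v, u, huv.symm, h, Or.inr ⟨rfl, rfl⟩⟩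
    obtain ⟨a1, b1, hab1, l1, e1⟩ := key a b hab
    obtain ⟨c1, d1, hcd1, l2, e2⟩ := key c d hcd
    obtain ⟨c2, d2, hcd2, l3, e3⟩ := key c' d' hcd'
    have y1 : altn (g a1) (g b1) (g c1) (g d1) := by
      rcases e1 with ⟨rfl, rfl⟩ | ⟨rfl, rfl⟩ <;> rcases e2 with ⟨rfl, rfl⟩ | ⟨rfl, rfl⟩
      · exact x1
      · exact altn_symm_right.1 x1
      · exact altn_symm_left.1 x1
      · exact altn_symm_left.1 (altn_symm_right.1 x1)
    have y2 : altn (g a1) (g b1) (g c2) (g d2) := by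
      rcases e1 with ⟨rfl, rfl⟩ | ⟨rfl, rfl⟩ <;> rcases e3 with ⟨rfl, rfl⟩ | ⟨rfl, rfl⟩
      · exact x2
      · exact altn_symm_right.1 x2
      · exact altn_symm_left.1 x2
      · exact altn_symm_left.1 (altn_symm_right.1 x2)
    obtain ⟨f1, f2⟩ := h _ _ _ _ _ _ ⟨l1, a1, b1, hab1, rfl, rfl⟩ ⟨l2, c1, d1, hcd1, rfl, rfl⟩
      ⟨l3, c2, d2, hcd2, rfl, rfl⟩ ((alt_nat l1 l2).1 y1) ((alt_nat l1 l3).1 y2)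
    have f1 := hg f1
    have f2 := hg f2
    rw [Sym2.eq_iff]
    rcases e2 with ⟨rfl, rfl⟩ | ⟨rfl, rfl⟩ <;> rcases e3 with ⟨rfl, rfl⟩ | ⟨rfl, rfl⟩ <;> simp [*]

lemma alt_congr {V α β : Type} [LinearOrder α] [LinearOrder β] (x : V → α) (g : V → β)
    (hx : Function.Injective x) (hg : Function.Injective g)
    (h : ∀ u v, x u < x v ↔ g u < g v) (a b c d : V) :
    altn (x a) (x b) (x c) (x d) ↔ altn (g a) (g b) (g c) (g d) := by
  unfold altn btwn
  simp only [h, ne_eq, hx.eq_iff, hg.eq_iff]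

lemma exists_nat_order {V : Type} [Fintype V] (x : V → ℝ) (hx : Function.Injective x) :
    ∃ g : V → ℕ, Function.Injective g ∧ (∀ v, g v < Fintype.card V) ∧
      ∀ u v, x u < x v ↔ g u < g v := by
  classical
  let g : V → ℕ := fun v => (Finset.univ.filter (fun w => x w < x v)).card
  have mono : ∀ u v, x u < x v → g u < g v := by
    intro u v huv
    apply Finset.card_lt_card
    rw [Finset.ssubset_iff_of_subset]
    · exact ⟨u, by simpa using huv, by simp⟩
    · intro w hw
      simp at hw ⊢
      exact hw.trans huv
  have inj : Function.Injective g := by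
    intro u v huv
    by_contra hne
    rcases lt_or_gt_of_ne (fun h => hne (hx h)) with h | h
    · exact (mono _ _ h).ne huv
    · exact (mono _ _ h).ne huv.symm
  refine ⟨g, inj, ?_, ?_⟩
  · intro v
    rw [← Finset.card_univ]
    apply Finset.card_lt_card
    rw [Finset.ssubset_iff_of_subset (Finset.subset_univ _)]
    exact ⟨v, by simp, by simp⟩
  · intro u v
    refine ⟨mono u v, fun h => ?_⟩
    rcases lt_trichotomy (x u) (x v) with h' | h' | h'
    · exact h'
    · rw [hx h'] at h; omega
    · have := mono _ _ h'; omega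

lemma CombO1P_iff_nat {V : Type} [Fintype V] (G : SimpleGraph V) :
    CombO1P G ↔ ∃ g : V → ℕ, Function.Injective g ∧ (∀ v, g v < Fintype.card V) ∧ GoodOrd G g := by
  constructor
  · rintro ⟨x, hx, h⟩
    obtain ⟨g, hg, hgn, hxg⟩ := exists_nat_order x hx
    refine ⟨g, hg, hgn, ?_⟩
    intro a b c d c' d' h1 h2 h3 h4 h5
    rw [← alt_congr x g hx hg hxg] at h4 h5
    exact h a b c d c' d' h1 h2 h3 h4 h5
  · rintro ⟨g, hg, hgn, h⟩
    refine ⟨fun v => (g v : ℝ), fun u v huv => hg (by simpa using huv), ?_⟩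
    intro a b c d c' d' h1 h2 h3 h4 h5
    rw [alt_congr (fun v => (g v : ℝ)) g (fun u v huv => hg (by simpa using huv)) hg (by simp)] at h4 h5
    exact h a b c d c' d' h1 h2 h3 h4 h5

lemma comb_lower {V : Type} [Fintype V] (G : SimpleGraph V) (hG : CombO1P G)
    (hmax : ∀ H : SimpleGraph V, G < H → ¬ CombO1P H) :
    (11 * (Fintype.card V : ℤ) - 18) ≤ 5 * (G.edgeSet.ncard : ℤ) := by
  classical
  set n := Fintype.card V with hn
  by_cases hn2 : n ≤ 1
  · have : (n : ℤ) ≤ 1 := by exact_mod_cast hn2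
    have : (0 : ℤ) ≤ (G.edgeSet.ncard : ℤ) := by positivity
    omega
  obtain ⟨g, hg, hgn, hgood⟩ := (CombO1P_iff_nat G).1 hG
  rw [← hn] at hgn
  have gsurj : ∀ i, i < n → ∃ v, g v = i := by
    intro i hi
    have hbij : Function.Bijective (fun v => (⟨g v, hgn v⟩ : Fin n)) := by
      rw [Fintype.bijective_iff_injective_and_card]
      exact ⟨fun u v h => hg (by simpa using h), by simp [hn]⟩
    obtain ⟨v, hv⟩ := hbij.2 ⟨i, hi⟩
    exact ⟨v, by simpa using hv⟩
  have H1 := (goodOrd_iff G g hg).1 hgood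
  have hR : ∀ a b, RG G g a b → a < b ∧ b < n := by
    rintro a b ⟨h, u, v, _, rfl, rfl⟩
    exact ⟨h, hgn v⟩
  have M : ∀ u v, u < v → v < n →
      (∀ c d, RG G g c d → XX u v c d → ∀ c' d', RG G g c' d' → ¬ XX c d c' d') →
      (∀ c d c' d', RG G g c d → RG G g c' d' → XX u v c d → XX u v c' d' → c = c' ∧ d = d') →
      RG G g u v := by
    intro u v huv hvn m1 m2
    by_contra hnot
    obtain ⟨U, rfl⟩ := gsurj u (by omega)
    obtain ⟨W, rfl⟩ := gsurj v (by omega)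
    have hUW : U ≠ W := by rintro rfl; omega
    have hna : ¬ G.Adj U W := fun h => hnot ⟨huv, U, W, h, rfl, rfl⟩
    have hlt : G < G ⊔ SimpleGraph.edge U W := by
      refine lt_of_le_of_ne le_sup_left fun heq => hna ?_
      rw [heq]
      simp [SimpleGraph.edge_adj, hUW]
    apply hmax _ hlt
    refine (CombO1P_iff_nat _).2 ⟨g, hg, hgn, (goodOrd_iff _ g hg).2 ?_⟩
    have hRH : ∀ a b, RG (G ⊔ SimpleGraph.edge U W) g a b → RG G g a b ∨ (a = g U ∧ b = g W) := by
      rintro a b ⟨h, p, q, hpq, rfl, rfl⟩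
      rw [SimpleGraph.sup_adj, SimpleGraph.edge_adj] at hpq
      rcases hpq with hpq | ⟨⟨rfl, rfl⟩ | ⟨rfl, rfl⟩, _⟩
      · exact Or.inl ⟨h, p, q, hpq, rfl, rfl⟩
      · right; simp
      · omega
    intro a b c d c' d' hab hcd hcd' x1 x2
    have irr : ¬ XX (g U) (g W) (g U) (g W) := by unfold XX; omega
    rcases hRH _ _ hab with hab | ⟨rfl, rfl⟩
    · rcases hRH _ _ hcd with hcd | ⟨rfl, rfl⟩ <;> rcases hRH _ _ hcd' with hcd' | ⟨rfl, rfl⟩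
      · exact H1 a b c d c' d' hab hcd hcd' x1 x2
      · exact absurd x1 (m1 a b hab (XX_symm x2) c d hcd)
      · exact absurd x2 (m1 a b hab (XX_symm x1) c' d' hcd')
      · simp
    · rcases hRH _ _ hcd with hcd | ⟨rfl, rfl⟩ <;> rcases hRH _ _ hcd' with hcd' | ⟨rfl, rfl⟩
      · exact m2 _ _ _ _ hcd hcd' x1 x2
      all_goals exact absurd (by assumption) irr
  have key := lower_nat (n := n) (R := RG G g) hR H1
    (fun u v h1 h2 h3 => M u v h1 h2 (fun c d hcd hx => absurd hx (h3 c d hcd))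
      (fun c d _ _ hcd _ hx => absurd hx (h3 c d hcd)))
    (fun u v e f h1 h2 h3 h4 h5 => M u v h1 h2
      (fun c d hcd hx => by
        obtain ⟨rfl, rfl⟩ := h4 c d hcd hx
        exact h5)
      (fun c d c' d' hcd hcd' hx hx' => by
        obtain ⟨rfl, rfl⟩ := h4 c d hcd hx
        obtain ⟨rfl, rfl⟩ := h4 c' d' hcd' hx'
        simp)) (by omega)
  have hcnt : cntE (RG G g) 0 (n - 1) ≤ G.edgeSet.ncard := by
    unfold cntE
    have hfin : G.edgeSet.Finite := Set.toFinite _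
    rw [Set.ncard_eq_toFinset_card _ hfin]
    choose s hs using gsurj
    let s' : ℕ → V := fun i => if h : i < n then s i h else s 0 (by omega)
    have hs' : ∀ v, s' (g v) = v := by
      intro v
      simp only [s', hgn v, dif_pos]
      exact hg (hs _ _)
    refine Finset.card_le_card_of_injOn (fun p => s(s' p.1, s' p.2)) ?_ ?_
    · rintro ⟨a, b⟩ hab
      simp at hab
      obtain ⟨_, h, u, v, huv, rfl, rfl⟩ := hab
      simp [hs', huv]
    · rintro ⟨a, b⟩ hab ⟨c, d⟩ hcd heq
      simp at hab hcd
      obtain ⟨_, h, u, v, huv, rfl, rfl⟩ := hab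
      obtain ⟨_, h', u', v', huv', rfl, rfl⟩ := hcd
      simp only [hs', Sym2.eq_iff] at heq
      rcases heq with ⟨rfl, rfl⟩ | ⟨rfl, rfl⟩
      · rfl
      · omega
  omega


/-- Ordered edges of the extremal example with `5 q + 3` vertices. -/
def EE (q a b : ℕ) : Prop :=
  a < b ∧ b ≤ 5 * q + 2 ∧
  ((b = a + 1 ∧ b ≤ 5 * q + 1) ∨ (b = 5 * q + 2 ∧ (a % 5 = 0 ∨ a % 5 = 1 ∨ a % 5 = 3)) ∨
    (b ≤ 5 * q + 1 ∧ ((a % 5 = 1 ∧ b = a + 2) ∨ (a % 5 = 3 ∧ b = a + 2) ∨ (a % 5 = 1 ∧ b = a + 4))))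

/-- The extremal example. -/
def exG (q : ℕ) : SimpleGraph (Fin (5 * q + 3)) where
  Adj u v := EE q u v ∨ EE q v u
  symm := ⟨fun _ _ h => h.symm⟩
  loopless := ⟨fun _ h => by rcases h with h | h <;> exact absurd h.1 (lt_irrefl _)⟩

lemma EE_cross {q a b c d : ℕ} (h1 : EE q a b) (h2 : EE q c d) (hac : a < c) (hcb : c < b)
    (hbd : b < d) : b = a + 4 ∧ c = a + 2 ∧ d = 5 * q + 2 ∧ a % 5 = 1 := by
  obtain ⟨l1, l2, h1⟩ := h1
  obtain ⟨m1, m2, h2⟩ := h2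
  rcases h1 with h1 | h1 | ⟨_, h1 | h1 | h1⟩ <;> rcases h2 with h2 | h2 | ⟨_, h2 | h2 | h2⟩ <;> omega

lemma exG_comb (q : ℕ) : CombO1P (exG q) := by
  rw [CombO1P_iff_nat]
  refine ⟨fun v => v.val, Fin.val_injective, fun v => by simp, ?_⟩
  rw [goodOrd_iff _ _ Fin.val_injective]
  have key : ∀ a b, RG (exG q) (fun v => v.val) a b → EE q a b := by
    rintro _ _ ⟨h, u, v, huv, rfl, rfl⟩
    rcases huv with huv | huv
    · exact huv
    · exact absurd huv.1 (not_lt.2 (le_of_lt h))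
  intro a b c d c' d' hab hcd hcd' x1 x2
  have hab := key _ _ hab
  have hcd := key _ _ hcd
  have hcd' := key _ _ hcd'
  rcases x1 with ⟨p1, p2, p3⟩ | ⟨p1, p2, p3⟩ <;> rcases x2 with ⟨q1, q2, q3⟩ | ⟨q1, q2, q3⟩
  · have := EE_cross hab hcd p1 p2 p3
    have := EE_cross hab hcd' q1 q2 q3
    omega
  · have := EE_cross hab hcd p1 p2 p3
    have := EE_cross hcd' hab q1 q2 q3
    omega
  · have := EE_cross hcd hab p1 p2 p3
    have := EE_cross hab hcd' q1 q2 q3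
    omega
  · have := EE_cross hcd hab p1 p2 p3
    have := EE_cross hcd' hab q1 q2 q3
    omega

lemma exG_card (q : ℕ) : (exG q).edgeSet.ncard ≤ 11 * q + 3 := by
  classical
  let vt : ℕ → Fin (5 * q + 3) := Fin.ofNat (5 * q + 3)
  have hvt : ∀ v : Fin (5 * q + 3), vt v.val = v := by
    intro v
    apply Fin.ext
    simp [vt]
  let S : Finset (ℕ × ℕ) :=
    (Finset.range (5 * q + 1)).image (fun a => (a, a + 1)) ∪
    ((Finset.range (q + 1)).image (fun i => (5 * i, 5 * q + 2)) ∪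
    ((Finset.range (q + 1)).image (fun i => (5 * i + 1, 5 * q + 2)) ∪
    ((Finset.range q).image (fun i => (5 * i + 3, 5 * q + 2)) ∪
    ((Finset.range q).image (fun i => (5 * i + 1, 5 * i + 3)) ∪
    ((Finset.range q).image (fun i => (5 * i + 3, 5 * i + 5)) ∪
    (Finset.range q).image (fun i => (5 * i + 1, 5 * i + 5)))))))
  have hS : S.card ≤ 11 * q + 3 := by
    have c1 := Finset.card_image_le (s := Finset.range (5 * q + 1)) (f := fun a => (a, a + 1))
    have c2 := Finset.card_image_le (s := Finset.range (q + 1)) (f := fun i => (5 * i, 5 * q + 2))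
    have c3 := Finset.card_image_le (s := Finset.range (q + 1)) (f := fun i => (5 * i + 1, 5 * q + 2))
    have c4 := Finset.card_image_le (s := Finset.range q) (f := fun i => (5 * i + 3, 5 * q + 2))
    have c5 := Finset.card_image_le (s := Finset.range q) (f := fun i => (5 * i + 1, 5 * i + 3))
    have c6 := Finset.card_image_le (s := Finset.range q) (f := fun i => (5 * i + 3, 5 * i + 5))
    have c7 := Finset.card_image_le (s := Finset.range q) (f := fun i => (5 * i + 1, 5 * i + 5))
    simp only [Finset.card_range] at c1 c2 c3 c4 c5 c6 c7
    refine (Finset.card_union_le _ _).trans ?_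
    refine (add_le_add c1 ((Finset.card_union_le _ _).trans (add_le_add c2
      ((Finset.card_union_le _ _).trans (add_le_add c3 ((Finset.card_union_le _ _).trans
      (add_le_add c4 ((Finset.card_union_le _ _).trans (add_le_add c5
      ((Finset.card_union_le _ _).trans (add_le_add c6 c7))))))))))).trans ?_
    omega
  have hE : ∀ a b, EE q a b → (a, b) ∈ S := by
    rintro a b ⟨h1, h2, h3⟩
    simp only [S, Finset.mem_union, Finset.mem_image, Finset.mem_range, Prod.mk.injEq]
    rcases h3 with h3 | ⟨h3, h4 | h4 | h4⟩ | ⟨h3, h4 | h4 | h4⟩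
    · left; exact ⟨a, by omega, by omega⟩
    · right; left; exact ⟨a / 5, by omega, by omega⟩
    · right; right; left; exact ⟨a / 5, by omega, by omega⟩
    · right; right; right; left; exact ⟨a / 5, by omega, by omega⟩
    · right; right; right; right; left; exact ⟨a / 5, by omega, by omega⟩
    · right; right; right; right; right; left; exact ⟨a / 5, by omega, by omega⟩
    · right; right; right; right; right; right; exact ⟨a / 5, by omega, by omega⟩
  have hsub : (exG q).edgeSet ⊆ ((S.image (fun p => s(vt p.1, vt p.2)) : Finset _) : Set (Sym2 (Fin (5 * q + 3)))) := by
    intro e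
    induction e using Sym2.ind with
    | _ u v =>
      intro huv
      rw [SimpleGraph.mem_edgeSet] at huv
      rw [Finset.coe_image]
      rcases huv with huv | huv
      · exact ⟨(u.val, v.val), hE _ _ huv, by simp [hvt]⟩
      · exact ⟨(v.val, u.val), hE _ _ huv, by simp [hvt, Sym2.eq_swap]⟩
  calc _ ≤ ((S.image (fun p => s(vt p.1, vt p.2)) : Finset _) : Set (Sym2 (Fin (5 * q + 3)))).ncard :=
        Set.ncard_le_ncard hsub (Finset.finite_toSet _)
    _ = (S.image (fun p => s(vt p.1, vt p.2))).card := Set.ncard_coe_finset _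
    _ ≤ S.card := Finset.card_image_le
    _ ≤ _ := hS

lemma exG_block (q i : ℕ) (hi : i < q) (A : ℕ → ℕ → Prop) (hE : ∀ a b, EE q a b → A a b)
    (S1 S2 : ℕ → Prop)
    (F1 : ∀ y z, y < z → z ≤ 5 * q + 2 → A y z → ¬ (y = 5 * i + 1 ∧ z = 5 * i + 5) →
      y ≠ 5 * i + 3 → z ≠ 5 * i + 3 → z ≠ 5 * q + 2 → (S1 y ↔ S1 z))
    (F2 : ∀ y z, y < z → z ≤ 5 * q + 2 → A y z → ¬ (y = 5 * i + 3 ∧ z = 5 * q + 2) →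
      y ≠ 5 * i + 1 → z ≠ 5 * i + 1 → y ≠ 5 * i + 5 → z ≠ 5 * i + 5 → (S2 y ↔ S2 z))
    (F3 : ¬ (S1 (5 * i + 1) ↔ S1 (5 * i + 5))) (F4 : ¬ (S2 (5 * q + 2) ↔ S2 (5 * i + 3)))
    (a b : ℕ) (hai : a / 5 = i) (hab : a < b) (hb : b ≤ 5 * q + 2) (hA : A a b) : EE q a b := by
  have e1 : S1 (5 * i) ↔ S1 (5 * i + 1) :=
    F1 _ _ (by omega) (by omega) (hE _ _ (by unfold EE; omega)) (by omega) (by omega) (by omega) (by omega)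
  have e2 : S2 (5 * i) ↔ S2 (5 * q + 2) :=
    F2 _ _ (by omega) (by omega) (hE _ _ (by unfold EE; omega)) (by omega) (by omega) (by omega) (by omega) (by omega)
  have x1 : S1 (5 * i + 1) ↔ S1 (5 * i + 2) :=
    F1 _ _ (by omega) (by omega) (hE _ _ (by unfold EE; omega)) (by omega) (by omega) (by omega) (by omega)
  have x2 : S2 (5 * i + 2) ↔ S2 (5 * i + 3) :=
    F2 _ _ (by omega) (by omega) (hE _ _ (by unfold EE; omega)) (by omega) (by omega) (by omega) (by omega) (by omega)
  have y1 : S1 (5 * i + 4) ↔ S1 (5 * i + 5) :=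
    F1 _ _ (by omega) (by omega) (hE _ _ (by unfold EE; omega)) (by omega) (by omega) (by omega) (by omega)
  have y2 : S2 (5 * i + 3) ↔ S2 (5 * i + 4) :=
    F2 _ _ (by omega) (by omega) (hE _ _ (by unfold EE; omega)) (by omega) (by omega) (by omega) (by omega) (by omega)
  have r : ∀ k, 5 * i + 6 + k ≤ 5 * q + 1 →
      ((S1 (5 * i + 5) ↔ S1 (5 * i + 6 + k)) ∧ (S2 (5 * i + 6 + k) ↔ S2 (5 * q + 2))) := by
    intro k
    induction k with
    | zero =>
      intro hk
      exact ⟨F1 _ _ (by omega) (by omega) (hE _ _ (by unfold EE; omega)) (by omega) (by omega) (by omega) (by omega),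
        F2 _ _ (by omega) (by omega) (hE _ _ (by unfold EE; omega)) (by omega) (by omega) (by omega) (by omega) (by omega)⟩
    | succ k ih =>
      intro hk
      obtain ⟨h1, h2⟩ := ih (by omega)
      have a1 : S1 (5 * i + 6 + k) ↔ S1 (5 * i + 6 + (k + 1)) :=
        F1 _ _ (by omega) (by omega) (hE _ _ (by unfold EE; omega)) (by omega) (by omega) (by omega) (by omega)
      have a2 : S2 (5 * i + 6 + k) ↔ S2 (5 * i + 6 + (k + 1)) :=
        F2 _ _ (by omega) (by omega) (hE _ _ (by unfold EE; omega)) (by omega) (by omega) (by omega) (by omega) (by omega)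
      exact ⟨h1.trans a1, a2.symm.trans h2⟩
  have G1 := F1 a b hab hb hA
  have G2 := F2 a b hab hb hA
  clear F1 F2 hE hA
  have cases_a : a = 5 * i ∨ a = 5 * i + 1 ∨ a = 5 * i + 2 ∨ a = 5 * i + 3 ∨ a = 5 * i + 4 := by omega
  by_cases hright : 5 * i + 6 ≤ b ∧ b ≤ 5 * q + 1
  · obtain ⟨r1, r2⟩ := r (b - (5 * i + 6)) (by omega)
    rw [show 5 * i + 6 + (b - (5 * i + 6)) = b by omega] at r1 r2
    clear r
    exfalso
    rcases cases_a with rfl | rfl | rfl | rfl | rfl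
    · have := G1 (by omega) (by omega) (by omega) (by omega); grind
    · have := G1 (by omega) (by omega) (by omega) (by omega); grind
    · have := G1 (by omega) (by omega) (by omega) (by omega); grind
    · have := G2 (by omega) (by omega) (by omega) (by omega) (by omega); grind
    · have := G2 (by omega) (by omega) (by omega) (by omega) (by omega); grind
  clear r
  by_contra hne
  have cases_b : b = 5 * q + 2 ∨ b = 5 * i + 1 ∨ b = 5 * i + 2 ∨ b = 5 * i + 3 ∨ b = 5 * i + 4 ∨ b = 5 * i + 5 := by omega
  unfold EE at hne
  rcases cases_a with rfl | rfl | rfl | rfl | rfl <;> rcases cases_b with rfl | rfl | rfl | rfl | rfl | rfl <;>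
  first
  | (exfalso; omega)
  | (have := G1 (by omega) (by omega) (by omega) (by omega); grind)
  | (have := G2 (by omega) (by omega) (by omega) (by omega) (by omega); grind)

lemma side_of_not_alt {p q r s : ℝ} (h : ¬ altn p q r s) (h1 : r ≠ p) (h2 : r ≠ q) (h3 : s ≠ p)
    (h4 : s ≠ q) : btwn p q r ↔ btwn p q s := by
  unfold altn at h; by_cases u : btwn p q r <;> by_cases v : btwn p q s <;> simp_all

lemma alt_of_side {p q r s : ℝ} (h : ¬ (btwn p q r ↔ btwn p q s)) (h1 : r ≠ p) (h2 : r ≠ q) (h3 : s ≠ p)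
    (h4 : s ≠ q) : altn p q r s := by
  unfold altn; by_cases u : btwn p q r <;> by_cases v : btwn p q s <;> simp_all

lemma not_side_of_alt {p q r s : ℝ} (h : altn p q r s) : ¬ (btwn p q r ↔ btwn p q s) := by
  unfold altn at h; by_cases u : btwn p q r <;> by_cases v : btwn p q s <;> simp_all

lemma alt_comm {p q r s : ℝ} (h : altn p q r s) : altn r s p q := by
  unfold altn btwn at *
  grind

lemma four_pts {a b c d : ℝ} (h1 : a ≠ b) (h2 : a ≠ c) (h3 : a ≠ d) (h4 : b ≠ c) (h5 : b ≠ d)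
    (h6 : c ≠ d) : altn a b c d ∨ altn a c b d ∨ altn a d b c := by
  unfold altn btwn
  grind

lemma ear {V : Type} (H : SimpleGraph V) (x : V → ℝ) (hx : Function.Injective x) (hg : GoodOrd H x)
    (a b c d e : V) (hab : H.Adj a b) (hcd : H.Adj c d) (hea : H.Adj e a) (heb : H.Adj e b)
    (hec : e ≠ c) (hed : e ≠ d) : ¬ altn (x a) (x b) (x c) (x d) := by
  intro h
  have h' := alt_comm h
  have nab := not_side_of_alt h'
  have hne : x a ≠ x c ∧ x a ≠ x d ∧ x b ≠ x c ∧ x b ≠ x d := by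
    unfold altn btwn at h'; grind
  have hec' := hx.ne hec
  have hed' := hx.ne hed
  by_cases hs : btwn (x c) (x d) (x e) ↔ btwn (x c) (x d) (x a)
  · have : altn (x c) (x d) (x e) (x b) := alt_of_side (by tauto) hec' hed' hne.2.2.1 hne.2.2.2
    have := hg c d a b e b hcd hab heb h' this
    rw [Sym2.eq_iff] at this
    have := hea.ne; have := heb.ne
    grind
  · have : altn (x c) (x d) (x e) (x a) := alt_of_side (by tauto) hec' hed' hne.1 hne.2.1
    have := hg c d a b e a hcd hab hea h' this
    rw [Sym2.eq_iff] at this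
    have := hea.ne; have := heb.ne
    grind

lemma k4_lemma {V : Type} (H : SimpleGraph V) (x : V → ℝ) (hx : Function.Injective x) (hg : GoodOrd H x)
    (a b c d e f : V) (hab : H.Adj a b) (hbc : H.Adj b c) (hcd : H.Adj c d) (hda : H.Adj d a)
    (hac : H.Adj a c) (hbd : H.Adj b d) (hea : H.Adj e a) (heb : H.Adj e b) (hec : e ≠ c) (hed : e ≠ d)
    (hfb : H.Adj f b) (hfc : H.Adj f c) (hfa : f ≠ a) (hfd : f ≠ d) :
    altn (x a) (x c) (x b) (x d) ∧
    (∀ y z, H.Adj y z → altn (x a) (x c) (x y) (x z) → s(y, z) = s(b, d)) ∧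
    (∀ y z, H.Adj y z → altn (x b) (x d) (x y) (x z) → s(y, z) = s(a, c)) := by
  have h : altn (x a) (x c) (x b) (x d) := by
    rcases four_pts (hx.ne hab.ne) (hx.ne hac.ne) (hx.ne hda.ne') (hx.ne hbc.ne) (hx.ne hbd.ne)
      (hx.ne hcd.ne) with h | h | h
    · exact absurd h (ear H x hx hg a b c d e hab hcd hea heb hec hed)
    · exact h
    · exact absurd (altn_symm_right.1 (alt_comm h)) (ear H x hx hg b c d a f hbc hda hfb hfc hfd hfa)
  refine ⟨h, ?_, ?_⟩
  · intro y z hyz hal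
    exact hg a c y z b d hac hyz hbd hal h
  · intro y z hyz hal
    exact hg b d y z a c hbd hyz hac hal (alt_comm h)

lemma exG_max (q : ℕ) (H : SimpleGraph (Fin (5 * q + 3))) (hlt : exG q < H) : ¬ CombO1P H := by
  rintro ⟨x, hx, hg⟩
  apply hlt.not_ge
  let vt : ℕ → Fin (5 * q + 3) := Fin.ofNat (5 * q + 3)
  have hval : ∀ a, a ≤ 5 * q + 2 → (vt a).val = a := by
    intro a ha
    simp [vt, Nat.mod_eq_of_lt (show a < 5 * q + 3 by omega)]
  have hvt : ∀ v : Fin (5 * q + 3), vt v.val = v := fun v => Fin.ext (hval _ (by omega))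
  have hinj : ∀ a b, a ≤ 5 * q + 2 → b ≤ 5 * q + 2 → a ≠ b → vt a ≠ vt b := by
    intro a b ha hb hne h
    apply hne
    rw [← hval a ha, ← hval b hb, h]
  let A : ℕ → ℕ → Prop := fun a b => H.Adj (vt a) (vt b)
  have hE : ∀ a b, EE q a b → A a b := by
    intro a b h
    apply hlt.le
    left
    rwa [hval a (by have := h.1; have := h.2.1; omega), hval b h.2.1]
  have hEs : ∀ a b, EE q a b → A b a := fun a b h => (hE a b h).symm
  have main : ∀ a b, a < b → b ≤ 5 * q + 2 → A a b → EE q a b := by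
    intro a b hab hb hA
    by_cases hi : a / 5 < q
    · set i := a / 5 with hidef
      have k4 := k4_lemma H x hx hg (vt (5 * q + 2)) (vt (5 * i + 1)) (vt (5 * i + 3)) (vt (5 * i + 5))
        (vt (5 * i)) (vt (5 * i + 2))
        (hEs _ _ (by unfold EE; omega)) (hE _ _ (by unfold EE; omega)) (hE _ _ (by unfold EE; omega))
        (hE _ _ (by unfold EE; omega)) (hEs _ _ (by unfold EE; omega)) (hE _ _ (by unfold EE; omega))
        (hE _ _ (by unfold EE; omega)) (hE _ _ (by unfold EE; omega))
        (hinj _ _ (by omega) (by omega) (by omega)) (hinj _ _ (by omega) (by omega) (by omega))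
        (hEs _ _ (by unfold EE; omega)) (hE _ _ (by unfold EE; omega))
        (hinj _ _ (by omega) (by omega) (by omega)) (hinj _ _ (by omega) (by omega) (by omega))
      obtain ⟨k1, k2, k3⟩ := k4
      have seq : ∀ y z u v, y ≤ 5 * q + 2 → z ≤ 5 * q + 2 → u ≤ 5 * q + 2 → v ≤ 5 * q + 2 →
          s(vt y, vt z) = s(vt u, vt v) → (y = u ∧ z = v) ∨ (y = v ∧ z = u) := by
        intro y z u v hy hz hu hv h
        have inj' : ∀ a b, a ≤ 5 * q + 2 → b ≤ 5 * q + 2 → vt a = vt b → a = b := by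
          intro a b ha hb h
          by_contra hne
          exact hinj a b ha hb hne h
        rw [Sym2.eq_iff] at h
        rcases h with ⟨h1, h2⟩ | ⟨h1, h2⟩
        · exact Or.inl ⟨inj' _ _ hy hu h1, inj' _ _ hz hv h2⟩
        · exact Or.inr ⟨inj' _ _ hy hv h1, inj' _ _ hz hu h2⟩
      have xne : ∀ a b, a ≤ 5 * q + 2 → b ≤ 5 * q + 2 → a ≠ b → x (vt a) ≠ x (vt b) :=
        fun a b h1 h2 h3 => hx.ne (hinj a b h1 h2 h3)
      refine exG_block q i hi A hE
        (fun y => btwn (x (vt (5 * q + 2))) (x (vt (5 * i + 3))) (x (vt y)))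
        (fun y => btwn (x (vt (5 * i + 1))) (x (vt (5 * i + 5))) (x (vt y)))
        ?_ ?_ ?_ ?_ a b rfl hab hb hA
      · intro y z hyz hz hyzA h1 h2 h3 h4
        apply side_of_not_alt
        · intro hal
          have := seq _ _ _ _ (by omega) (by omega) (by omega) (by omega) (k2 _ _ hyzA hal)
          omega
        · exact xne _ _ (by omega) (by omega) (by omega)
        · exact xne _ _ (by omega) (by omega) (by omega)
        · exact xne _ _ (by omega) (by omega) (by omega)
        · exact xne _ _ (by omega) (by omega) (by omega)
      · intro y z hyz hz hyzA h1 h2 h3 h4 h5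
        apply side_of_not_alt
        · intro hal
          have := seq _ _ _ _ (by omega) (by omega) (by omega) (by omega) (k3 _ _ hyzA hal)
          omega
        · exact xne _ _ (by omega) (by omega) (by omega)
        · exact xne _ _ (by omega) (by omega) (by omega)
        · exact xne _ _ (by omega) (by omega) (by omega)
        · exact xne _ _ (by omega) (by omega) (by omega)
      · exact not_side_of_alt k1
      · exact not_side_of_alt (alt_comm k1)
    · unfold EE; omega
  intro u v huv
  rcases lt_trichotomy u.val v.val with h | h | h
  · left
    exact main _ _ h (by omega) (by simpa [A, hvt] using huv)
  · exact absurd (Fin.ext h) huv.ne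
  · right
    exact main _ _ h (by omega) (by simpa [A, hvt] using huv.symm)

open unitInterval in
theorem log_change (g h : C(I, ℂ)) (u : ℂ) (hu : u ≠ 0) (hg : ∀ s, Complex.exp (g s) = h s)
    (hs : ∀ s, u * h s ∈ Complex.slitPlane) :
    g 1 - g 0 = Complex.log (u * h 1) - Complex.log (u * h 0) := by
  have key := Complex.isCoveringMap_exp.const_of_comp (A := I)
    (g := fun s => g s - Complex.log (u * h s)) (by
      refine (map_continuous g).sub ?_
      exact Continuous.clog (by fun_prop) hs) (by
      intro s s'
      apply Subtype.ext
      have : ∀ s, Complex.exp (g s - Complex.log (u * h s)) = u⁻¹ := by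
        intro s
        have h0 : h s ≠ 0 := by rw [← hg]; exact Complex.exp_ne_zero _
        rw [Complex.exp_sub, Complex.exp_log (mul_ne_zero hu h0), hg]
        field_simp
      simp only [this]) 1 0
  linear_combination key

theorem argI_pos {x : ℝ} (hx : 0 < x) : (Complex.log (Complex.I * x)).im = Real.pi / 2 := by
  rw [Complex.log_im, mul_comm, Complex.arg_real_mul _ hx, Complex.arg_I]

theorem argI_neg {x : ℝ} (hx : x < 0) : (Complex.log (Complex.I * x)).im = - (Real.pi / 2) := by
  have : Complex.I * x = ((-x : ℝ) : ℂ) * (-Complex.I) := by push_cast; ring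
  rw [Complex.log_im, this, Complex.arg_real_mul _ (by linarith), Complex.arg_neg_I]

open unitInterval in
theorem half_plane_cross {A B : Set ℂ} (hA : ∀ z ∈ A, 0 ≤ z.im) (hB : ∀ z ∈ B, 0 ≤ z.im)
    {a b c d : ℝ} (hab : a < b) (hbc : b < c) (hcd : c < d)
    (h1 : JoinedIn A (a:ℂ) c) (h2 : JoinedIn B (b:ℂ) d) : (A ∩ B).Nonempty := by
  by_contra hne
  have hdis : ∀ z ∈ A, z ∉ B := fun z hz hz' => hne ⟨z, hz, hz'⟩
  obtain ⟨α, hα⟩ := h1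
  obtain ⟨β, hβ⟩ := h2
  have hn : ∀ s t, α s - β t ≠ 0 := by
    intro s t h
    have := hα s
    rw [sub_eq_zero.1 h] at this
    exact hdis _ this (hβ t)
  let H : C(I × I, {z : ℂ // z ≠ 0}) := ⟨fun p => ⟨α p.1 - β p.2, hn _ _⟩, by fun_prop⟩
  let γ : C(I, {z : ℂ // z ≠ 0}) := ⟨fun t => ⟨α 0 - β t, hn _ _⟩, by fun_prop⟩
  obtain ⟨Γ, hΓ, -⟩ := Complex.isCoveringMap_exp.exists_path_lifts γ (Complex.log (γ 0).1)
    (Subtype.ext (Complex.exp_log (γ 0).2).symm)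
  have H0 : ∀ t, H (0, t) = (fun z : ℂ ↦ (⟨_, z.exp_ne_zero⟩ : {z : ℂ // z ≠ 0})) (Γ t) :=
    fun t => (congrFun hΓ t).symm
  have hlift := Complex.isCoveringMap_exp.liftHomotopy_lifts H Γ H0
  generalize Complex.isCoveringMap_exp.liftHomotopy H Γ H0 = g at hlift
  have hg : ∀ s t, Complex.exp (g (s,t)) = α s - β t := fun s t =>
    congrArg Subtype.val (congrFun hlift (s,t))
  have slit : ∀ z : ℂ, z ≠ 0 → 0 ≤ z.im → -Complex.I * z ∈ Complex.slitPlane := by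
    intro z hz hi
    rw [Complex.mem_slitPlane_iff]
    simp
    rcases hi.lt_or_eq with h | h
    · exact Or.inl h
    · right; intro h'; exact hz (Complex.ext h' h.symm)
  have slit' : ∀ z : ℂ, z ≠ 0 → z.im ≤ 0 → Complex.I * z ∈ Complex.slitPlane := by
    intro z hz hi
    have := slit (-z) (neg_ne_zero.2 hz) (by simpa using hi)
    simpa using this
  have e1 := log_change ⟨fun s => g (s, 0), by fun_prop⟩ ⟨fun s => α s - β 0, by fun_prop⟩
    (-Complex.I) (by simp) (fun s => hg s 0)
    (fun s => slit _ (hn _ _) (by simpa using hA _ (hα s)))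
  have e2 := log_change ⟨fun s => g (s, 1), by fun_prop⟩ ⟨fun s => α s - β 1, by fun_prop⟩
    (-Complex.I) (by simp) (fun s => hg s 1)
    (fun s => slit _ (hn _ _) (by simpa using hA _ (hα s)))
  have e3 := log_change ⟨fun s => g (0, s), by fun_prop⟩ ⟨fun s => α 0 - β s, by fun_prop⟩
    (Complex.I) (by simp) (fun s => hg 0 s)
    (fun s => slit' _ (hn _ _) (by simpa using hB _ (hβ s)))
  have e4 := log_change ⟨fun s => g (1, s), by fun_prop⟩ ⟨fun s => α 1 - β s, by fun_prop⟩
    (Complex.I) (by simp) (fun s => hg 1 s)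
    (fun s => slit' _ (hn _ _) (by simpa using hB _ (hβ s)))
  simp only [ContinuousMap.coe_mk, Path.source, Path.target] at e1 e2 e3 e4
  have r : ∀ x y : ℝ, -Complex.I * ((x:ℂ) - y) = Complex.I * ((y - x : ℝ) : ℂ) := by
    intro x y; push_cast; ring
  have r' : ∀ x y : ℝ, Complex.I * ((x:ℂ) - y) = Complex.I * ((x - y : ℝ) : ℂ) := by
    intro x y; push_cast; ring
  rw [r, r] at e1 e2
  rw [r', r'] at e3 e4
  have f1 := congrArg Complex.im e1
  have f2 := congrArg Complex.im e2
  have f3 := congrArg Complex.im e3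
  have f4 := congrArg Complex.im e4
  simp only [Complex.sub_im] at f1 f2 f3 f4
  rw [argI_neg (by linarith), argI_pos (by linarith)] at f1
  rw [argI_pos (by linarith), argI_pos (by linarith)] at f2
  rw [argI_neg (by linarith), argI_neg (by linarith)] at f3
  rw [argI_neg (by linarith), argI_pos (by linarith)] at f4
  have := Real.pi_pos
  linarith

theorem trunc_one {Γ C : Set ℂ} {z c : ℂ} (hC : IsClosed C) (hz : z ∉ C) (hc : c ∈ C)
    (h : JoinedIn Γ z c) : ∃ Γ' c', Γ' ⊆ Γ ∧ IsCompact Γ' ∧ JoinedIn Γ' z c' ∧ c' ∈ C ∧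
      (∀ p ∈ Γ', p ∈ C → p = c') ∧ c' ∉ interior C := by
  obtain ⟨γ, hγ⟩ := h
  have hcont : Continuous γ.extend := γ.continuous_extend
  have hcomp : IsCompact (Icc (0:ℝ) 1 ∩ γ.extend ⁻¹' C) :=
    isCompact_Icc.inter_right (hC.preimage hcont)
  obtain ⟨T, ⟨⟨hT0, hT1⟩, hTC⟩, hTmin⟩ := hcomp.exists_isLeast
    ⟨1, by simp, by simpa using hc⟩
  have hTpos : 0 < T := by
    rcases hT0.lt_or_eq with h | h
    · exact h
    · exfalso; apply hz; rw [← h] at hTC; simpa using hTC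
  have hlt : ∀ t, 0 ≤ t → t < T → γ.extend t ∉ C := fun t h0 ht hC' =>
    absurd (hTmin ⟨⟨h0, ht.le.trans hT1⟩, hC'⟩) (not_le.2 ht)
  refine ⟨γ.extend '' Icc 0 T, γ.extend T, ?_, isCompact_Icc.image hcont, ?_, hTC, ?_, ?_⟩
  · rintro _ ⟨t, -, rfl⟩
    exact hγ _
  · refine JoinedIn.ofLine (f := fun t => γ.extend (T * t)) ?_ ?_ ?_ ?_
    · exact (hcont.comp (by fun_prop)).continuousOn
    · simp
    · simp
    · rintro _ ⟨t, ht, rfl⟩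
      exact ⟨T * t, ⟨mul_nonneg hT0 ht.1, mul_le_of_le_one_right hT0 ht.2⟩, rfl⟩
  · rintro _ ⟨t, ht, rfl⟩ hp
    rcases ht.2.lt_or_eq with h | h
    · exact absurd hp (hlt t ht.1 h)
    · rw [h]
  · intro hcint
    have h1 : ∀ᶠ t in nhdsWithin T (Iio T), γ.extend t ∈ interior C :=
      (hcont.continuousAt.eventually (isOpen_interior.mem_nhds hcint)).filter_mono
        nhdsWithin_le_nhds
    have h2 : ∀ᶠ t in nhdsWithin T (Iio T), t ∈ Ioo 0 T := Ioo_mem_nhdsLT hTpos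
    obtain ⟨t, ht, ht'⟩ := (h1.and h2).exists
    exact hlt t ht'.1.le ht'.2 (interior_subset ht)

/-- Disjoint arms from the points `z i` through `F` to points `c i` of `C`. -/
def StarArms {V : Type} (F : Set ℂ) (z : V → ℂ) (S : Finset V) (C : Set ℂ)
    (Γ : V → Set ℂ) (c : V → ℂ) : Prop :=
  (∀ i ∈ S, IsCompact (Γ i) ∧ JoinedIn (Γ i) (z i) (c i) ∧ Γ i ⊆ insert (z i) F ∧ c i ∈ C) ∧
  ∀ i ∈ S, ∀ j ∈ S, i ≠ j → Disjoint (Γ i) (Γ j)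

theorem StarArms.mono {V : Type} {F : Set ℂ} {z : V → ℂ} {S : Finset V} {C C' : Set ℂ}
    {Γ : V → Set ℂ} {c : V → ℂ} (h : StarArms F z S C Γ c) (hC : C ⊆ C') : StarArms F z S C' Γ c :=
  ⟨fun i hi => ⟨(h.1 i hi).1, (h.1 i hi).2.1, (h.1 i hi).2.2.1, hC (h.1 i hi).2.2.2⟩, h.2⟩

theorem StarArms.trunc {V : Type} {F : Set ℂ} {z : V → ℂ} {S : Finset V} {C : Set ℂ}
    {Γ : V → Set ℂ} {c : V → ℂ} (h : StarArms F z S C Γ c) (hC : IsClosed C) (hCF : C ⊆ F)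
    (hz : ∀ i, z i ∉ F) :
    ∃ Γ' c', StarArms F z S C Γ' c' ∧ ∀ i ∈ S, Γ' i ⊆ Γ i ∧ (∀ p ∈ Γ' i, p ∈ C → p = c' i) ∧
      c' i ∉ interior C := by
  have : ∀ i, ∃ Γ' c', i ∈ S → Γ' ⊆ Γ i ∧ IsCompact Γ' ∧ JoinedIn Γ' (z i) c' ∧ c' ∈ C ∧
      (∀ p ∈ Γ', p ∈ C → p = c') ∧ c' ∉ interior C := by
    intro i
    by_cases hi : i ∈ S
    · obtain ⟨Γ', c', h'⟩ := trunc_one hC (fun h => hz i (hCF h)) (h.1 i hi).2.2.2 (h.1 i hi).2.1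
      exact ⟨Γ', c', fun _ => h'⟩
    · exact ⟨∅, 0, fun h => absurd h hi⟩
  choose Γ' c' h' using this
  refine ⟨Γ', c', ⟨fun i hi => ⟨(h' i hi).2.1, (h' i hi).2.2.1,
    (h' i hi).1.trans (h.1 i hi).2.2.1, (h' i hi).2.2.2.1⟩, fun i hi j hj hij =>
    (h.2 i hi j hj hij).mono (h' i hi).1 (h' j hj).1⟩, fun i hi => ⟨(h' i hi).1,
    (h' i hi).2.2.2.2.1, (h' i hi).2.2.2.2.2⟩⟩

theorem StarArms.shrink {V : Type} {F : Set ℂ} {z : V → ℂ} {S : Finset V} {C : Set ℂ}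
    {Γ : V → Set ℂ} {c : V → ℂ} (h : StarArms F z S C Γ c) (hC : IsClosed C) (hCc : Convex ℝ C)
    (hCF : C ⊆ F) (hz : ∀ i, z i ∉ F) {o : ℂ} {ρ : ℝ} (hρ : 0 < ρ)
    (ho : Metric.closedBall o ρ ⊆ C) :
    ∃ Γ' c', StarArms F z S (Metric.closedBall o ρ) Γ' c' ∧ ∀ i ∈ S, Γ' i ⊆ Γ i ∪ C := by
  obtain ⟨Γ₁, c₁, h₁, hs⟩ := h.trunc hC hCF hz
  have hoint : o ∈ interior C :=
    mem_interior.2 ⟨Metric.ball o ρ, Metric.ball_subset_closedBall.trans ho, Metric.isOpen_ball,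
      Metric.mem_ball_self hρ⟩
  have key : ∀ i ∈ S, ∀ j ∈ S, i ≠ j → ∀ κ : ℝ, 0 < κ → κ ≤ 1 → c₁ i ≠ o + κ • (c₁ j - o) := by
    intro i hi j hj hij κ h0 h1 heq
    rcases h1.lt_or_eq with h1 | h1
    · apply (hs i hi).2.2
      have := hCc.combo_interior_self_mem_interior hoint (h₁.1 j hj).2.2.2 (a := 1 - κ) (b := κ)
        (by linarith) h0.le (by ring)
      rw [heq]
      convert this using 1
      simp only [Complex.real_smul]; push_cast; ring
    · have e : c₁ i = c₁ j := by rw [heq, h1]; simp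
      exact (Set.disjoint_left.1 (h₁.2 i hi j hj hij)) (h₁.1 i hi).2.1.target_mem
        (e ▸ (h₁.1 j hj).2.1.target_mem)
  let lam : V → ℝ := fun i => ρ / (ρ + ‖c₁ i - o‖)
  have lpos : ∀ i, 0 < lam i := fun i => by positivity
  have lle : ∀ i, lam i ≤ 1 := fun i => by
    apply div_le_one_of_le₀ <;> [skip; positivity]
    linarith [norm_nonneg (c₁ i - o)]
  let c' : V → ℂ := fun i => o + lam i • (c₁ i - o)
  have hc' : ∀ i, c' i ∈ Metric.closedBall o ρ := by
    intro i
    have : dist (c' i) o = ρ / (ρ + ‖c₁ i - o‖) * ‖c₁ i - o‖ := by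
      rw [dist_eq_norm]
      simp only [c', lam, add_sub_cancel_left, norm_smul, Real.norm_eq_abs]
      rw [abs_of_pos (lpos i)]
    rw [Metric.mem_closedBall, this, div_mul_eq_mul_div, div_le_iff₀ (by positivity)]
    nlinarith [norm_nonneg (c₁ i - o)]
  have hseg : ∀ i, ∀ p ∈ segment ℝ (c₁ i) (c' i), ∃ μ : ℝ, 0 < μ ∧ μ ≤ 1 ∧
      p = o + μ • (c₁ i - o) := by
    rintro i p ⟨a, b, ha, hb, hab, rfl⟩
    refine ⟨a + b * lam i, ?_, ?_, ?_⟩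
    · rcases ha.lt_or_eq with h | h
      · have := mul_nonneg hb (lpos i).le
        linarith
      · have : b = 1 := by linarith
        rw [← h, this]; linarith [lpos i]
    · nlinarith [lle i]
    · have : (a:ℂ) = 1 - b := by rw [eq_sub_iff_add_eq]; exact_mod_cast hab
      simp only [c', Complex.real_smul]; push_cast; rw [this]; ring
  have hsegC : ∀ i ∈ S, segment ℝ (c₁ i) (c' i) ⊆ C := fun i hi =>
    hCc.segment_subset (h₁.1 i hi).2.2.2 (ho (hc' i))
  have d1 : ∀ i ∈ S, ∀ j ∈ S, i ≠ j → Disjoint (Γ₁ i) (segment ℝ (c₁ j) (c' j)) := by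
    intro i hi j hj hij
    rw [Set.disjoint_left]
    intro p hp hp'
    have e := (hs i hi).2.1 p hp (hsegC j hj hp')
    obtain ⟨μ, m0, m1, e'⟩ := hseg j p hp'
    exact key i hi j hj hij μ m0 m1 (e ▸ e')
  have d2 : ∀ i ∈ S, ∀ j ∈ S, i ≠ j →
      Disjoint (segment ℝ (c₁ i) (c' i)) (segment ℝ (c₁ j) (c' j)) := by
    intro i hi j hj hij
    rw [Set.disjoint_left]
    intro p hp hp'
    obtain ⟨μ, m0, m1, e⟩ := hseg i p hp
    obtain ⟨ν, n0, n1, e'⟩ := hseg j p hp'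
    have e2 : μ • (c₁ i - o) = ν • (c₁ j - o) := by
      rw [e] at e'; exact add_left_cancel e'
    have hμ : (μ:ℂ) ≠ 0 := by exact_mod_cast m0.ne'
    have hν : (ν:ℂ) ≠ 0 := by exact_mod_cast n0.ne'
    simp only [Complex.real_smul] at e2
    rcases le_total μ ν with hle | hle
    · refine key j hj i hi (Ne.symm hij) (μ / ν) (by positivity) (by rwa [div_le_one n0]) ?_
      simp only [Complex.real_smul]; push_cast
      field_simp
      linear_combination -e2
    · refine key i hi j hj hij (ν / μ) (by positivity) (by rwa [div_le_one m0]) ?_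
      simp only [Complex.real_smul]; push_cast
      field_simp
      linear_combination e2
  refine ⟨fun i => Γ₁ i ∪ segment ℝ (c₁ i) (c' i), c', ⟨fun i hi => ⟨?_, ?_, ?_, hc' i⟩, ?_⟩, ?_⟩
  · refine (h₁.1 i hi).1.union ?_
    rw [segment_eq_image_lineMap]
    exact isCompact_Icc.image AffineMap.lineMap_continuous
  · exact ((h₁.1 i hi).2.1.mono subset_union_left).trans
      (JoinedIn.of_segment_subset subset_union_right)
  · exact union_subset (h₁.1 i hi).2.2.1
      (((hsegC i hi).trans hCF).trans (subset_insert _ _))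
  · intro i hi j hj hij
    rw [disjoint_union_left, disjoint_union_right, disjoint_union_right]
    exact ⟨⟨h₁.2 i hi j hj hij, d1 i hi j hj hij⟩, (d1 j hj i hi (Ne.symm hij)).symm,
      d2 i hi j hj hij⟩
  · intro i hi
    exact union_subset ((hs i hi).1.trans subset_union_left)
      ((hsegC i hi).trans subset_union_right)

theorem star_exists {V : Type} {F : Set ℂ} {z w : V → ℂ} (hF : IsOpen F) (hFc : IsPreconnected F)
    (hz : ∀ i, z i ∉ F) (hzi : Function.Injective z) (hw : ∀ i, w i ∈ F)
    (hzw : ∀ i, ∀ t ∈ Ioc (0:ℝ) 1, z i + t • (w i - z i) ∈ F) (S : Finset V) :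
    ∀ o ∈ F, ∃ ρ > 0, Metric.closedBall o ρ ⊆ F ∧ ∃ Γ c, StarArms F z S (Metric.closedBall o ρ) Γ c := by
  classical
  have small : ∀ {U : Set ℂ} {o : ℂ}, IsOpen U → o ∈ U → ∃ ρ > 0, Metric.closedBall o ρ ⊆ U :=
    fun {U o} hU ho => Metric.nhds_basis_closedBall.mem_iff.1 (hU.mem_nhds ho)
  have move : ∀ (S : Finset V) (x : ℂ), x ∈ F → (∃ ρ > 0, Metric.closedBall x ρ ⊆ F ∧
      ∃ Γ c, StarArms F z S (Metric.closedBall x ρ) Γ c) → ∀ y ∈ F, ∃ ρ > 0,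
      Metric.closedBall y ρ ⊆ F ∧ ∃ Γ c, StarArms F z S (Metric.closedBall y ρ) Γ c := by
    intro S x hx hQ y hy
    let Q : ℂ → Prop := fun x => ∃ ρ > 0, Metric.closedBall x ρ ⊆ F ∧
      ∃ Γ c, StarArms F z S (Metric.closedBall x ρ) Γ c
    have step : ∀ p R, Metric.closedBall p R ⊆ F → ∀ x ∈ Metric.ball p R,
        ∀ y ∈ Metric.ball p R, Q x → Q y := by
      rintro p R hpR x hx y hy ⟨ρ, hρ, hρF, Γ, c, hst⟩
      obtain ⟨ρ₁, hρ₁, hb₁⟩ := small Metric.isOpen_ball hx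
      obtain ⟨ρ₂, hρ₂, hb₂⟩ := small Metric.isOpen_ball hy
      obtain ⟨Γ', c', h', -⟩ := hst.shrink Metric.isClosed_closedBall (convex_closedBall _ _) hρF hz
        (ρ := min ρ ρ₁) (o := x) (by positivity) (Metric.closedBall_subset_closedBall (min_le_left _ _))
      have h2 := h'.mono (C' := Metric.closedBall p R)
        ((Metric.closedBall_subset_closedBall (min_le_right _ _)).trans
          (hb₁.trans Metric.ball_subset_closedBall))
      have hb2' := hb₂.trans (Metric.ball_subset_closedBall (x := p) (ε := R))
      obtain ⟨Γ'', c'', h'', -⟩ := h2.shrink Metric.isClosed_closedBall (convex_closedBall _ _)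
        hpR hz hρ₂ hb2'
      exact ⟨ρ₂, hρ₂, hb2'.trans hpR, Γ'', c'', h''⟩
    have := hFc.induction₂ (fun x y => Q x ↔ Q y) (fun p hp => by
      obtain ⟨R, hR, hb⟩ := small hF hp
      filter_upwards [nhdsWithin_le_nhds (Metric.ball_mem_nhds p hR)] with q hq
      exact ⟨step p R hb p (Metric.mem_ball_self hR) q hq, step p R hb q hq p (Metric.mem_ball_self hR)⟩)
      (fun _ _ _ _ _ _ h1 h2 => h1.trans h2) (fun _ _ _ _ h => h.symm) hx hy
    exact this.1 hQ
  induction S using Finset.induction_on with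
  | empty =>
    intro o ho
    obtain ⟨ρ, hρ, hb⟩ := small hF ho
    exact ⟨ρ, hρ, hb, fun _ => ∅, fun _ => 0, by simp [StarArms]⟩
  | insert j S hj ih =>
    refine move _ (w j) (hw j) ?_
    obtain ⟨ρ, hρ, hρF, Γ, c, hst⟩ := ih (w j) (hw j)
    have hcl : IsClosed ((⋃ i ∈ S, Γ i) ∪ Metric.closedBall (w j) ρ) :=
      (S.finite_toSet.isClosed_biUnion fun i hi => (hst.1 i hi).1.isClosed).union
        Metric.isClosed_closedBall
    have hzj : z j ∈ ((⋃ i ∈ S, Γ i) ∪ Metric.closedBall (w j) ρ)ᶜ := by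
      rintro (h | h)
      · simp only [mem_iUnion] at h
        obtain ⟨i, hi, h⟩ := h
        rcases (hst.1 i hi).2.2.1 h with h | h
        · exact hj (hzi h ▸ hi)
        · exact hz j h
      · exact hz j (hρF h)
    obtain ⟨η, hη, hbη⟩ := small hcl.isOpen_compl hzj
    let τ : ℝ := η / (η + ‖w j - z j‖)
    have τpos : 0 < τ := by positivity
    have τle : τ ≤ 1 := by
      apply div_le_one_of_le₀ <;> [skip; positivity]
      linarith [norm_nonneg (w j - z j)]
    let z1 : ℂ := z j + τ • (w j - z j)
    have hz1 : z1 ∈ Metric.closedBall (z j) η := by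
      have : dist z1 (z j) = η / (η + ‖w j - z j‖) * ‖w j - z j‖ := by
        rw [dist_eq_norm]
        simp only [z1, add_sub_cancel_left, norm_smul, Real.norm_eq_abs]
        rw [abs_of_pos τpos]
      rw [Metric.mem_closedBall, this, div_mul_eq_mul_div, div_le_iff₀ (by positivity)]
      nlinarith [norm_nonneg (w j - z j)]
    have hsegη : segment ℝ (z j) z1 ⊆ Metric.closedBall (z j) η :=
      (convex_closedBall _ _).segment_subset (Metric.mem_closedBall_self hη.le) hz1
    have hcomp : ∀ a b : ℂ, IsCompact (segment ℝ a b) := by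
      intro a b
      rw [segment_eq_image_lineMap]
      exact isCompact_Icc.image AffineMap.lineMap_continuous
    have hsegF : segment ℝ z1 (w j) ⊆ F := by
      rintro _ ⟨a, b, ha, hb, hab, rfl⟩
      have := hzw j (a * τ + b) ⟨?_, ?_⟩
      · convert this using 1
        have : (a:ℂ) = 1 - b := by rw [eq_sub_iff_add_eq]; exact_mod_cast hab
        simp only [z1, Complex.real_smul]; push_cast; rw [this]; ring
      · rcases ha.lt_or_eq with h | h
        · have := mul_pos h τpos
          linarith
        · have : b = 1 := by linarith
          rw [← h, this]; norm_num
      · nlinarith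
    have hsegF' : segment ℝ (z j) z1 ⊆ insert (z j) F := by
      rintro _ ⟨a, b, ha, hb, hab, rfl⟩
      rcases hb.lt_or_eq with h | h
      · right
        have := hzw j (b * τ) ⟨mul_pos h τpos, by nlinarith⟩
        convert this using 1
        have : (a:ℂ) = 1 - b := by rw [eq_sub_iff_add_eq]; exact_mod_cast hab
        simp only [z1, Complex.real_smul]; push_cast; rw [this]; ring
      · left
        have : a = 1 := by linarith
        rw [← h, this]; simp
    obtain ⟨δ, hδ, hδF⟩ := (hcomp z1 (w j)).exists_cthickening_subset_open hF hsegF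
    obtain ⟨Γ', c', h', hsub⟩ := hst.shrink Metric.isClosed_closedBall (convex_closedBall _ _)
      hρF hz (ρ := min ρ δ) (o := w j) (by positivity)
      (Metric.closedBall_subset_closedBall (min_le_left _ _))
    have hCsub : Metric.closedBall (w j) δ ⊆ Metric.cthickening δ (segment ℝ z1 (w j)) :=
      Metric.closedBall_subset_cthickening (right_mem_segment ℝ _ _) δ
    have hd : ∀ i ∈ S, Disjoint (Γ' i) (segment ℝ (z j) z1) := by
      intro i hi
      rw [Set.disjoint_left]
      intro p hp hp'
      refine hbη (hsegη hp') ?_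
      rcases hsub i hi hp with h | h
      · left; simp only [mem_iUnion]; exact ⟨i, hi, h⟩
      · right; exact h
    have hne : ∀ i ∈ S, i ≠ j := fun i hi h => hj (h ▸ hi)
    have hbig : StarArms F z (insert j S) (Metric.cthickening δ (segment ℝ z1 (w j)))
        (fun i => if i = j then segment ℝ (z j) z1 else Γ' i)
        (fun i => if i = j then z1 else c' i) := by
      refine ⟨fun i hi => ?_, ?_⟩
      · rcases Finset.mem_insert.1 hi with h | h
        · subst h
          simp only [if_true]
          exact ⟨hcomp _ _, JoinedIn.of_segment_subset subset_rfl, hsegF',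
            Metric.self_subset_cthickening _ (left_mem_segment ℝ _ _)⟩
        · simp only [hne i h, if_false]
          have := h'.1 i h
          exact ⟨this.1, this.2.1, this.2.2.1,
            hCsub (Metric.closedBall_subset_closedBall (min_le_right _ _) this.2.2.2)⟩
      · intro i hi k hk hik
        rcases Finset.mem_insert.1 hi with h | h <;> rcases Finset.mem_insert.1 hk with h2 | h2
        · exact absurd (h.trans h2.symm) hik
        · simp only [h, hne k h2, if_true, if_false]
          exact (hd k h2).symm
        · simp only [h2, hne i h, if_true, if_false]
          exact hd i h
        · simp only [hne i h, hne k h2, if_false]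
          exact h'.2 i h k h2 hik
    obtain ⟨Γ'', c'', h'', -⟩ := hbig.shrink Metric.isClosed_cthickening
      ((convex_segment _ _).cthickening δ) hδF hz hδ hCsub
    exact ⟨δ, hδ, hCsub.trans hδF, Γ'', c'', h''⟩

theorem half_plane_altn {A B : Set ℂ} (hA : ∀ z ∈ A, 0 ≤ z.im) (hB : ∀ z ∈ B, 0 ≤ z.im)
    {p q r s : ℝ} (halt : altn p q r s)
    (h1 : JoinedIn A (p:ℂ) q) (h2 : JoinedIn B (r:ℂ) s) : (A ∩ B).Nonempty := by
  have n : ∀ {s : ℝ}, ¬btwn p q s → s ≠ p → s ≠ q → (s < p ∧ s < q) ∨ (p < s ∧ q < s) := by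
    intro s h a b
    unfold btwn at h
    push Not at h
    rcases lt_or_gt_of_ne a with a | a <;> rcases lt_or_gt_of_ne b with b | b
    · exact Or.inl ⟨a, b⟩
    · have := h.2 b; linarith
    · have := h.1 a; linarith
    · exact Or.inr ⟨a, b⟩
  have sw : (B ∩ A).Nonempty → (A ∩ B).Nonempty := fun h => by rwa [inter_comm]
  rcases halt with ⟨hr, hs, a, b⟩ | ⟨hr, hs, a, b⟩
  · rcases hr with ⟨u, v⟩ | ⟨u, v⟩ <;> rcases n hs a b with ⟨x, y⟩ | ⟨x, y⟩
    · exact sw (half_plane_cross hB hA x u v h2.symm h1)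
    · exact half_plane_cross hA hB u v y h1 h2
    · exact sw (half_plane_cross hB hA y u v h2.symm h1.symm)
    · exact half_plane_cross hA hB u v x h1.symm h2
  · rcases hr with ⟨u, v⟩ | ⟨u, v⟩ <;> rcases n hs a b with ⟨x, y⟩ | ⟨x, y⟩
    · exact sw (half_plane_cross hB hA x u v h2 h1)
    · exact half_plane_cross hA hB u v y h1 h2.symm
    · exact sw (half_plane_cross hB hA y u v h2 h1.symm)
    · exact half_plane_cross hA hB u v x h1.symm h2.symm

theorem circle_order {V : Type} [Finite V] (o : ℂ) {ρ : ℝ} (hρ : 0 < ρ) (c : V → ℂ)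
    (hc : Function.Injective c) (hcs : ∀ i, dist (c i) o = ρ) :
    ∃ x : V → ℝ, Function.Injective x ∧ ∀ (A B : Set ℂ) (i j k l : V),
      (∀ p ∈ A, p ∈ Metric.closedBall o ρ → p ∈ range c) →
      (∀ p ∈ B, p ∈ Metric.closedBall o ρ → p ∈ range c) →
      altn (x i) (x j) (x k) (x l) → JoinedIn A (c i) (c j) → JoinedIn B (c k) (c l) →
      (A ∩ B).Nonempty := by
  have hinf : (Metric.sphere o ρ).Infinite := by
    apply Set.infinite_of_injective_forall_mem (f := fun n : ℕ =>
      o + ρ * Complex.exp ((1 / ((n:ℝ) + 1) : ℝ) * Complex.I))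
    · intro m n h
      have h1 : Complex.exp ((1 / ((m:ℝ) + 1) : ℝ) * Complex.I)
          = Complex.exp ((1 / ((n:ℝ) + 1) : ℝ) * Complex.I) := by
        have := add_left_cancel h
        exact mul_left_cancel₀ (by exact_mod_cast hρ.ne') this
      have h2 := congrArg Complex.arg h1
      have hr : ∀ n : ℕ, (1 / ((n:ℝ) + 1)) ∈ Ioc (-Real.pi) Real.pi := by
        intro n
        have a : 0 < (1 / ((n:ℝ) + 1)) := by positivity
        have b : (1 / ((n:ℝ) + 1)) ≤ 1 := by
          rw [div_le_one (by positivity)]; linarith [(Nat.cast_nonneg n : (0:ℝ) ≤ n)]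
        have := Real.pi_gt_three
        constructor <;> linarith
      rw [Complex.arg_exp_mul_I, Complex.arg_exp_mul_I,
        (toIocMod_eq_self _).2, (toIocMod_eq_self _).2] at h2
      · have := one_div_one_div ((m:ℝ) + 1)
        rw [h2, one_div_one_div] at this
        have : (m:ℝ) = n := by linarith
        exact_mod_cast this
      · have := hr n; constructor <;> linarith [this.1, this.2]
      · have := hr m; constructor <;> linarith [this.1, this.2]
    · intro n
      rw [mem_sphere_iff_norm, add_sub_cancel_left, norm_mul, Complex.norm_exp_ofReal_mul_I]
      simp [hρ.le]
  obtain ⟨p0, hp0, hp0c⟩ := hinf.exists_notMem_finite (Set.finite_range c)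
  have hq : p0 - o ≠ 0 := by
    intro h
    rw [mem_sphere_iff_norm, h, norm_zero] at hp0
    exact hρ.ne hp0
  let w : ℂ → ℂ := fun z => (z - o) / (p0 - o)
  have hw1 : ∀ z, z ≠ p0 → w z - 1 ≠ 0 := by
    intro z hz h
    apply hz
    have : (z - o) / (p0 - o) = 1 := by linear_combination h
    rw [div_eq_one_iff_eq hq] at this
    linear_combination this
  have hwn : ∀ z, ‖w z‖ = dist z o / ρ := by
    intro z
    rw [mem_sphere_iff_norm] at hp0
    simp only [w, norm_div, hp0, dist_eq_norm]
  let φ : ℂ → ℂ := fun z => Complex.I * ((w z + 1) / (w z - 1))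
  have him : ∀ z, (φ z).im = (‖w z‖ ^ 2 - 1) / Complex.normSq (w z - 1) := by
    intro z
    simp only [φ, Complex.I_mul_im, Complex.div_re, ← Complex.normSq_eq_norm_sq,
      Complex.normSq_apply (w z)]
    rw [← add_div]
    congr 1
    simp; ring
  have hinj : ∀ z z', z ≠ p0 → z' ≠ p0 → φ z = φ z' → z = z' := by
    intro z z' hz hz' h
    have h1 := hw1 z hz
    have h2 := hw1 z' hz'
    have h3 := mul_left_cancel₀ Complex.I_ne_zero h
    rw [div_eq_div_iff h1 h2] at h3
    have h4 : w z = w z' := by linear_combination (-1/2) * h3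
    simp only [w] at h4
    rw [div_left_inj' hq] at h4
    linear_combination h4
  have hcp : ∀ i, c i ≠ p0 := fun i h => hp0c ⟨i, h⟩
  have hreal : ∀ i, φ (c i) = ((φ (c i)).re : ℂ) := by
    intro i
    apply Complex.ext
    · simp
    · rw [him, hwn, hcs, div_self hρ.ne']; simp
  have hall : ∀ A : Set ℂ, (∀ p ∈ A, p ∈ Metric.closedBall o ρ → p ∈ range c) →
      (∀ p ∈ A, p ≠ p0) ∧ (∀ p ∈ φ '' A, 0 ≤ p.im) ∧ ContinuousOn φ A := by
    intro A hA
    have hne : ∀ p ∈ A, p ≠ p0 := by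
      rintro p hp rfl
      exact hp0c (hA _ hp (Metric.sphere_subset_closedBall hp0))
    refine ⟨hne, ?_, ?_⟩
    · rintro _ ⟨p, hp, rfl⟩
      rw [him]
      apply div_nonneg _ (Complex.normSq_nonneg _)
      have : 1 ≤ ‖w p‖ := by
        rw [hwn, le_div_iff₀ hρ, one_mul]
        by_contra hlt
        push Not at hlt
        obtain ⟨i, rfl⟩ := hA p hp (Metric.mem_closedBall.2 hlt.le)
        exact hlt.ne (hcs i)
      nlinarith
    · have : ContinuousOn w A := by
        simp only [w]; fun_prop
      exact continuousOn_const.mul ((this.add continuousOn_const).div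
        (this.sub continuousOn_const) fun z hz => hw1 z (hne z hz))
  refine ⟨fun i => (φ (c i)).re, ?_, ?_⟩
  · intro i j h
    simp only at h
    have : φ (c i) = φ (c j) := by rw [hreal i, hreal j, h]
    exact hc (hinj _ _ (hcp i) (hcp j) this)
  · intro A B i j k l hA hB halt h1 h2
    obtain ⟨a1, a2, a3⟩ := hall A hA
    obtain ⟨b1, b2, b3⟩ := hall B hB
    have h1' := h1.map_continuousOn a3
    have h2' := h2.map_continuousOn b3
    rw [hreal i, hreal j] at h1'
    rw [hreal k, hreal l] at h2'
    obtain ⟨_, ⟨p, hp, rfl⟩, ⟨q, hq, h⟩⟩ := half_plane_altn a2 b2 halt h1' h2'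
    have := hinj _ _ (b1 q hq) (a1 p hp) h
    exact ⟨p, hp, this ▸ hq⟩

theorem arc_local {g : ℝ → ℂ} (hg : ContinuousOn g (Icc 0 1)) (hi : InjOn g (Icc 0 1))
    {U : Set ℂ} (hU : IsOpen U) (h0 : g 0 ∈ U) :
    ∃ W, IsOpen W ∧ g 0 ∈ W ∧ ∀ p ∈ W, p ∈ g '' Icc 0 1 → JoinedIn (g '' Icc 0 1 ∩ U) (g 0) p := by
  have h1 : ∀ᶠ t in nhdsWithin (0:ℝ) (Icc 0 1), g t ∈ U :=
    (hg 0 (by simp)).eventually (hU.mem_nhds h0)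
  rw [eventually_nhdsWithin_iff] at h1
  obtain ⟨η, hη, hb⟩ := Metric.eventually_nhds_iff.1 h1
  refine ⟨(g '' Icc η 1)ᶜ, ?_, ?_, ?_⟩
  · rw [isOpen_compl_iff]
    exact (isCompact_Icc.image_of_continuousOn (hg.mono (Icc_subset_Icc_left hη.le))).isClosed
  · rintro ⟨t, ht, h⟩
    have := hi ⟨hη.le.trans ht.1, ht.2⟩ (by simp) h
    exact absurd ht.1 (not_le.2 (this ▸ hη))
  · rintro p hp ⟨t, ht, rfl⟩
    have htη : t < η := by
      by_contra h
      exact hp ⟨t, ⟨not_lt.1 h, ht.2⟩, rfl⟩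
    have hmem : ∀ s ∈ Icc (0:ℝ) 1, t * s ∈ Icc (0:ℝ) 1 := fun s hs =>
      ⟨mul_nonneg ht.1 hs.1, mul_le_one₀ ht.2 hs.1 hs.2⟩
    refine JoinedIn.ofLine (f := fun s => g (t * s)) ?_ (by simp) (by simp) ?_
    · exact hg.comp (by fun_prop) hmem
    · rintro _ ⟨s, hs, rfl⟩
      refine ⟨⟨_, hmem s hs, rfl⟩, hb ?_ (hmem s hs)⟩
      rw [Real.dist_eq, sub_zero, abs_of_nonneg (hmem s hs).1]
      exact (mul_le_of_le_one_right ht.1 hs.2).trans_lt htη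

theorem drawing_order {V E : Type} [Fintype V] [Finite E] (pos : V → ℂ)
    (hpos : Function.Injective pos) (arc : E → ℝ → ℂ)
    (hcont : ∀ e, ContinuousOn (arc e) (Icc (0:ℝ) 1)) (hinj : ∀ e, InjOn (arc e) (Icc (0:ℝ) 1))
    (u v : E → V) (hu : ∀ e, arc e 0 = pos (u e)) (hv : ∀ e, arc e 1 = pos (v e))
    (havoid : ∀ e, ∀ w : V, pos w ∉ arc e '' Ioo (0:ℝ) 1)
    (K : Set ℂ) (hK : K = range pos ∪ ⋃ e, arc e '' Icc (0:ℝ) 1)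
    (F : Set ℂ) (hF : IsOpen F) (hFc : IsPreconnected F) (hFne : F.Nonempty) (hFK : Disjoint F K)
    (hFmax : ∀ T : Set ℂ, IsPreconnected T → Disjoint T K → (T ∩ F).Nonempty → T ⊆ F)
    (hcl : ∀ w, pos w ∈ closure F) :
    ∃ x : V → ℝ, Function.Injective x ∧ ∀ e f,
      altn (x (u e)) (x (v e)) (x (u f)) (x (v f)) →
      (arc e '' Icc (0:ℝ) 1 ∩ arc f '' Icc (0:ℝ) 1).Nonempty := by
  classical
  have hcomp : ∀ e, IsCompact (arc e '' Icc (0:ℝ) 1) := fun e =>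
    isCompact_Icc.image_of_continuousOn (hcont e)
  have harcK : ∀ e, arc e '' Icc (0:ℝ) 1 ⊆ K := fun e => by
    rw [hK]; exact (subset_iUnion (fun e => arc e '' Icc (0:ℝ) 1) e).trans subset_union_right
  have hposK : ∀ w, pos w ∈ K := fun w => by rw [hK]; exact Or.inl ⟨w, rfl⟩
  have hKcl : IsClosed K := by
    rw [hK]
    exact (Set.finite_range pos).isClosed.union (isClosed_iUnion_of_finite fun e => (hcomp e).isClosed)
  have hinc : ∀ e w, pos w ∈ arc e '' Icc (0:ℝ) 1 → w = u e ∨ w = v e := by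
    rintro e w ⟨t, ht, h⟩
    rcases ht.1.lt_or_eq with h0 | h0
    · rcases ht.2.lt_or_eq with h1 | h1
      · exact absurd ⟨t, ⟨h0, h1⟩, h⟩ (havoid e w)
      · right; rw [h1, hv] at h; exact (hpos h).symm
    · left; rw [← h0, hu] at h; exact (hpos h).symm
  -- neighbourhoods
  obtain ⟨U₀, hU₀, hU₀d⟩ := (Set.finite_range pos).t2_separation
  let U : V → Set ℂ := fun w =>
    U₀ (pos w) ∩ ⋂ e : {e : E // pos w ∉ arc e '' Icc (0:ℝ) 1}, (arc e '' Icc (0:ℝ) 1)ᶜ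
  have hUo : ∀ w, IsOpen (U w) := fun w =>
    (hU₀ _).2.inter (isOpen_iInter_of_finite fun e => (hcomp e).isClosed.isOpen_compl)
  have hUm : ∀ w, pos w ∈ U w := fun w => ⟨(hU₀ _).1, mem_iInter.2 fun e => e.2⟩
  have hUd : ∀ w w', w ≠ w' → Disjoint (U w) (U w') := fun w w' h =>
    (hU₀d ⟨w, rfl⟩ ⟨w', rfl⟩ (fun h' => h (hpos h'))).mono inter_subset_left inter_subset_left
  have hUe : ∀ w e, w ≠ u e → w ≠ v e → Disjoint (U w) (arc e '' Icc (0:ℝ) 1) := by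
    intro w e h1 h2
    rw [Set.disjoint_left]
    intro p hp hp'
    have : pos w ∉ arc e '' Icc (0:ℝ) 1 := fun h => (hinc e w h).elim h1 h2
    exact mem_iInter.1 hp.2 ⟨e, this⟩ hp'
  -- local joinability
  have hloc : ∀ w e, ∃ W, IsOpen W ∧ pos w ∈ W ∧ ∀ p ∈ W, p ∈ arc e '' Icc (0:ℝ) 1 →
      JoinedIn (K ∩ U w) (pos w) p := by
    intro w e
    by_cases h : pos w ∈ arc e '' Icc (0:ℝ) 1
    · rcases hinc e w h with h | h
      · obtain ⟨W, a, b, c⟩ := arc_local (hcont e) (hinj e) (hUo w) (by rw [hu, ← h]; exact hUm w)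
        rw [hu, ← h] at b c
        exact ⟨W, a, b, fun p hp hp' => (c p hp hp').mono (inter_subset_inter_left _ (harcK e))⟩
      · have himg : (fun t => arc e (1 - t)) '' Icc (0:ℝ) 1 = arc e '' Icc (0:ℝ) 1 := by
          ext p; constructor
          · rintro ⟨t, ht, rfl⟩
            exact ⟨1 - t, ⟨by linarith [ht.2], by linarith [ht.1]⟩, rfl⟩
          · rintro ⟨t, ht, rfl⟩
            exact ⟨1 - t, ⟨by linarith [ht.2], by linarith [ht.1]⟩, by simp⟩
        have hm : MapsTo (fun t : ℝ => 1 - t) (Icc 0 1) (Icc 0 1) := fun t ht =>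
          ⟨by linarith [ht.2], by linarith [ht.1]⟩
        obtain ⟨W, a, b, c⟩ := arc_local (g := fun t => arc e (1 - t))
          ((hcont e).comp (by fun_prop) hm)
          ((hinj e).comp (fun a _ b _ h => by simpa using h) hm) (hUo w)
          (by simp only [sub_zero]; rw [hv, ← h]; exact hUm w)
        rw [himg] at c
        simp only [sub_zero] at b c
        rw [hv, ← h] at b c
        exact ⟨W, a, b, fun p hp hp' => (c p hp hp').mono (inter_subset_inter_left _ (harcK e))⟩
    · exact ⟨(arc e '' Icc (0:ℝ) 1)ᶜ, (hcomp e).isClosed.isOpen_compl, h,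
        fun p hp hp' => absurd hp' hp⟩
  choose W hWo hWm hWj using hloc
  have hacc : ∀ w, ∃ z f : ℂ, z ∈ K ∩ U w ∧ JoinedIn (K ∩ U w) (pos w) z ∧ f ∈ F ∧
      ∀ t ∈ Ioc (0:ℝ) 1, z + t • (f - z) ∈ F := by
    intro w
    have hO : IsOpen (U w ∩ ⋂ e, W w e) := (hUo w).inter (isOpen_iInter_of_finite fun e => hWo w e)
    obtain ⟨δ, hδ, hb⟩ := Metric.isOpen_iff.1 hO (pos w) ⟨hUm w, mem_iInter.2 fun e => hWm w e⟩
    have hjoin : ∀ p ∈ Metric.ball (pos w) δ, p ∈ K → JoinedIn (K ∩ U w) (pos w) p := by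
      intro p hp hpK
      have hp2 := hb hp
      rw [hK] at hpK
      rcases hpK with ⟨w', rfl⟩ | hpK
      · by_cases hww : w = w'
        · subst hww
          exact JoinedIn.refl ⟨hposK _, hUm _⟩
        · exact absurd (hUm w') (Set.disjoint_left.1 (hUd w w' hww) hp2.1)
      · obtain ⟨e, he⟩ := mem_iUnion.1 hpK
        exact hWj w e p (mem_iInter.1 hp2.2 e) he
    obtain ⟨f, hfb, hf⟩ := mem_closure_iff.1 (hcl w) _ Metric.isOpen_ball (Metric.mem_ball_self hδ)
    let g : ℝ → ℂ := fun t => f + t • (pos w - f)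
    have hgc : Continuous g := by simp only [g]; fun_prop
    have hgb : ∀ t ∈ Icc (0:ℝ) 1, g t ∈ Metric.ball (pos w) δ := by
      intro t ht
      refine (convex_ball (pos w) δ).segment_subset hfb (Metric.mem_ball_self hδ) ?_
      rw [segment_eq_image']
      exact ⟨t, ht, rfl⟩
    have hc : IsCompact (Icc (0:ℝ) 1 ∩ g ⁻¹' K) := isCompact_Icc.inter_right (hKcl.preimage hgc)
    obtain ⟨T, ⟨hT, hTK⟩, hTmin⟩ := hc.exists_isLeast ⟨1, by simp, by
      change g 1 ∈ K
      simp only [g, one_smul, add_sub_cancel]; exact hposK w⟩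
    have hTpos : 0 < T := by
      rcases hT.1.lt_or_eq with h | h
      · exact h
      · exfalso
        rw [← h] at hTK
        refine Set.disjoint_left.1 hFK hf ?_
        simpa [g] using hTK
    have heq : ∀ t : ℝ, g T + t • (f - g T) = g ((1 - t) * T) := by
      intro t
      simp only [g, Complex.real_smul]; push_cast; ring
    have hj := hjoin _ (hgb T hT) hTK
    refine ⟨g T, f, hj.target_mem, hj, hf, ?_⟩
    have hsub : g '' Ico 0 T ⊆ F := by
      apply hFmax
      · exact isPreconnected_Ico.image _ hgc.continuousOn
      · rw [Set.disjoint_left]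
        rintro _ ⟨t, ht, rfl⟩ htK
        exact absurd (hTmin ⟨⟨ht.1, ht.2.le.trans hT.2⟩, htK⟩) (not_le.2 ht.2)
      · exact ⟨f, ⟨0, ⟨le_rfl, hTpos⟩, by simp [g]⟩, hf⟩
    intro t ht
    rw [heq]
    exact hsub ⟨_, ⟨mul_nonneg (by linarith [ht.2]) hTpos.le, by nlinarith [ht.1]⟩, rfl⟩
  choose z f hzN hzj hfF hzf using hacc
  have hzF : ∀ i, z i ∉ F := fun i h => Set.disjoint_left.1 hFK h (hzN i).1
  have hzi : Function.Injective z := by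
    intro i j h
    by_contra hij
    exact Set.disjoint_left.1 (hUd i j hij) (hzN i).2 (h ▸ (hzN j).2)
  obtain ⟨o, ho⟩ := hFne
  obtain ⟨ρ, hρ, hρF, Γ₀, c₀, hst₀⟩ := star_exists hF hFc hzF hzi hfF hzf Finset.univ o ho
  obtain ⟨Γ, c, hst, htr⟩ := hst₀.trunc Metric.isClosed_closedBall hρF hzF
  have hΓd : ∀ i j, i ≠ j → Disjoint (Γ i) (Γ j) := fun i j h =>
    hst.2 i (Finset.mem_univ _) j (Finset.mem_univ _) h
  have hΓ := fun i => hst.1 i (Finset.mem_univ _)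
  have htr := fun i => htr i (Finset.mem_univ _)
  have hci : Function.Injective c := by
    intro i j h
    by_contra hij
    exact Set.disjoint_left.1 (hΓd i j hij) (hΓ i).2.1.target_mem (h ▸ (hΓ j).2.1.target_mem)
  have hcs : ∀ i, dist (c i) o = ρ := by
    intro i
    refine le_antisymm (Metric.mem_closedBall.1 (hΓ i).2.2.2) ?_
    have := (htr i).2.2
    rw [interior_closedBall o hρ.ne'] at this
    simpa using this
  obtain ⟨x, hx, hcross⟩ := circle_order o hρ c hci hcs
  refine ⟨x, hx, fun e e' halt => ?_⟩
  by_contra hno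
  have hdis : Disjoint (arc e '' Icc (0:ℝ) 1) (arc e' '' Icc (0:ℝ) 1) :=
    Set.disjoint_iff_inter_eq_empty.2 (Set.not_nonempty_iff_eq_empty.1 hno)
  -- the four endpoints are distinct
  have hd4 : u e ≠ u e' ∧ u e ≠ v e' ∧ v e ≠ u e' ∧ v e ≠ v e' := by
    have : x (u e) ≠ x (u e') ∧ x (u e) ≠ x (v e') ∧ x (v e) ≠ x (u e') ∧ x (v e) ≠ x (v e') := by
      unfold altn btwn at halt
      rcases halt with ⟨h1, -, h3, h4⟩ | ⟨h1, -, h3, h4⟩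
      · refine ⟨?_, h3.symm, ?_, h4.symm⟩ <;> rcases h1 with h | h <;>
          first | exact h.1.ne | exact h.2.ne | exact h.1.ne' | exact h.2.ne'
      · refine ⟨h3.symm, ?_, h4.symm, ?_⟩ <;> rcases h1 with h | h <;>
          first | exact h.1.ne | exact h.2.ne | exact h.1.ne' | exact h.2.ne'
    exact ⟨fun h => this.1 (by rw [h]), fun h => this.2.1 (by rw [h]),
      fun h => this.2.2.1 (by rw [h]), fun h => this.2.2.2 (by rw [h])⟩
  let M : V → Set ℂ := fun w => (K ∩ U w) ∪ Γ w
  have hMK : ∀ w, ∀ p ∈ M w, p ∈ K → p ∈ U w := by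
    rintro w p (h | h) hpK
    · exact h.2
    · rcases (hΓ w).2.2.1 h with h | h
      · rw [h]; exact (hzN w).2
      · exact absurd hpK (Set.disjoint_left.1 hFK h)
  have hMd : ∀ i j, i ≠ j → Disjoint (M i) (M j) := by
    intro i j hij
    rw [Set.disjoint_left]
    intro p hp hp'
    by_cases hpK : p ∈ K
    · exact Set.disjoint_left.1 (hUd i j hij) (hMK i p hp hpK) (hMK j p hp' hpK)
    · exact Set.disjoint_left.1 (hΓd i j hij) (hp.resolve_left fun h => hpK h.1)
        (hp'.resolve_left fun h => hpK h.1)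
  have hMe : ∀ w e, w ≠ u e → w ≠ v e → Disjoint (M w) (arc e '' Icc (0:ℝ) 1) := by
    intro w e h1 h2
    rw [Set.disjoint_left]
    intro p hp hp'
    exact Set.disjoint_left.1 (hUe w e h1 h2) (hMK w p hp (harcK e hp')) hp'
  have hball : ∀ p ∈ K, p ∉ Metric.closedBall o ρ := fun p hp h =>
    Set.disjoint_left.1 hFK (hρF h) hp
  let A : E → Set ℂ := fun e => arc e '' Icc (0:ℝ) 1 ∪ (M (u e) ∪ M (v e))
  have hAb : ∀ e, ∀ p ∈ A e, p ∈ Metric.closedBall o ρ → p ∈ range c := by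
    have hMb : ∀ w, ∀ p ∈ M w, p ∈ Metric.closedBall o ρ → p ∈ range c := by
      rintro w p (h | h) hb
      · exact absurd hb (hball p h.1)
      · exact ⟨w, ((htr w).2.1 p h hb).symm⟩
    rintro e p (h | h | h) hb
    · exact absurd hb (hball p (harcK e h))
    · exact hMb _ p h hb
    · exact hMb _ p h hb
  have hMj : ∀ w, JoinedIn (M w) (c w) (pos w) := fun w =>
    ((hΓ w).2.1.symm.mono subset_union_right).trans ((hzj w).symm.mono subset_union_left)
  have hAj : ∀ e, JoinedIn (A e) (c (u e)) (c (v e)) := by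
    intro e
    refine ((hMj (u e)).mono ?_).trans (JoinedIn.trans ?_ ((hMj (v e)).symm.mono ?_))
    · exact subset_union_left.trans subset_union_right
    · exact JoinedIn.ofLine (hcont e) (hu e) (hv e) subset_union_left
    · exact subset_union_right.trans subset_union_right
  obtain ⟨p, hp, hp'⟩ := hcross (A e) (A e') _ _ _ _ (hAb e) (hAb e') halt (hAj e) (hAj e')
  obtain ⟨n1, n2, n3, n4⟩ := hd4
  have L : ∀ {s t : Set ℂ}, Disjoint s t → p ∈ s → p ∈ t → False :=
    fun h h1 h2 => Set.disjoint_left.1 h h1 h2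
  rcases hp with hp | hp | hp <;> rcases hp' with hp' | hp' | hp'
  · exact L hdis hp hp'
  · exact L (hMe _ _ n1.symm n3.symm) hp' hp
  · exact L (hMe _ _ n2.symm n4.symm) hp' hp
  · exact L (hMe _ _ n1 n2) hp hp'
  · exact L (hMd _ _ n1) hp hp'
  · exact L (hMd _ _ n2) hp hp'
  · exact L (hMe _ _ n3 n4) hp hp'
  · exact L (hMd _ _ n3) hp hp'
  · exact L (hMd _ _ n4) hp hp'

theorem altn_ne {p q r s : ℝ} (halt : altn p q r s) : p ≠ r ∧ p ≠ s ∧ q ≠ r ∧ q ≠ s := by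
  unfold altn btwn at halt
  rcases halt with ⟨h1, -, h3, h4⟩ | ⟨h1, -, h3, h4⟩
  · refine ⟨?_, h3.symm, ?_, h4.symm⟩ <;> rcases h1 with h | h <;>
      first | exact h.1.ne | exact h.2.ne | exact h.1.ne' | exact h.2.ne'
  · refine ⟨h3.symm, ?_, h4.symm, ?_⟩ <;> rcases h1 with h | h <;>
      first | exact h.1.ne | exact h.2.ne | exact h.1.ne' | exact h.2.ne'

theorem comb_of_outer {V : Type} [Fintype V] (G : SimpleGraph V) (h : OuterOnePlanar G) :
    CombO1P G := by
  obtain ⟨D, hD, F, ⟨p, hp, hFdef⟩, -, hcl⟩ := h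
  choose u v huv hu hv using D.arc_ends
  have hfin : Finite G.edgeSet := inferInstance
  have hclosed : IsClosed D.image := by
    unfold MultiDrawing.image
    exact (Set.finite_range D.pos).isClosed.union (isClosed_iUnion_of_finite fun e =>
      (isCompact_Icc.image_of_continuousOn (D.arc_cont e)).isClosed)
  let L : Plane ≃ₜ ℂ := Complex.equivRealProdCLM.symm.toHomeomorph
  have hFo : IsOpen F := by rw [hFdef]; exact hclosed.isOpen_compl.connectedComponentIn
  have hFp : IsPreconnected F := by rw [hFdef]; exact isPreconnected_connectedComponentIn
  have hpF : p ∈ F := by rw [hFdef]; exact mem_connectedComponentIn hp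
  have hFs : F ⊆ D.imageᶜ := by rw [hFdef]; exact connectedComponentIn_subset _ _
  obtain ⟨x, hx, hcross⟩ := drawing_order (E := G.edgeSet) (fun w => L (D.pos w))
    (L.injective.comp D.pos_inj) (fun e t => L (D.arc e t))
    (fun e => L.continuous.comp_continuousOn (D.arc_cont e))
    (fun e => L.injective.injOn.comp (D.arc_inj e) (mapsTo_univ _ _))
    u v (fun e => by simp only [hu]) (fun e => by simp only [hv])
    (by
      rintro e w ⟨t, ht, h⟩
      exact D.arc_avoid e w ⟨t, ht, L.injective h⟩)
    (L '' D.image) (by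
      unfold MultiDrawing.image
      rw [image_union, image_iUnion, ← range_comp]
      simp only [image_image]
      rfl)
    (L '' F) (L.isOpenMap _ hFo) (hFp.image _ L.continuous.continuousOn) ⟨_, p, hpF, rfl⟩
    (by
      rw [Set.disjoint_image_iff L.injective]
      exact Set.disjoint_left.2 fun q hq => hFs hq)
    (by
      rintro T hT hTK ⟨_, hq, ⟨q, hqF, rfl⟩⟩
      have h1 : IsPreconnected (L.symm '' T) := hT.image _ L.symm.continuous.continuousOn
      have h2 : L.symm '' T ⊆ D.imageᶜ := by
        rintro _ ⟨t, ht, rfl⟩ hi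
        exact Set.disjoint_left.1 hTK ht ⟨_, hi, by simp⟩
      have h3 : q ∈ L.symm '' T := ⟨_, hq, by simp⟩
      have h4 := h1.subset_connectedComponentIn h3 h2
      have h5 : connectedComponentIn D.imageᶜ q = F := by
        rw [hFdef] at hqF ⊢
        exact (connectedComponentIn_eq hqF).symm
      rw [h5] at h4
      intro t ht
      exact ⟨L.symm t, h4 ⟨t, ht, rfl⟩, by simp⟩)
    (fun w => by
      rw [← L.image_closure]
      exact ⟨_, hcl w, rfl⟩)
  refine ⟨x, hx, ?_⟩
  have key : ∀ e f : G.edgeSet, altn (x (u e)) (x (v e)) (x (u f)) (x (v f)) →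
      ∃ p, ((f, p) : G.edgeSet × Plane) ∈ D.crossSet e := by
    intro e f halt
    obtain ⟨n1, n2, n3, n4⟩ := altn_ne halt
    have m1 : u e ≠ u f := fun h => n1 (by rw [h])
    have m2 : u e ≠ v f := fun h => n2 (by rw [h])
    have m3 : v e ≠ u f := fun h => n3 (by rw [h])
    have m4 : v e ≠ v f := fun h => n4 (by rw [h])
    obtain ⟨_, ⟨t, ht, rfl⟩, ⟨s, hs, hst⟩⟩ := hcross e f halt
    have hst' : D.arc f s = D.arc e t := L.injective hst
    have ends : ∀ (g : G.edgeSet) (r : ℝ), r ∈ Icc (0:ℝ) 1 →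
        D.arc g r = D.pos (u g) ∨ D.arc g r = D.pos (v g) ∨ r ∈ Ioo (0:ℝ) 1 := by
      intro g r hr
      rcases hr.1.lt_or_eq with h0 | h0
      · rcases hr.2.lt_or_eq with h1 | h1
        · exact Or.inr (Or.inr ⟨h0, h1⟩)
        · right; left; rw [h1, hv]
      · left; rw [← h0, hu]
    rcases ends e t ht with h | h | h
    · rw [h] at hst'
      rcases ends f s hs with k | k | k
      · exact absurd (D.pos_inj (hst'.symm.trans k)) m1
      · exact absurd (D.pos_inj (hst'.symm.trans k)) m2
      · exact absurd ⟨s, k, hst'⟩ (D.arc_avoid f _)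
    · rw [h] at hst'
      rcases ends f s hs with k | k | k
      · exact absurd (D.pos_inj (hst'.symm.trans k)) m3
      · exact absurd (D.pos_inj (hst'.symm.trans k)) m4
      · exact absurd ⟨s, k, hst'⟩ (D.arc_avoid f _)
    · rcases ends f s hs with k | k | k
      · exact absurd ⟨t, h, hst'.symm.trans k⟩ (D.arc_avoid e _)
      · exact absurd ⟨t, h, hst'.symm.trans k⟩ (D.arc_avoid e _)
      · exact ⟨D.arc e t, fun hfe => m1 (by rw [show f = e from hfe]), ⟨t, h, rfl⟩, ⟨s, k, hst'⟩⟩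
  have key2 : ∀ a b c d (hab : G.Adj a b) (hcd : G.Adj c d), altn (x a) (x b) (x c) (x d) →
      ∃ p, ((⟨s(c,d), hcd⟩, p) : G.edgeSet × Plane) ∈ D.crossSet ⟨s(a,b), hab⟩ := by
    intro a b c d hab hcd halt
    apply key
    have e1 := huv ⟨s(a,b), hab⟩
    have e2 := huv ⟨s(c,d), hcd⟩
    simp only at e1 e2
    rcases Sym2.eq_iff.1 e1 with ⟨h1, h2⟩ | ⟨h1, h2⟩ <;>
      rcases Sym2.eq_iff.1 e2 with ⟨h3, h4⟩ | ⟨h3, h4⟩ <;> rw [← h1, ← h2, ← h3, ← h4]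
    · exact halt
    · exact altn_symm_right.1 halt
    · exact altn_symm_left.1 halt
    · exact altn_symm_right.1 (altn_symm_left.1 halt)
  intro a b c d c' d' hab hcd hcd' h1 h2
  obtain ⟨p, hp⟩ := key2 a b c d hab hcd h1
  obtain ⟨q, hq⟩ := key2 a b c' d' hab hcd' h2
  have := hD _ hp hq
  exact congrArg (fun r : G.edgeSet × Plane => (r.1 : Sym2 V)) this

/-- The chord of the parabola between the points with abscissas `a` and `b`. -/
def chd (a b t : ℝ) : Plane := ((1 - t) * a + t * b, (1 - t) * a ^ 2 + t * b ^ 2)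

theorem chd_above {a b t : ℝ} (hab : a ≠ b) (ht : t ∈ Ioo (0:ℝ) 1) :
    (chd a b t).1 ^ 2 < (chd a b t).2 := by
  have h1 : 0 < t * (1 - t) * (a - b) ^ 2 :=
    mul_pos (mul_pos ht.1 (by linarith [ht.2])) (by positivity [sub_ne_zero.2 hab])
  simp only [chd]
  nlinarith

theorem chd_above_le {a b t : ℝ} (ht : t ∈ Icc (0:ℝ) 1) :
    (chd a b t).1 ^ 2 ≤ (chd a b t).2 := by
  have h1 : 0 ≤ t * (1 - t) * (a - b) ^ 2 :=
    mul_nonneg (mul_nonneg ht.1 (by linarith [ht.2])) (by positivity)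
  simp only [chd]
  nlinarith

theorem chd_line (a b t : ℝ) : (chd a b t).2 = (a + b) * (chd a b t).1 - a * b := by
  simp only [chd]; ring

theorem pair_eq {a b c d : ℝ} (h : c + d - a - b = 0) (h2 : c * d = a * b) :
    (a = c ∧ b = d) ∨ (a = d ∧ b = c) := by
  have h3 : (c - a) * (c - b) = 0 := by linear_combination c * h - h2
  rcases mul_eq_zero.1 h3 with h4 | h4
  · left; constructor <;> linarith
  · right; constructor <;> linarith

theorem chd_cross {a b c d t s : ℝ} (hcd : c ≠ d) (hs : s ∈ Ioo (0:ℝ) 1)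
    (hne : ¬((a = c ∧ b = d) ∨ (a = d ∧ b = c))) (h : chd a b t = chd c d s) :
    c + d - a - b ≠ 0 ∧ (c + d - a - b) * (chd a b t).1 = c * d - a * b ∧ altn a b c d := by
  have e1 := chd_line a b t
  have e2 := chd_line c d s
  rw [← h] at e2
  have e3 : (c + d - a - b) * (chd a b t).1 = c * d - a * b := by linear_combination e1 - e2
  have hk : c + d - a - b ≠ 0 := by
    intro hk
    rw [hk, zero_mul] at e3
    exact hne (pair_eq hk (by linarith))
  refine ⟨hk, e3, ?_⟩
  have hX : (chd a b t).1 = (1 - s) * c + s * d := by rw [h]; rfl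
  rw [hX] at e3
  have f1 : (c - a) * (c - b) = (c + d - a - b) * (s * (c - d)) := by linear_combination e3
  have f2 : (d - a) * (d - b) = -((c + d - a - b) * ((1 - s) * (c - d))) := by
    linear_combination e3
  have hs0 := hs.1
  have hs1 : 0 < 1 - s := by linarith [hs.2]
  have hm : (c + d - a - b) * (c - d) ≠ 0 := mul_ne_zero hk (sub_ne_zero.2 hcd)
  have cases : ∀ {y : ℝ}, (y - a) * (y - b) < 0 → btwn a b y := by
    intro y hy
    rcases mul_neg_iff.1 hy with ⟨u, v⟩ | ⟨u, v⟩
    · left; constructor <;> linarith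
    · right; constructor <;> linarith
  have ncases : ∀ {y : ℝ}, 0 < (y - a) * (y - b) → ¬btwn a b y ∧ y ≠ a ∧ y ≠ b := by
    intro y hy
    refine ⟨?_, ?_, ?_⟩
    · rintro (⟨u, v⟩ | ⟨u, v⟩)
      · nlinarith
      · nlinarith
    · rintro rfl; simp at hy
    · rintro rfl; simp at hy
  rcases lt_or_gt_of_ne hm with hm | hm
  · left
    exact ⟨cases (by rw [f1]; nlinarith), ncases (by rw [f2]; nlinarith)⟩
  · right
    exact ⟨cases (by rw [f2]; nlinarith), ncases (by rw [f1]; nlinarith)⟩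

theorem outer_of_comb {V : Type} (G : SimpleGraph V) (h : CombO1P G) : OuterOnePlanar G := by
  obtain ⟨x, hx, hgood⟩ := h
  have hex : ∀ e : G.edgeSet, ∃ u v : V, (e : Sym2 V) = s(u, v) := fun e =>
    Sym2.ind (fun u v => ⟨u, v, rfl⟩) (e : Sym2 V)
  choose u v huv using hex
  have hadj : ∀ e, G.Adj (u e) (v e) := fun e => by
    have := e.2
    rw [huv e] at this
    exact this
  have hab : ∀ e, x (u e) ≠ x (v e) := fun e h => (hadj e).ne (hx h)
  have hne : ∀ e f, e ≠ f →
      ¬((x (u e) = x (u f) ∧ x (v e) = x (v f)) ∨ (x (u e) = x (v f) ∧ x (v e) = x (u f))) := by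
    rintro e f hef (⟨h1, h2⟩ | ⟨h1, h2⟩)
    · apply hef; apply Subtype.ext; rw [huv e, huv f, hx h1, hx h2]
    · apply hef; apply Subtype.ext; rw [huv e, huv f, hx h1, hx h2]; exact Sym2.eq_swap
  let D : G.Drawing :=
    { pos := fun w => (x w, x w ^ 2)
      pos_inj := fun a b h => hx (congrArg Prod.fst h)
      arc := fun e t => chd (x (u e)) (x (v e)) t
      arc_cont := fun e => by
        unfold chd
        exact Continuous.continuousOn (by fun_prop)
      arc_inj := fun e t _ s _ h => by
        have h1 := congrArg Prod.fst h
        simp only [chd] at h1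
        have h2 : (t - s) * (x (v e) - x (u e)) = 0 := by linear_combination h1
        rcases mul_eq_zero.1 h2 with h3 | h3
        · linarith
        · exact absurd (by linarith) (hab e)
      arc_ends := fun e => ⟨u e, v e, huv e, by simp [chd], by simp [chd]⟩
      arc_avoid := by
        rintro e w ⟨t, ht, h⟩
        simp only at h
        have := chd_above (hab e) ht
        rw [h] at this
        simp at this
      no_incident_cross := by
        rintro e f hef ⟨_, ⟨t, ht, rfl⟩, ⟨s, hs, h⟩⟩ y ⟨hy1, hy2⟩
        have halt := (chd_cross (hab f) hs (hne e f hef) h.symm).2.2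
        obtain ⟨n1, n2, n3, n4⟩ := altn_ne halt
        rw [huv e, Sym2.mem_iff] at hy1
        rw [huv f, Sym2.mem_iff] at hy2
        rcases hy1 with h1 | h1 <;> rcases hy2 with h2 | h2 <;> rw [h1] at h2
        · exact n1 (by rw [h2])
        · exact n2 (by rw [h2])
        · exact n3 (by rw [h2])
        · exact n4 (by rw [h2]) }
  have himg : ∀ p ∈ D.image, p.1 ^ 2 ≤ p.2 := by
    rintro p (⟨w, rfl⟩ | hp)
    · exact le_rfl
    · obtain ⟨e, t, ht, rfl⟩ := mem_iUnion.1 hp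
      exact chd_above_le ht
  refine ⟨D, ?_, connectedComponentIn D.imageᶜ (0, -1), ⟨(0, -1), ?_, rfl⟩, ?_, ?_⟩
  · rintro e ⟨f, p⟩ ⟨h1, ⟨t, ht, h2⟩, ⟨s, hs, h3⟩⟩ ⟨f', p'⟩ ⟨h1', ⟨t', ht', h2'⟩, ⟨s', hs', h3'⟩⟩
    simp only at h1 h2 h3 h1' h2' h3'
    obtain ⟨k1, k2, k3⟩ := chd_cross (hab f) hs (hne e f h1.symm) (h2.trans h3.symm)
    obtain ⟨k1', k2', k3'⟩ := chd_cross (hab f') hs' (hne e f' h1'.symm) (h2'.trans h3'.symm)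
    have hff : f = f' := by
      apply Subtype.ext
      rw [huv f, huv f']
      exact hgood _ _ _ _ _ _ (hadj e) (hadj f) (hadj f') k3 k3'
    subst hff
    have e1 : (chd (x (u e)) (x (v e)) t).1 = (chd (x (u e)) (x (v e)) t').1 :=
      mul_left_cancel₀ k1 (k2.trans k2'.symm)
    have e2 : (chd (x (u e)) (x (v e)) t).2 = (chd (x (u e)) (x (v e)) t').2 := by
      rw [chd_line, chd_line, e1]
    have e3 : p = p' := by
      rw [← h2, ← h2']
      exact Prod.ext e1 e2
    rw [e3]
  · intro h
    have := himg _ h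
    norm_num at this
  all_goals
    have hconn : IsPreconnected ((fun q : ℝ × ℝ => ((q.1, q.1 ^ 2 - q.2) : Plane)) ''
        (univ ×ˢ Ioi (0:ℝ))) :=
      (isPreconnected_univ.prod isPreconnected_Ioi).image _
        (Continuous.continuousOn (by fun_prop))
    have hsub := hconn.subset_connectedComponentIn (x := ((0, -1) : Plane)) (F := D.imageᶜ)
      ⟨(0, 1), ⟨mem_univ _, by simp⟩, by simp⟩ (by
        rintro _ ⟨q, ⟨-, hq⟩, rfl⟩ hi
        have := himg _ hi
        simp only [mem_Ioi] at hq this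
        linarith)
  · intro hb
    have hb2 := (hb.subset hsub)
    obtain ⟨R, hR⟩ := hb2.exists_norm_le
    have := hR (|R| + 1, (|R| + 1) ^ 2 - 1) ⟨(|R| + 1, 1), ⟨mem_univ _, by simp⟩, rfl⟩
    have h2 := (norm_fst_le _).trans this
    simp only [Real.norm_eq_abs] at h2
    have h3 := (le_abs_self (|R| + 1)).trans h2
    linarith [le_abs_self R]
  · intro w
    apply closure_mono hsub
    rw [Metric.mem_closure_iff]
    intro ε hε
    refine ⟨(x w, x w ^ 2 - ε / 2), ⟨(x w, ε / 2), ⟨mem_univ _, by simpa using hε⟩, rfl⟩, ?_⟩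
    change dist ((x w, x w ^ 2) : ℝ × ℝ) (x w, x w ^ 2 - ε / 2) < ε
    rw [Prod.dist_eq, Real.dist_eq, Real.dist_eq]
    simp only [sub_self, abs_zero, sub_sub_cancel]
    rw [abs_of_pos (by linarith)]
    exact max_lt hε (by linarith)

theorem outer_iff_comb {V : Type} [Fintype V] (G : SimpleGraph V) :
    OuterOnePlanar G ↔ CombO1P G :=
  ⟨comb_of_outer G, outer_of_comb G⟩


/-- There are maximal outer 1-planar graphs on `n` vertices
with exactly `(11 n − 18)/5` edges (for infinitely many `n`), and this is the
minimum number of edges of a maximal outer 1-planar graph. -/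
theorem maximal_outer_one_planar_min_edges :
    {n : ℕ | ∃ G : SimpleGraph (Fin n), MaximalOuterOnePlanar G ∧
      5 * G.edgeSet.ncard = 11 * n - 18}.Infinite ∧
    ∀ (V : Type) [Fintype V] (G : SimpleGraph V), MaximalOuterOnePlanar G →
      (11 * (Fintype.card V : ℤ) - 18) ≤ 5 * (G.edgeSet.ncard : ℤ) := by
  have lower : ∀ (V : Type) [Fintype V] (G : SimpleGraph V), MaximalOuterOnePlanar G →
      (11 * (Fintype.card V : ℤ) - 18) ≤ 5 * (G.edgeSet.ncard : ℤ) := by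
    intro V _ G hG
    exact comb_lower G ((outer_iff_comb G).1 hG.1)
      fun H hlt hH => hG.2 H hlt ((outer_iff_comb H).2 hH)
  refine ⟨?_, lower⟩
  refine Set.infinite_of_injective_forall_mem (f := fun q : ℕ => 5 * q + 3) ?_ ?_
  · intro a b h
    simp only at h
    omega
  · intro q
    have hmax : MaximalOuterOnePlanar (exG q) :=
      ⟨(outer_iff_comb _).2 (exG_comb q),
        fun H hlt hH => exG_max q H hlt ((outer_iff_comb H).1 hH)⟩
    refine ⟨exG q, hmax, ?_⟩
    have h1 := exG_card q
    have h2 := lower _ (exG q) hmax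
    rw [Fintype.card_fin] at h2
    push_cast at h2
    omega
end
end

section
/- There exist maximal IC-planar graphs on n vertices with only 3n − 5 edges. -/
open Set

noncomputable section

/-- An IC-planar drawing: 1-planar and every vertex is incident to at most one
crossed edge. -/
def IsICDrawing {V : Type} {G : SimpleGraph V} (D : G.Drawing) : Prop :=
  D.IsOnePlanarD ∧
    ∀ v : V, {e : G.edgeSet | v ∈ (e : Sym2 V) ∧ (D.crossSet e).Nonempty}.Subsingleton

/-- An IC-planar graph: it admits an IC-planar drawing. -/
def ICPlanar {V : Type} (G : SimpleGraph V) : Prop :=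
  ∃ D : G.Drawing, IsICDrawing D

/-- A maximal IC-planar graph: IC-planar and no edge can be added while
preserving IC-planarity. -/
def MaximalICPlanar {V : Type} (G : SimpleGraph V) : Prop :=
  ICPlanar G ∧ ∀ H : SimpleGraph V, G < H → ¬ICPlanar H


/-- continuous logarithm on the plane of parameters -/
theorem exists_log (F : ℝ × ℝ → ℂ) (hF : Continuous F) (h0 : ∀ p, F p ≠ 0) :
    ∃ L : ℝ × ℝ → ℂ, Continuous L ∧ ∀ p, Complex.exp (L p) = F p := by
  have cov := Complex.isCoveringMap_exp
  let f : C(ℝ × ℝ, {z : ℂ // z ≠ 0}) := ⟨fun p => ⟨F p, h0 p⟩, hF.subtype_mk _⟩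
  obtain ⟨L, ⟨-, hL⟩, -⟩ := cov.existsUnique_continuousMap_lifts f (0, 0)
    (Complex.log (F (0, 0))) (Subtype.ext (Complex.exp_log (h0 _)))
  exact ⟨L, L.continuous, fun p => congrArg Subtype.val (congrFun hL p)⟩

theorem log_diff_unique (L M : ℝ → ℂ) (hL : Continuous L) (hM : Continuous M) (c : ℂ)
    (h : ∀ s, Complex.exp (L s) = c * Complex.exp (M s)) :
    L 1 - L 0 = M 1 - M 0 := by
  have cov := Complex.isCoveringMap_exp
  have key : ∀ s, Complex.exp (L s - M s) = c := fun s => by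
    rw [Complex.exp_sub, h s, mul_div_assoc, div_self (Complex.exp_ne_zero _), mul_one]
  have := cov.eq_of_comp_eq (g₁ := fun s : ℝ => L s - M s) (g₂ := fun _ : ℝ => L 0 - M 0)
    (hL.sub hM) continuous_const
    (by funext s; apply Subtype.ext; simp only [Function.comp]; rw [key, key]) 0 rfl
  have h1 := congrFun this 1
  linear_combination h1

open Classical in
/-- total change of the logarithm of `γ - c` -/
noncomputable def angChange (γ : ℝ → ℂ) (c : ℂ) : ℂ :=
  if h : ∃ L : ℝ → ℂ, Continuous L ∧ ∀ s, Complex.exp (L s) = γ s - c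
  then h.choose 1 - h.choose 0 else 0

theorem angChange_eq (γ : ℝ → ℂ) (c k : ℂ) (hk : k ≠ 0) (L : ℝ → ℂ) (hL : Continuous L)
    (h : ∀ s, Complex.exp (L s) = k * (γ s - c)) : L 1 - L 0 = angChange γ c := by
  have ex : ∃ L : ℝ → ℂ, Continuous L ∧ ∀ s, Complex.exp (L s) = γ s - c := by
    refine ⟨fun s => L s - Complex.log k, hL.sub continuous_const, fun s => ?_⟩
    rw [Complex.exp_sub, h s, Complex.exp_log hk]
    field_simp
  rw [angChange, dif_pos ex]
  exact log_diff_unique _ _ hL ex.choose_spec.1 k (fun s => by rw [h s, ex.choose_spec.2 s])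

theorem ang_rel (γ δ : ℝ → ℂ) (hγ : Continuous γ) (hδ : Continuous δ)
    (hd : ∀ s t, γ s ≠ δ t) :
    angChange γ (δ 0) + angChange δ (γ 1) = angChange δ (γ 0) + angChange γ (δ 1) := by
  obtain ⟨L, hL, hexp⟩ := exists_log (fun p => γ p.1 - δ p.2) (by fun_prop)
    (fun p => sub_ne_zero.mpr (hd _ _))
  have h1 := angChange_eq γ (δ 0) 1 one_ne_zero (fun s => L (s, 0)) (by fun_prop)
    (fun s => by rw [hexp]; simp)
  have h2 := angChange_eq γ (δ 1) 1 one_ne_zero (fun s => L (s, 1)) (by fun_prop)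
    (fun s => by rw [hexp]; simp)
  have h3 := angChange_eq δ (γ 0) (-1) (by simp) (fun s => L (0, s)) (by fun_prop)
    (fun s => by rw [hexp]; simp)
  have h4 := angChange_eq δ (γ 1) (-1) (by simp) (fun s => L (1, s)) (by fun_prop)
    (fun s => by rw [hexp]; simp)
  linear_combination -h1 + h2 + h3 - h4

theorem ang_mod (γ : ℝ → ℂ) (hγ : Continuous γ) (c A B : ℂ) (hc : ∀ s, γ s ≠ c)
    (hA : Complex.exp A = γ 0 - c) (hB : Complex.exp B = γ 1 - c) :
    ∃ n : ℤ, angChange γ c = B - A + n * (2 * Real.pi * Complex.I) := by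
  obtain ⟨L, hL, hexp⟩ := exists_log (fun p => γ p.1 - c) (by fun_prop)
    (fun p => sub_ne_zero.mpr (hc _))
  have h1 := angChange_eq γ c 1 one_ne_zero (fun s => L (s, 0)) (by fun_prop)
    (fun s => by rw [hexp]; simp)
  have e0 := hexp (0, 0)
  have e1 := hexp (1, 0)
  simp only at e0 e1 h1
  rw [← hA, Complex.exp_eq_exp_iff_exists_int] at e0
  rw [← hB, Complex.exp_eq_exp_iff_exists_int] at e1
  obtain ⟨n, hn⟩ := e0
  obtain ⟨m, hm⟩ := e1
  refine ⟨m - n, ?_⟩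
  push_cast
  rw [← h1]
  linear_combination hm - hn

theorem no_K5 (P : Fin 5 → ℂ) (S : Fin 5 → Fin 5 → Set ℂ)
    (hJ : ∀ i j, i < j → JoinedIn (S i j) (P i) (P j))
    (hd : ∀ i j k l, i < j → k < l → i ≠ k → i ≠ l → j ≠ k → j ≠ l →
      Disjoint (S i j) (S k l)) : False := by
  have hγ : ∀ i j, ∃ γ : ℝ → ℂ, i < j →
      (Continuous γ ∧ γ 0 = P i ∧ γ 1 = P j ∧ ∀ s, γ s ∈ S i j) := by
    intro i j
    by_cases h : i < j
    · obtain ⟨p, hp⟩ := hJ i j h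
      refine ⟨p.extend, fun _ => ⟨p.continuous_extend, p.extend_zero, p.extend_one, fun s => ?_⟩⟩
      have : p.extend s = p (Set.projIcc 0 1 zero_le_one s) := rfl
      rw [this]; exact hp _
    · exact ⟨fun _ => 0, fun h' => absurd h' h⟩
  choose γ hγ using hγ
  have hdis : ∀ i j k l, i < j → k < l → i ≠ k → i ≠ l → j ≠ k → j ≠ l →
      ∀ s t, γ i j s ≠ γ k l t := by
    intro i j k l h1 h2 h3 h4 h5 h6 s t he
    refine Set.disjoint_left.mp (hd i j k l h1 h2 h3 h4 h5 h6) ((hγ i j h1).2.2.2 s) ?_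
    rw [he]; exact (hγ k l h2).2.2.2 t
  have havoid : ∀ i j k, i < j → k ≠ i → k ≠ j → ∀ s, γ i j s ≠ P k := by
    intro i j k h1 h2 h3 s
    have : ∃ l, l ≠ i ∧ l ≠ j ∧ l ≠ k := by revert i j k; decide
    obtain ⟨l, l1, l2, l3⟩ := this
    rcases lt_or_gt_of_ne l3 with h | h
    · rw [← (hγ l k h).2.2.1]
      exact hdis i j l k h1 h l1.symm h2.symm l2.symm h3.symm s 1
    · rw [← (hγ k l h).2.1]
      exact hdis i j k l h1 h h2.symm l1.symm h3.symm l2.symm s 0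
  have hP : ∀ i j, i ≠ j → P i ≠ P j := by
    intro i j hij
    have : ∃ l, l ≠ i ∧ l ≠ j := by revert i j; decide
    obtain ⟨l, l1, l2⟩ := this
    rcases lt_or_gt_of_ne l1 with h | h
    · rw [← (hγ l i h).2.2.1]
      exact havoid _ _ _ h l2.symm hij.symm 1
    · rw [← (hγ i l h).2.1]
      exact havoid _ _ _ h hij.symm l2.symm 0
  let B : Fin 5 → Fin 5 → ℂ := fun u v => Complex.log (P (min u v) - P (max u v))
  let σ : Fin 5 → Fin 5 → ℤ := fun u v => if u < v then 0 else 1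
  let A : Fin 5 → Fin 5 → ℂ := fun u v => B u v + (σ u v) * (Real.pi * Complex.I)
  have hB : ∀ u v, B u v = B v u := fun u v => by simp only [B, min_comm, max_comm]
  have hA : ∀ u v, u ≠ v → Complex.exp (A u v) = P u - P v := by
    intro u v huv
    rcases lt_or_gt_of_ne huv with h | h
    · simp only [A, B, σ, if_pos h, min_eq_left h.le, max_eq_right h.le]
      simp only [Int.cast_zero, zero_mul, add_zero]
      exact Complex.exp_log (sub_ne_zero.mpr (hP _ _ huv))
    · simp only [A, B, σ, if_neg h.not_gt, min_eq_right h.le, max_eq_left h.le]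
      simp only [Int.cast_one, one_mul]
      rw [Complex.exp_add, Complex.exp_log (sub_ne_zero.mpr (hP _ _ huv.symm)),
        Complex.exp_pi_mul_I]
      ring
  have hn : ∀ a b c, ∃ n : ℤ, a < b → c ≠ a → c ≠ b → angChange (γ a b) (P c)
      = A b c - A a c + n * (2 * Real.pi * Complex.I) := by
    intro a b c
    by_cases h : a < b ∧ c ≠ a ∧ c ≠ b
    · obtain ⟨h1, h2, h3⟩ := h
      obtain ⟨n, hn⟩ := ang_mod (γ a b) (hγ a b h1).1 (P c) (A a c) (A b c)
        (havoid a b c h1 h2 h3) (by rw [(hγ a b h1).2.1, hA _ _ h2.symm])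
        (by rw [(hγ a b h1).2.2.1, hA _ _ h3.symm])
      exact ⟨n, fun _ _ _ => hn⟩
    · exact ⟨0, fun h1 h2 h3 => absurd ⟨h1, h2, h3⟩ h⟩
  choose n hn using hn
  have E : ∀ a b c d, a < b → c < d → a ≠ c → a ≠ d → b ≠ c → b ≠ d →
      2 * (n a b c + n c d b - n c d a - n a b d) + σ b c - σ a c + σ d b - σ c b
        - σ d a + σ c a - σ b d + σ a d = 0 := by
    intro a b c d h1 h2 h3 h4 h5 h6
    have := ang_rel (γ a b) (γ c d) (hγ a b h1).1 (hγ c d h2).1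
      (hdis a b c d h1 h2 h3 h4 h5 h6)
    rw [(hγ a b h1).2.1, (hγ a b h1).2.2.1, (hγ c d h2).2.1, (hγ c d h2).2.2.1,
      hn a b c h1 h3.symm h5.symm, hn a b d h1 h4.symm h6.symm, hn c d a h2 h3 h4,
      hn c d b h2 h5 h6] at this
    simp only [A] at this
    rw [hB c b, hB d b, hB c a, hB d a] at this
    have hpi : (Real.pi * Complex.I : ℂ) ≠ 0 := by simp [Real.pi_ne_zero]
    have : ((2 * (n a b c + n c d b - n c d a - n a b d) + σ b c - σ a c + σ d b - σ c b
        - σ d a + σ c a - σ b d + σ a d : ℤ) : ℂ) = 0 := by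
      apply mul_right_cancel₀ hpi
      push_cast
      linear_combination this
    exact_mod_cast this
  have e1 := E 0 1 2 3 (by decide) (by decide) (by decide) (by decide) (by decide) (by decide)
  have e2 := E 0 2 1 3 (by decide) (by decide) (by decide) (by decide) (by decide) (by decide)
  have e3 := E 0 3 1 2 (by decide) (by decide) (by decide) (by decide) (by decide) (by decide)
  have e4 := E 0 1 2 4 (by decide) (by decide) (by decide) (by decide) (by decide) (by decide)
  have e5 := E 0 2 1 4 (by decide) (by decide) (by decide) (by decide) (by decide) (by decide)
  have e6 := E 0 4 1 2 (by decide) (by decide) (by decide) (by decide) (by decide) (by decide)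
  have e7 := E 0 1 3 4 (by decide) (by decide) (by decide) (by decide) (by decide) (by decide)
  have e8 := E 0 3 1 4 (by decide) (by decide) (by decide) (by decide) (by decide) (by decide)
  have e9 := E 0 4 1 3 (by decide) (by decide) (by decide) (by decide) (by decide) (by decide)
  have e10 := E 0 2 3 4 (by decide) (by decide) (by decide) (by decide) (by decide) (by decide)
  have e11 := E 0 3 2 4 (by decide) (by decide) (by decide) (by decide) (by decide) (by decide)
  have e12 := E 0 4 2 3 (by decide) (by decide) (by decide) (by decide) (by decide) (by decide)
  have e13 := E 1 2 3 4 (by decide) (by decide) (by decide) (by decide) (by decide) (by decide)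
  have e14 := E 1 3 2 4 (by decide) (by decide) (by decide) (by decide) (by decide) (by decide)
  have e15 := E 1 4 2 3 (by decide) (by decide) (by decide) (by decide) (by decide) (by decide)
  simp [σ] at e1 e2 e3 e4 e5 e6 e7 e8 e9 e10 e11 e12 e13 e14 e15
  omega

section Drawings

variable {V : Type} {H : SimpleGraph V}

/-- closed arc of an (unordered) pair -/
def dclo (D : H.Drawing) (s : Sym2 V) : Set Plane :=
  {p | ∃ h : s ∈ H.edgeSet, p ∈ D.arc ⟨s, h⟩ '' Icc (0:ℝ) 1}

/-- open arc of an (unordered) pair -/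
def dope (D : H.Drawing) (s : Sym2 V) : Set Plane :=
  {p | ∃ h : s ∈ H.edgeSet, p ∈ D.inter ⟨s, h⟩}

/-- the pair is a crossed edge -/
def dcrossed (D : H.Drawing) (s : Sym2 V) : Prop :=
  ∃ t, t ≠ s ∧ (dope D s ∩ dope D t).Nonempty

theorem dclo_cases (D : H.Drawing) {s : Sym2 V} {p : Plane} (hp : p ∈ dclo D s) :
    p ∈ dope D s ∨ ∃ v ∈ s, p = D.pos v := by
  obtain ⟨h, t, ht, rfl⟩ := hp
  obtain ⟨u, v, he, h0, h1⟩ := D.arc_ends ⟨s, h⟩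
  simp only at he
  rcases eq_or_lt_of_le ht.1 with h' | h'
  · right; refine ⟨u, by rw [he]; exact Sym2.mem_mk_left _ _, by rw [← h', h0]⟩
  rcases eq_or_lt_of_le ht.2 with h'' | h''
  · right; refine ⟨v, by rw [he]; exact Sym2.mem_mk_right _ _, by rw [h'', h1]⟩
  · left; exact ⟨h, t, ⟨h', h''⟩, rfl⟩

theorem pos_not_dope (D : H.Drawing) (s : Sym2 V) (v : V) : D.pos v ∉ dope D s := by
  rintro ⟨h, hp⟩
  exact D.arc_avoid _ v hp

theorem pos_mem_dclo (D : H.Drawing) {s : Sym2 V} {v : V} (h : D.pos v ∈ dclo D s) : v ∈ s := by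
  rcases dclo_cases D h with h | ⟨w, hw, he⟩
  · exact absurd h (pos_not_dope D s v)
  · rw [D.pos_inj he]; exact hw

theorem dclo_disjoint (D : H.Drawing) {s t : Sym2 V} (hst : ∀ x, x ∈ s → x ∉ t)
    (ho : Disjoint (dope D s) (dope D t)) : Disjoint (dclo D s) (dclo D t) := by
  rw [Set.disjoint_left] at ho ⊢
  intro p hs ht
  rcases dclo_cases D hs with h | ⟨v, hv, rfl⟩
  · rcases dclo_cases D ht with h' | ⟨w, hw, rfl⟩
    · exact ho h h'
    · exact pos_not_dope D _ _ h
  · exact hst v hv (pos_mem_dclo D ht)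

theorem dclo_joined (D : H.Drawing) {u v : V} (h : H.Adj u v) :
    JoinedIn (dclo D s(u, v)) (D.pos u) (D.pos v) := by
  obtain ⟨a, b, he, h0, h1⟩ := D.arc_ends ⟨s(u, v), h⟩
  have key : JoinedIn (dclo D s(u, v)) (D.pos a) (D.pos b) := by
    refine JoinedIn.ofLine (D.arc_cont ⟨s(u, v), h⟩) h0 h1 ?_
    intro p hp
    exact ⟨h, hp⟩
  simp only [Sym2.eq_iff] at he
  rcases he with ⟨rfl, rfl⟩ | ⟨rfl, rfl⟩
  · exact key
  · exact key.symm

theorem dope_disjoint_of_not_crossed (D : H.Drawing) {s t : Sym2 V} (hs : ¬ dcrossed D s)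
    (hne : t ≠ s) : Disjoint (dope D s) (dope D t) := by
  rw [Set.disjoint_iff_inter_eq_empty]
  by_contra hc
  exact hs ⟨t, hne, Set.nonempty_iff_ne_empty.mpr hc⟩

theorem ic_unique_cross (D : H.Drawing) (hD : IsICDrawing D) {s t t' : Sym2 V}
    (h1 : t ≠ s) (h2 : t' ≠ s) (c1 : (dope D s ∩ dope D t).Nonempty)
    (c2 : (dope D s ∩ dope D t').Nonempty) : t = t' := by
  obtain ⟨p, ⟨hs, ps⟩, ht, pt⟩ := c1
  obtain ⟨p', ⟨hs', ps'⟩, ht', pt'⟩ := c2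
  have hsub : (D.crossSet ⟨s, hs⟩).Subsingleton := hD.1 ⟨s, hs⟩
  have m1 : ((⟨t, ht⟩, p) : H.edgeSet × Plane) ∈ D.crossSet ⟨s, hs⟩ :=
    ⟨by simpa using h1, ps, pt⟩
  have m2 : ((⟨t', ht'⟩, p') : H.edgeSet × Plane) ∈ D.crossSet ⟨s, hs⟩ :=
    ⟨by simpa using h2, ps', pt'⟩
  have := hsub m1 m2
  simp only [Prod.mk.injEq, Subtype.mk.injEq] at this
  exact this.1

theorem ic_unique_vertex (D : H.Drawing) (hD : IsICDrawing D) {s t : Sym2 V} (v : V)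
    (hs : v ∈ s) (ht : v ∈ t) (cs : dcrossed D s) (ct : dcrossed D t) : s = t := by
  obtain ⟨s', ns, p, ⟨hs1, ps⟩, hs2, ps'⟩ := cs
  obtain ⟨t', nt, q, ⟨ht1, qt⟩, ht2, qt'⟩ := ct
  have m1 : (⟨s, hs1⟩ : H.edgeSet) ∈
      {e : H.edgeSet | v ∈ (e : Sym2 V) ∧ (D.crossSet e).Nonempty} :=
    ⟨hs, ⟨(⟨s', hs2⟩, p), by simpa using ns, ps, ps'⟩⟩
  have m2 : (⟨t, ht1⟩ : H.edgeSet) ∈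
      {e : H.edgeSet | v ∈ (e : Sym2 V) ∧ (D.crossSet e).Nonempty} :=
    ⟨ht, ⟨(⟨t', ht2⟩, q), by simpa using nt, qt, qt'⟩⟩
  have := hD.2 v m1 m2
  simpa using this

/-- region in which a rim path between `w i` and `w j` has to stay -/
def rimSet (D : H.Drawing) (w : Fin 5 → V) (i j : Fin 5) : Set Plane :=
  {p | ∀ k l : Fin 5, k < 2 → k < l → k ≠ i → k ≠ j → l ≠ i → l ≠ j → p ∉ dclo D s(w k, w l)}

theorem no_K5_drawing (D : H.Drawing) (w : Fin 5 → V) (hw : Function.Injective w)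
    (hadj : ∀ k l : Fin 5, k < 2 → k < l → H.Adj (w k) (w l))
    (hunc : ∀ k l : Fin 5, k < 2 → 2 ≤ l → ¬ dcrossed D s(w k, w l))
    (hrim : ∀ i j : Fin 5, 2 ≤ i → i < j → JoinedIn (rimSet D w i j) (D.pos (w i)) (D.pos (w j))) :
    False := by
  let φ : Plane ≃L[ℝ] ℂ := Complex.equivRealProdCLM.symm
  let T : Fin 5 → Fin 5 → Set Plane := fun i j =>
    if i < 2 then dclo D s(w i, w j) else rimSet D w i j
  refine no_K5 (fun i => φ (D.pos (w i))) (fun i j => φ '' T i j) ?_ ?_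
  · intro i j hij
    refine JoinedIn.map ?_ φ.continuous
    by_cases hi : i < 2
    · simp only [T, if_pos hi]
      exact dclo_joined D (hadj i j hi hij)
    · simp only [T, if_neg hi]
      exact hrim i j (not_lt.mp hi) hij
  · intro i j k l hij hkl h1 h2 h3 h4
    refine Set.disjoint_image_of_injective φ.injective ?_
    by_cases hi : i < 2
    · by_cases hk : k < 2
      · simp only [T, if_pos hi, if_pos hk]
        refine dclo_disjoint D ?_ ?_
        · intro x hx hx'
          simp only [Sym2.mem_iff] at hx hx'
          rcases hx with rfl | rfl <;> rcases hx' with h | h <;> have := hw h <;> contradiction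
        · have hj : 2 ≤ j := by omega
          refine dope_disjoint_of_not_crossed D (hunc i j hi hj) ?_
          intro he
          rw [Sym2.eq_iff] at he
          rcases he with ⟨h, -⟩ | ⟨h, -⟩ <;> have := hw h <;> simp_all
      · simp only [T, if_pos hi, if_neg hk]
        rw [Set.disjoint_left]
        intro p hp hp'
        exact hp' i j hi hij h1 h2 h3 h4 hp
    · by_cases hk : k < 2
      · simp only [T, if_neg hi, if_pos hk]
        rw [Set.disjoint_left]
        intro p hp hp'
        exact hp k l hk hkl h1.symm h3.symm h2.symm h4.symm hp'
      · exfalso; omega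

/-- the spokes at `v` are uncrossed edges -/
def GoodV (D : H.Drawing) (x y v : V) : Prop :=
  (H.Adj x v ∧ ¬ dcrossed D s(x, v)) ∧ (H.Adj y v ∧ ¬ dcrossed D s(y, v))

/-- an edge not crossing `xy` -/
def OkEdge (D : H.Drawing) (x y u v : V) : Prop :=
  H.Adj u v ∧ Disjoint (dope D s(x, y)) (dope D s(u, v))

theorem joined_chain (D : H.Drawing) (F : Set Plane) (c : ℕ → V) (a b : ℕ) (hab : a ≤ b)
    (ha : D.pos (c a) ∈ F)
    (h : ∀ k, a ≤ k → k < b → JoinedIn F (D.pos (c k)) (D.pos (c (k+1)))) :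
    JoinedIn F (D.pos (c a)) (D.pos (c b)) := by
  induction b, hab using Nat.le_induction with
  | base => exact JoinedIn.refl ha
  | succ b hb ih =>
    exact (ih fun k h1 h2 => h k h1 (by omega)).trans (h b hb (by omega))

theorem no_cycle (D : H.Drawing) (x y : V) (hxy : H.Adj x y) (c : ℕ → V) (L : ℕ)
    (hinj : ∀ k l, k < L → l < L → c k = c l → k = l)
    (hx : ∀ k, k < L → c k ≠ x) (hy : ∀ k, k < L → c k ≠ y)
    (hE : ∀ k, k + 1 < L → OkEdge D x y (c k) (c (k+1)))
    (hE' : OkEdge D x y (c (L-1)) (c 0))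
    (a b d : ℕ) (hab : a < b) (hbd : b < d) (hd : d < L)
    (ga : GoodV D x y (c a)) (gb : GoodV D x y (c b)) (gd : GoodV D x y (c d)) : False := by
  let w : Fin 5 → V := ![x, y, c a, c b, c d]
  have w0 : w 0 = x := rfl
  have w1 : w 1 = y := rfl
  have w2 : w 2 = c a := rfl
  have w3 : w 3 = c b := rfl
  have w4 : w 4 = c d := rfl
  have hxy' : x ≠ y := hxy.ne
  have nab : c a ≠ c b := fun h => by have := hinj _ _ (by omega) (by omega) h; omega
  have nad : c a ≠ c d := fun h => by have := hinj _ _ (by omega) (by omega) h; omega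
  have nbd : c b ≠ c d := fun h => by have := hinj _ _ (by omega) (by omega) h; omega
  have xa := hx a (by omega)
  have xb := hx b (by omega)
  have xd := hx d (by omega)
  have ya := hy a (by omega)
  have yb := hy b (by omega)
  have yd := hy d (by omega)
  have hw : Function.Injective w := by
    intro i j hij
    fin_cases i <;> fin_cases j <;> first | rfl | (exfalso; simp [w] at hij; simp_all)
  have hadj : ∀ k l : Fin 5, k < 2 → k < l → H.Adj (w k) (w l) := by
    intro k l h1 h2
    fin_cases k <;> fin_cases l <;> simp at h1 h2 <;>
      first | exact hxy | exact ga.1.1 | exact gb.1.1 | exact gd.1.1 | exact ga.2.1 | exact gb.2.1 | exact gd.2.1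
  have hunc : ∀ k l : Fin 5, k < 2 → 2 ≤ l → ¬ dcrossed D s(w k, w l) := by
    intro k l h1 h2
    fin_cases k <;> fin_cases l <;> simp at h1 h2 <;>
      first | exact ga.1.2 | exact gb.1.2 | exact gd.1.2 | exact ga.2.2 | exact gb.2.2 | exact gd.2.2
  -- a pair of rim vertices, both avoiding the third chosen one, is joined inside the region
  have hmem : ∀ i j v, (∀ k, k ≠ i → k ≠ j → v ≠ w k) → D.pos v ∈ rimSet D w i j := by
    intro i j v hv k l _ _ hki hkj hli hlj hp
    have := pos_mem_dclo D hp
    rw [Sym2.mem_iff] at this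
    rcases this with h | h
    · exact hv k hki hkj h
    · exact hv l hli hlj h
  have hstep : ∀ i j u v, (∀ k, k ≠ i → k ≠ j → u ≠ w k) → (∀ k, k ≠ i → k ≠ j → v ≠ w k) →
      OkEdge D x y u v → JoinedIn (rimSet D w i j) (D.pos u) (D.pos v) := by
    intro i j u v hu hv hok
    refine (dclo_joined D hok.1).mono ?_
    intro p hp k l hk hkl hki hkj hli hlj hp'
    refine Set.disjoint_left.mp (dclo_disjoint D (s := s(w k, w l)) (t := s(u, v)) ?_ ?_) hp' hp
    · intro z hz hz'
      rw [Sym2.mem_iff] at hz hz'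
      rcases hz with rfl | rfl
      · rcases hz' with h | h
        · exact hu k hki hkj h.symm
        · exact hv k hki hkj h.symm
      · rcases hz' with h | h
        · exact hu l hli hlj h.symm
        · exact hv l hli hlj h.symm
    · by_cases hl : 2 ≤ l
      · refine dope_disjoint_of_not_crossed D (hunc k l hk hl) ?_
        intro he
        rw [Sym2.eq_iff] at he
        rcases he with ⟨h, -⟩ | ⟨-, h⟩
        · exact hu k hki hkj h
        · exact hv k hki hkj h
      · have : k = 0 := by omega
        have : l = 1 := by omega
        subst k l
        exact hok.2
  refine no_K5_drawing D w hw hadj hunc ?_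
  have av : ∀ i j k₀ : Fin 5, ∀ t r : ℕ, t < L → r < L → w k₀ = c r → t ≠ r →
      (∀ k : Fin 5, k ≠ i → k ≠ j → k = 0 ∨ k = 1 ∨ k = k₀) →
      (∀ k, k ≠ i → k ≠ j → c t ≠ w k) := by
    intro i j k₀ t r ht hr hk₀ htr hall k hki hkj he
    rcases hall k hki hkj with rfl | rfl | rfl
    · exact hx t ht he
    · exact hy t ht he
    · rw [hk₀] at he
      exact htr (hinj _ _ ht hr he)
  have c23 : JoinedIn (rimSet D w 2 3) (D.pos (w 2)) (D.pos (w 3)) := by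
    have hv := fun t ht htr => av 2 3 4 t d ht hd w4 htr (by decide)
    refine joined_chain D _ c a b hab.le (hmem _ _ _ (hv a (by omega) (by omega))) ?_
    intro k h1 h2
    exact hstep _ _ _ _ (hv k (by omega) (by omega)) (hv (k+1) (by omega) (by omega))
      (hE k (by omega))
  have c34 : JoinedIn (rimSet D w 3 4) (D.pos (w 3)) (D.pos (w 4)) := by
    have hv := fun t ht htr => av 3 4 2 t a ht (by omega) w2 htr (by decide)
    refine joined_chain D _ c b d hbd.le (hmem _ _ _ (hv b (by omega) (by omega))) ?_
    intro k h1 h2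
    exact hstep _ _ _ _ (hv k (by omega) (by omega)) (hv (k+1) (by omega) (by omega))
      (hE k (by omega))
  have c24 : JoinedIn (rimSet D w 2 4) (D.pos (w 2)) (D.pos (w 4)) := by
    have hv := fun t ht htr => av 2 4 3 t b ht (by omega) w3 htr (by decide)
    have s1 : JoinedIn (rimSet D w 2 4) (D.pos (c 0)) (D.pos (c a)) := by
      refine joined_chain D _ c 0 a (by omega) (hmem _ _ _ (hv 0 (by omega) (by omega))) ?_
      intro k h1 h2
      exact hstep _ _ _ _ (hv k (by omega) (by omega)) (hv (k+1) (by omega) (by omega))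
        (hE k (by omega))
    have s2 : JoinedIn (rimSet D w 2 4) (D.pos (c d)) (D.pos (c (L-1))) := by
      refine joined_chain D _ c d (L-1) (by omega) (hmem _ _ _ (hv d (by omega) (by omega))) ?_
      intro k h1 h2
      exact hstep _ _ _ _ (hv k (by omega) (by omega)) (hv (k+1) (by omega) (by omega))
        (hE k (by omega))
    have s3 : JoinedIn (rimSet D w 2 4) (D.pos (c (L-1))) (D.pos (c 0)) :=
      hstep _ _ _ _ (hv (L-1) (by omega) (by omega)) (hv 0 (by omega) (by omega)) hE'
    exact ((s2.trans s3).trans s1).symm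
  intro i j h1 h2
  have : (i = 2 ∧ j = 3) ∨ (i = 3 ∧ j = 4) ∨ (i = 2 ∧ j = 4) := by omega
  rcases this with ⟨rfl, rfl⟩ | ⟨rfl, rfl⟩ | ⟨rfl, rfl⟩
  · exact c23
  · exact c34
  · exact c24

end Drawings

/-- the join of an edge with a cycle of length `m` -/
def biWheel (m : ℕ) : SimpleGraph (Fin (m + 2)) where
  Adj u v := u ≠ v ∧ (m ≤ u.val ∨ m ≤ v.val ∨ u.val + 1 = v.val ∨ v.val + 1 = u.val ∨
    (u.val = 0 ∧ v.val + 1 = m) ∨ (v.val = 0 ∧ u.val + 1 = m))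
  symm := ⟨fun u v h => ⟨h.1.symm, by have := h.2; omega⟩⟩
  loopless := ⟨fun u h => h.1 rfl⟩

/-- rim vertices, indexed periodically -/
def rimV (m : ℕ) (hm : 0 < m) (k : ℕ) : Fin (m + 2) :=
  ⟨k % m, by have := Nat.mod_lt k hm; omega⟩

theorem rimV_val (m : ℕ) (hm : 0 < m) (k : ℕ) (hk : k < 2 * m) :
    (rimV m hm k).val = if k < m then k else k - m := by
  simp only [rimV]
  split_ifs with h
  · exact Nat.mod_eq_of_lt h
  · rw [Nat.mod_eq_sub_mod (by omega), Nat.mod_eq_of_lt (by omega)]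

theorem rimV_val_lt (m : ℕ) (hm : 0 < m) (k : ℕ) : (rimV m hm k).val < m := Nat.mod_lt k hm

theorem biWheel_maximal (m : ℕ) (hm : 5 ≤ m) (H : SimpleGraph (Fin (m + 2)))
    (hH : biWheel m < H) : ¬ ICPlanar H := by
  rintro ⟨D, hD⟩
  have hle : ∀ u v, (biWheel m).Adj u v → H.Adj u v := fun u v h => hH.le h
  obtain ⟨i, j, hij, hjm, hadjij, hne1, hne2⟩ : ∃ i j : ℕ, i < j ∧ j < m ∧
      H.Adj (rimV m (by omega) i) (rimV m (by omega) j) ∧ i + 1 ≠ j ∧ ¬ (i = 0 ∧ j + 1 = m) := by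
    have : ∃ u v, H.Adj u v ∧ ¬ (biWheel m).Adj u v := by
      by_contra hc
      push Not at hc
      exact hH.not_ge hc
    obtain ⟨u, v, huv, hnot⟩ := this
    have hnot' : ¬ (m ≤ u.val ∨ m ≤ v.val ∨ u.val + 1 = v.val ∨ v.val + 1 = u.val ∨
      (u.val = 0 ∧ v.val + 1 = m) ∨ (v.val = 0 ∧ u.val + 1 = m)) := fun h => hnot ⟨huv.ne, h⟩
    have huv' : u.val ≠ v.val := fun h => huv.ne (Fin.ext h)
    have ru : rimV m (by omega) u.val = u := Fin.ext (Nat.mod_eq_of_lt (by omega))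
    have rv : rimV m (by omega) v.val = v := Fin.ext (Nat.mod_eq_of_lt (by omega))
    rcases lt_or_gt_of_ne huv' with h | h
    · exact ⟨u.val, v.val, h, by omega, by rw [ru, rv]; exact huv, by omega, by omega⟩
    · exact ⟨v.val, u.val, h, by omega, by rw [ru, rv]; exact huv.symm, by omega, by omega⟩
  have hm0 : 0 < m := by omega
  let x : Fin (m + 2) := ⟨m, by omega⟩
  let y : Fin (m + 2) := ⟨m + 1, by omega⟩
  let r : ℕ → Fin (m + 2) := rimV m hm0
  have xv : x.val = m := rfl
  have yv : y.val = m + 1 := rfl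
  have rlt : ∀ k, (r k).val < m := rimV_val_lt m hm0
  have rval : ∀ k, k < 2 * m → (r k).val = if k < m then k else k - m := rimV_val m hm0
  have rval' : ∀ k, k < m → (r k).val = k := fun k hk => Nat.mod_eq_of_lt hk
  have rper : ∀ k, r (m + k) = r k := fun k => Fin.ext (Nat.add_mod_left m k)
  change H.Adj (r i) (r j) at hadjij
  have hxr : ∀ k, r k ≠ x := fun k h => by have := rlt k; have := congrArg Fin.val h; omega
  have hyr : ∀ k, r k ≠ y := fun k h => by have := rlt k; have := congrArg Fin.val h; omega
  have hxyne : x ≠ y := fun h => by have := congrArg Fin.val h; omega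
  have hxy : H.Adj x y := hle _ _ ⟨hxyne, by omega⟩
  have hxadj : ∀ k, H.Adj x (r k) := fun k => hle _ _ ⟨(hxr k).symm, by omega⟩
  have hyadj : ∀ k, H.Adj y (r k) := fun k => hle _ _ ⟨(hyr k).symm, by omega⟩
  have hradj : ∀ k, k < m + i → H.Adj (r k) (r (k + 1)) := by
    intro k hk
    have h1 := rval k (by omega)
    have h2 := rval (k + 1) (by omega)
    split_ifs at h1 h2 <;>
      exact hle _ _ ⟨fun h => by have := congrArg Fin.val h; omega, by omega⟩
  have hrclose : H.Adj (r (m - 1)) (r 0) := by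
    have h1 := rval' (m - 1) (by omega)
    have h2 := rval' 0 (by omega)
    exact hle _ _ ⟨fun h => by have := congrArg Fin.val h; omega, by omega⟩
  have rinj : ∀ k l, k < m → l < m → r k = r l → k = l := by
    intro k l hk hl h
    have := congrArg Fin.val h
    rw [rval' k hk, rval' l hl] at this
    exact this
  have rim_ne_xy : ∀ k l, s(r k, r l) ≠ s(x, y) := by
    intro k l h
    rw [Sym2.eq_iff] at h
    rcases h with ⟨h, -⟩ | ⟨h, -⟩
    · exact hxr _ h
    · exact hyr _ h
  by_cases hc : dcrossed D s(x, y)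
  · -- `xy` is crossed by `f`, so all spokes are uncrossed
    have good : ∀ k, GoodV D x y (r k) := by
      intro k
      refine ⟨⟨hxadj k, fun h => ?_⟩, ⟨hyadj k, fun h => ?_⟩⟩
      · have := ic_unique_vertex D hD x (Sym2.mem_mk_left _ _) (Sym2.mem_mk_left _ _) h hc
        rw [Sym2.eq_iff] at this
        rcases this with ⟨-, h⟩ | ⟨h, -⟩
        · exact hyr _ h
        · exact hxyne h
      · have := ic_unique_vertex D hD y (Sym2.mem_mk_left _ _) (Sym2.mem_mk_right _ _) h hc
        rw [Sym2.eq_iff] at this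
        rcases this with ⟨h, -⟩ | ⟨-, h⟩
        · exact hxyne h.symm
        · exact hxr _ h
    obtain ⟨f, hf, hfc⟩ := hc
    have ok : ∀ k l, H.Adj (r k) (r l) → s(r k, r l) ≠ f → OkEdge D x y (r k) (r l) := by
      intro k l hkl hne
      refine ⟨hkl, ?_⟩
      rw [Set.disjoint_iff_inter_eq_empty]
      by_contra hcon
      exact hne (ic_unique_cross D hD (rim_ne_xy k l) hf
        (Set.nonempty_iff_ne_empty.mpr hcon) hfc)
    by_cases hA : f = s(r i, r j)
    · subst hA
      refine no_cycle D x y hxy r m rinj (fun k _ => hxr k) (fun k _ => hyr k) ?_ ?_ 0 1 2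
        (by omega) (by omega) (by omega) (good 0) (good 1) (good 2)
      · intro k hk
        refine ok _ _ (hradj k (by omega)) ?_
        rw [Ne, Sym2.eq_iff]
        rintro (⟨h1, h2⟩ | ⟨h1, h2⟩)
        · have := rinj _ _ (by omega) (by omega) h1
          have := rinj _ _ (by omega) (by omega) h2
          omega
        · have := rinj _ _ (by omega) (by omega) h1
          have := rinj _ _ (by omega) (by omega) h2
          omega
      · refine ok _ _ hrclose ?_
        rw [Ne, Sym2.eq_iff]
        rintro (⟨h1, h2⟩ | ⟨h1, h2⟩)
        · have := rinj _ _ (by omega) (by omega) h1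
          have := rinj _ _ (by omega) (by omega) h2
          omega
        · have := rinj _ _ (by omega) (by omega) h1
          have := rinj _ _ (by omega) (by omega) h2
          omega
    by_cases hB : ∃ k, i ≤ k ∧ k < j ∧ f = s(r k, r (k + 1))
    · obtain ⟨k, hik, hkj, rfl⟩ := hB
      refine no_cycle D x y hxy (fun t => r (j + t)) (m - (j - i) + 1) ?_ (fun t _ => hxr _)
        (fun t _ => hyr _) ?_ ?_ 0 1 2 (by omega) (by omega) (by omega) (good _) (good _) (good _)
      · intro t t' ht ht' h
        have h0 := congrArg Fin.val h
        have h1 := rval (j + t) (by omega)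
        have h2 := rval (j + t') (by omega)
        split_ifs at h1 h2 <;> omega
      · intro t ht
        refine ok _ _ (hradj (j + t) (by omega)) ?_
        have h1 := rval (j + t) (by omega)
        have h2 := rval (j + t + 1) (by omega)
        have h3 := rval' k (by omega)
        have h4 := rval' (k + 1) (by omega)
        rw [Ne, Sym2.eq_iff, Fin.ext_iff, Fin.ext_iff, Fin.ext_iff, Fin.ext_iff, ← add_assoc]
        split_ifs at h1 h2 <;> omega
      · have e : j + (m - (j - i) + 1 - 1) = m + i := by omega
        simp only [e, rper, add_zero]
        exact ok _ _ hadjij (Ne.symm hA)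
    · refine no_cycle D x y hxy (fun t => r (i + t)) (j - i + 1) ?_ (fun t _ => hxr _)
        (fun t _ => hyr _) ?_ ?_ 0 1 2 (by omega) (by omega) (by omega) (good _) (good _) (good _)
      · intro t t' ht ht' h
        have := rinj _ _ (by omega) (by omega) h
        omega
      · intro t ht
        refine ok _ _ (hradj (i + t) (by omega)) (fun h => hB ⟨i + t, by omega, by omega, h.symm⟩)
      · have e : i + (j - i + 1 - 1) = j := by omega
        simp only [e, add_zero]
        refine ok _ _ hadjij.symm ?_
        rw [Sym2.eq_swap]
        exact Ne.symm hA
  · -- `xy` is uncrossed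
    have ok : ∀ k l, H.Adj (r k) (r l) → OkEdge D x y (r k) (r l) := fun k l h =>
      ⟨h, dope_disjoint_of_not_crossed D hc (rim_ne_xy k l)⟩
    have bad : ∀ z, (∀ k, r k ≠ z) → ∃ u, ∀ k, k < 5 → k ≠ u → ¬ dcrossed D s(z, r k) := by
      intro z hz
      by_cases h : ∃ u, u < 5 ∧ dcrossed D s(z, r u)
      · obtain ⟨u, hu, hcu⟩ := h
        refine ⟨u, fun k hk hku hck => hku ?_⟩
        have := ic_unique_vertex D hD z (Sym2.mem_mk_left _ _) (Sym2.mem_mk_left _ _) hck hcu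
        rw [Sym2.eq_iff] at this
        rcases this with ⟨-, h⟩ | ⟨h, -⟩
        · exact rinj _ _ (by omega) (by omega) h
        · exact absurd h.symm (hz _)
      · exact ⟨5, fun k hk _ hck => h ⟨k, hk, hck⟩⟩
    obtain ⟨u, hu⟩ := bad x hxr
    obtain ⟨w, hw⟩ := bad y hyr
    have good : ∀ k, k < 5 → k ≠ u → k ≠ w → GoodV D x y (r k) := fun k h1 h2 h3 =>
      ⟨⟨hxadj k, hu k h1 h2⟩, ⟨hyadj k, hw k h1 h3⟩⟩
    have pick : ∃ a b d : ℕ, a < b ∧ b < d ∧ d < 5 ∧ (a ≠ u ∧ a ≠ w) ∧ (b ≠ u ∧ b ≠ w) ∧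
        (d ≠ u ∧ d ≠ w) := by
      by_cases h0 : 0 ≠ u ∧ 0 ≠ w
      · by_cases h1 : 1 ≠ u ∧ 1 ≠ w
        · by_cases h2 : 2 ≠ u ∧ 2 ≠ w
          · exact ⟨0, 1, 2, by omega⟩
          · by_cases h3 : 3 ≠ u ∧ 3 ≠ w
            · exact ⟨0, 1, 3, by omega⟩
            · exact ⟨0, 1, 4, by omega⟩
        · by_cases h2 : 2 ≠ u ∧ 2 ≠ w
          · by_cases h3 : 3 ≠ u ∧ 3 ≠ w
            · exact ⟨0, 2, 3, by omega⟩
            · exact ⟨0, 2, 4, by omega⟩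
          · exact ⟨0, 3, 4, by omega⟩
      · by_cases h1 : 1 ≠ u ∧ 1 ≠ w
        · by_cases h2 : 2 ≠ u ∧ 2 ≠ w
          · by_cases h3 : 3 ≠ u ∧ 3 ≠ w
            · exact ⟨1, 2, 3, by omega⟩
            · exact ⟨1, 2, 4, by omega⟩
          · exact ⟨1, 3, 4, by omega⟩
        · exact ⟨2, 3, 4, by omega⟩
    obtain ⟨a, b, d, hab, hbd, hd, ha', hb', hd'⟩ := pick
    refine no_cycle D x y hxy r m rinj (fun k _ => hxr k) (fun k _ => hyr k) ?_ ?_ a b d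
      hab hbd (by omega) (good a (by omega) ha'.1 ha'.2) (good b (by omega) hb'.1 hb'.2)
      (good d (by omega) hd'.1 hd'.2)
    · intro k hk
      exact ok _ _ (hradj k (by omega))
    · exact ok _ _ hrclose

theorem rimV_val' (m : ℕ) (hm : 0 < m) (k : ℕ) (hk : k < m) : (rimV m hm k).val = k :=
  Nat.mod_eq_of_lt hk

theorem rimV_of_lt (m : ℕ) (hm : 0 < m) (v : Fin (m + 2)) (hv : v.val < m) :
    rimV m hm v.val = v := Fin.ext (Nat.mod_eq_of_lt hv)

/-- classification of the edges -/
theorem biWheel_edges (m : ℕ) (hm : 0 < m) (s : Sym2 (Fin (m + 2)))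
    (hs : s ∈ (biWheel m).edgeSet) :
    s = s(⟨m, by omega⟩, ⟨m + 1, by omega⟩) ∨ (∃ r, r < m ∧ s = s(⟨m, by omega⟩, rimV m hm r)) ∨
    (∃ r, r < m ∧ s = s(⟨m + 1, by omega⟩, rimV m hm r)) ∨
    (∃ r, r + 1 < m ∧ s = s(rimV m hm r, rimV m hm (r + 1))) ∨
    s = s(rimV m hm (m - 1), rimV m hm 0) := by
  induction s using Sym2.ind with
  | _ u v =>
  wlog huv : v.val < u.val generalizing u v
  · have hne : u ≠ v := hs.1
    have hne' : u.val ≠ v.val := fun h => hne (Fin.ext h)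
    rw [Sym2.eq_swap]
    exact this v u (by rw [Sym2.eq_swap]; exact hs) (by omega)
  have h : m ≤ u.val ∨ m ≤ v.val ∨ u.val + 1 = v.val ∨ v.val + 1 = u.val ∨
    (u.val = 0 ∧ v.val + 1 = m) ∨ (v.val = 0 ∧ u.val + 1 = m) :=
      (show (biWheel m).Adj u v from hs).2
  by_cases hu : u.val = m + 1
  · have eu : u = ⟨m + 1, by omega⟩ := Fin.ext hu
    by_cases hv : v.val = m
    · have ev : v = ⟨m, by omega⟩ := Fin.ext hv
      left; rw [eu, ev, Sym2.eq_swap]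
    · right; right; left
      exact ⟨v.val, by omega, by rw [rimV_of_lt m hm v (by omega), eu]⟩
  by_cases hu' : u.val = m
  · have eu : u = ⟨m, by omega⟩ := Fin.ext hu'
    right; left
    exact ⟨v.val, by omega, by rw [rimV_of_lt m hm v (by omega), eu]⟩
  right; right; right
  by_cases h1 : v.val + 1 = u.val
  · left
    refine ⟨v.val, by omega, ?_⟩
    rw [h1, rimV_of_lt m hm v (by omega), rimV_of_lt m hm u (by omega), Sym2.eq_swap]
  · right
    have e1 : m - 1 = u.val := by omega
    have e2 : 0 = v.val := by omega
    rw [e1, e2, rimV_of_lt m hm v (by omega), rimV_of_lt m hm u (by omega)]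

/-- enumeration of the edges -/
def edgeEnum (m : ℕ) (hm : 0 < m) : Option (Fin m × Fin 3) → Sym2 (Fin (m + 2))
  | none => s(⟨m, by omega⟩, ⟨m + 1, by omega⟩)
  | some (r, 0) => s(⟨m, by omega⟩, rimV m hm r)
  | some (r, 1) => s(⟨m + 1, by omega⟩, rimV m hm r)
  | some (r, 2) => s(rimV m hm r, rimV m hm (r + 1))

theorem biWheel_ncard (m : ℕ) (hm : 3 ≤ m) : (biWheel m).edgeSet.ncard = 3 * (m + 2) - 5 := by
  have hm0 : 0 < m := by omega
  have hinj : Function.Injective (edgeEnum m hm0) := by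
    intro a b hab
    have hr : ∀ q : Fin m, (rimV m hm0 q.val).val = q.val := fun q => rimV_val' m hm0 _ q.2
    have hr' : ∀ q : Fin m, (rimV m hm0 (q.val + 1)).val =
      if q.val + 1 < m then q.val + 1 else q.val + 1 - m :=
        fun q => rimV_val m hm0 _ (by omega)
    rcases a with _ | ⟨q, i⟩ <;> rcases b with _ | ⟨q', i'⟩
    · rfl
    · have := hr q'
      have := hr' q'
      split_ifs at this <;> fin_cases i' <;>
        simp [edgeEnum, Sym2.eq_iff, Fin.ext_iff] at hab <;> omega
    · have := hr q
      have := hr' q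
      split_ifs at this <;> fin_cases i <;>
        simp [edgeEnum, Sym2.eq_iff, Fin.ext_iff] at hab <;> omega
    · have h1 := hr q
      have h2 := hr' q
      have h3 := hr q'
      have h4 := hr' q'
      have : q.val = q'.val ∧ i = i' := by
        split_ifs at h2 h4 <;> fin_cases i <;> fin_cases i' <;>
          simp [edgeEnum, Sym2.eq_iff, Fin.ext_iff] at hab ⊢ <;> omega
      rw [Fin.ext this.1, this.2]
  have hrange : (biWheel m).edgeSet = Set.range (edgeEnum m hm0) := by
    ext s
    constructor
    · intro hs
      rcases biWheel_edges m hm0 s hs with h | ⟨r, hr, h⟩ | ⟨r, hr, h⟩ | ⟨r, hr, h⟩ | h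
      · exact ⟨none, h.symm⟩
      · exact ⟨some (⟨r, hr⟩, 0), h.symm⟩
      · exact ⟨some (⟨r, hr⟩, 1), h.symm⟩
      · exact ⟨some (⟨r, by omega⟩, 2), h.symm⟩
      · refine ⟨some (⟨m - 1, by omega⟩, 2), ?_⟩
        rw [h]
        have e : m - 1 + 1 = m := by omega
        have : rimV m hm0 m = rimV m hm0 0 := Fin.ext (by simp [rimV])
        simp only [edgeEnum, e, this]
    · rintro ⟨c, rfl⟩
      have hr : ∀ q : Fin m, (rimV m hm0 q.val).val = q.val := fun q => rimV_val' m hm0 _ q.2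
      have hr' : ∀ q : Fin m, (rimV m hm0 (q.val + 1)).val =
        if q.val + 1 < m then q.val + 1 else q.val + 1 - m :=
          fun q => rimV_val m hm0 _ (by omega)
      rcases c with _ | ⟨q, i⟩
      · exact ⟨by simp, by simp⟩
      · have h1 := hr q
        have h2 := hr' q
        have h3 := q.2
        fin_cases i
        · exact ⟨fun h => by have := congrArg Fin.val h; simp only at this; omega, by simp⟩
        · exact ⟨fun h => by have := congrArg Fin.val h; simp only at this; omega, by simp⟩
        · have goal' : (biWheel m).Adj (rimV m hm0 q.val) (rimV m hm0 (q.val + 1)) := by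
            generalize rimV m hm0 q.val = a at h1 ⊢
            generalize rimV m hm0 (q.val + 1) = b at h2 ⊢
            refine ⟨fun h => ?_, ?_⟩
            · have := congrArg Fin.val h
              split_ifs at h2 <;> omega
            · split_ifs at h2 <;> omega
          exact goal'
  rw [hrange, Set.ncard_range_of_injective hinj]
  simp
  omega

/-- the open straight segment of a pair -/
def oseg {V : Type} (pos : V → Plane) (s : Sym2 V) : Set Plane :=
  Sym2.lift ⟨fun u v => openSegment ℝ (pos u) (pos v), fun _ _ => openSegment_symm ℝ _ _⟩ s

theorem icplanar_of_straight {V : Type} (G : SimpleGraph V) (pos : V → Plane)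
    (hpos : Function.Injective pos)
    (havoid : ∀ s ∈ G.edgeSet, ∀ w, pos w ∉ oseg pos s)
    (e₀ f₀ : Sym2 V) (hdisj : ∀ x, x ∈ e₀ → x ∉ f₀)
    (hsub : (oseg pos e₀ ∩ oseg pos f₀).Subsingleton)
    (hcross : ∀ s ∈ G.edgeSet, ∀ t ∈ G.edgeSet, s ≠ t → (oseg pos s ∩ oseg pos t).Nonempty →
      (s = e₀ ∧ t = f₀) ∨ (s = f₀ ∧ t = e₀)) : ICPlanar G := by
  let arc : G.edgeSet → ℝ → Plane := fun e =>
    AffineMap.lineMap (pos (Quot.out e.1).1) (pos (Quot.out e.1).2)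
  have hout : ∀ e : G.edgeSet, e.1 = s((Quot.out e.1).1, (Quot.out e.1).2) := fun e =>
    (Quot.out_eq e.1).symm
  have harc : ∀ e : G.edgeSet, arc e '' Ioo (0:ℝ) 1 = oseg pos e.1 := by
    intro e
    rw [← openSegment_eq_image_lineMap]
    conv_rhs => rw [hout e]
    rfl
  have hne : ∀ e : G.edgeSet, pos (Quot.out e.1).1 ≠ pos (Quot.out e.1).2 := by
    intro e h
    have := e.2
    rw [hout e] at this
    exact (G.mem_edgeSet.mp this).ne (hpos h)
  let D : G.Drawing :=
    { pos := pos
      pos_inj := hpos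
      arc := arc
      arc_cont := fun e => AffineMap.lineMap_continuous.continuousOn
      arc_inj := fun e => (AffineMap.lineMap_injective ℝ (hne e)).injOn
      arc_ends := fun e => ⟨_, _, hout e, AffineMap.lineMap_apply_zero _ _,
        AffineMap.lineMap_apply_one _ _⟩
      arc_avoid := fun e w => by rw [harc]; exact havoid e.1 e.2 w
      no_incident_cross := fun e f hef h x hx => by
        rw [harc, harc] at h
        rcases hcross e.1 e.2 f.1 f.2 (fun h => hef (Subtype.ext h)) h with ⟨h1, h2⟩ | ⟨h1, h2⟩
        · exact hdisj x (h1 ▸ hx.1) (h2 ▸ hx.2)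
        · exact hdisj x (h2 ▸ hx.2) (h1 ▸ hx.1) }
  have key : ∀ (e : G.edgeSet) (fp : G.edgeSet × Plane), fp ∈ D.crossSet e →
      fp.2 ∈ oseg pos e₀ ∩ oseg pos f₀ ∧
      ((e.1 = e₀ ∧ fp.1.1 = f₀) ∨ (e.1 = f₀ ∧ fp.1.1 = e₀)) := by
    rintro e ⟨f, p⟩ ⟨hne, hp1, hp2⟩
    have h1 : p ∈ oseg pos e.1 := by rw [← harc]; exact hp1
    have h2 : p ∈ oseg pos f.1 := by rw [← harc]; exact hp2
    have := hcross e.1 e.2 f.1 f.2 (fun h => hne (Subtype.ext h.symm)) ⟨p, h1, h2⟩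
    refine ⟨?_, this⟩
    rcases this with ⟨a, b⟩ | ⟨a, b⟩
    · rw [a] at h1; rw [b] at h2; exact ⟨h1, h2⟩
    · rw [a] at h1; rw [b] at h2; exact ⟨h2, h1⟩
  have hef : e₀ ≠ f₀ := by
    intro h
    induction e₀ using Sym2.ind with
    | _ u v => exact hdisj u (Sym2.mem_mk_left _ _) (h ▸ Sym2.mem_mk_left _ _)
  refine ⟨D, ?_, ?_⟩
  · intro e a ha b hb
    obtain ⟨a1, a2⟩ := key e a ha
    obtain ⟨b1, b2⟩ := key e b hb
    refine Prod.ext (Subtype.ext ?_) (hsub a1 b1)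
    rcases a2 with ⟨h1, h2⟩ | ⟨h1, h2⟩ <;> rcases b2 with ⟨h3, h4⟩ | ⟨h3, h4⟩
    · rw [h2, h4]
    · exact absurd (h1.symm.trans h3) hef
    · exact absurd (h3.symm.trans h1) hef
    · rw [h2, h4]
  · rintro v e ⟨ve, a, ha⟩ f ⟨vf, b, hb⟩
    obtain ⟨-, a2⟩ := key e a ha
    obtain ⟨-, b2⟩ := key f b hb
    apply Subtype.ext
    rcases a2 with ⟨h1, h2⟩ | ⟨h1, h2⟩ <;> rcases b2 with ⟨h3, h4⟩ | ⟨h3, h4⟩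
    · rw [h1, h3]
    · exact absurd (h3 ▸ vf) (hdisj v (h1 ▸ ve))
    · exact absurd (h1 ▸ ve) (hdisj v (h3 ▸ vf))
    · rw [h1, h3]

def onXY (K X Y : ℝ) : Prop := X = 0 ∧ -2 < Y ∧ Y < K
def onX (K : ℝ) (t : ℤ) (X Y : ℝ) : Prop :=
  ∃ l : ℝ, 0 < l ∧ l < 1 ∧ X = l * t ∧ Y = (1 - l) * K - l * (t : ℝ) ^ 2
def onY (t : ℤ) (X Y : ℝ) : Prop :=
  ∃ l : ℝ, 0 < l ∧ l < 1 ∧ X = l * t ∧ Y = -2 * (1 - l) - l * (t : ℝ) ^ 2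
def onP (s : ℤ) (X Y : ℝ) : Prop :=
  (s : ℝ) < X ∧ X < s + 2 ∧ Y + (2 * s + 2) * X - s * (s + 2) = 0
def onLR (T X Y : ℝ) : Prop := Y = - T ^ 2 ∧ -T < X ∧ X < T

theorem onX_h {K X Y : ℝ} {t : ℤ} (hK : (t : ℝ) ^ 2 < K) (h : onX K t X Y) : 0 < Y + X ^ 2 := by
  obtain ⟨l, h0, h1, rfl, rfl⟩ := h
  have h2 : 0 < K - l * (t : ℝ) ^ 2 := by nlinarith [sq_nonneg (t : ℝ)]
  have : 0 < (1 - l) * (K - l * (t : ℝ) ^ 2) := mul_pos (by linarith) h2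
  nlinarith

theorem onX_ne {K X Y : ℝ} {t : ℤ} (ht : t ≠ 0) (h : onX K t X Y) : X ≠ 0 := by
  obtain ⟨l, h0, h1, rfl, rfl⟩ := h
  exact mul_ne_zero h0.ne' (by exact_mod_cast ht)

theorem onY_h {X Y : ℝ} {t : ℤ} (h : onY t X Y) : Y + X ^ 2 < 0 := by
  obtain ⟨l, h0, h1, rfl, rfl⟩ := h
  have : 0 < (1 - l) * (2 + l * (t : ℝ) ^ 2) := mul_pos (by linarith) (by positivity)
  nlinarith

theorem onY_ne {X Y : ℝ} {t : ℤ} (ht : t ≠ 0) (h : onY t X Y) : X ≠ 0 := by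
  obtain ⟨l, h0, h1, rfl, rfl⟩ := h
  exact mul_ne_zero h0.ne' (by exact_mod_cast ht)

theorem onP_h {X Y : ℝ} {s : ℤ} (h : onP s X Y) : Y + X ^ 2 < 0 := by
  obtain ⟨h0, h1, h2⟩ := h
  have : 0 < (X - s) * (s + 2 - X) := mul_pos (by linarith) (by linarith)
  nlinarith

theorem onLR_h {T X Y : ℝ} (h : onLR T X Y) : Y + X ^ 2 < 0 := by
  obtain ⟨h0, h1, h2⟩ := h
  have : 0 < (T - X) * (T + X) := mul_pos (by linarith) (by linarith)
  nlinarith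

theorem onXY_onP {K X Y : ℝ} {s : ℤ} (h : onXY K X Y) (h' : onP s X Y) : s = -1 ∧ Y = -1 := by
  obtain ⟨rfl, -, -⟩ := h
  obtain ⟨h0, h1, h2⟩ := h'
  have a : s < 0 := by exact_mod_cast h0
  have b : 0 < s + 2 := by exact_mod_cast h1
  have c : s = -1 := by omega
  refine ⟨c, ?_⟩
  subst c
  push_cast at h2
  linarith

theorem onXY_onLR {K T X Y : ℝ} (hT : 2 ≤ T) (h : onXY K X Y) (h' : onLR T X Y) : False := by
  obtain ⟨rfl, h1, -⟩ := h
  obtain ⟨h0, -, -⟩ := h'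
  nlinarith

theorem onX_onX {K X Y : ℝ} {t t' : ℤ} (hne : t ≠ t') (hK : (t : ℝ) ^ 2 < K)
    (hK' : (t' : ℝ) ^ 2 < K) (h : onX K t X Y) (h' : onX K t' X Y) : False := by
  obtain ⟨l, h0, h1, h2, h3⟩ := h
  obtain ⟨l', h0', h1', h2', h3'⟩ := h'
  have e1 : l * (t : ℝ) = l' * t' := h2.symm.trans h2'
  have e2 : (1 - l) * K - l * (t : ℝ) ^ 2 = (1 - l') * K - l' * (t' : ℝ) ^ 2 := h3.symm.trans h3'
  have e3 : l * (((t : ℝ) - t') * (K - t * t')) = 0 := by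
    linear_combination (K + (t' : ℝ) ^ 2) * e1 + (t' : ℝ) * e2
  have n1 : (t : ℝ) - t' ≠ 0 := sub_ne_zero.mpr (by exact_mod_cast hne)
  have n2 : K - (t : ℝ) * t' ≠ 0 := by nlinarith [sq_nonneg ((t : ℝ) - t')]
  exact mul_ne_zero h0.ne' (mul_ne_zero n1 n2) e3

theorem onY_onY {X Y : ℝ} {t t' : ℤ} (hne : t ≠ t') (ht : t % 2 = 1) (ht' : t' % 2 = 1)
    (h : onY t X Y) (h' : onY t' X Y) : False := by
  obtain ⟨l, h0, h1, h2, h3⟩ := h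
  obtain ⟨l', h0', h1', h2', h3'⟩ := h'
  have e1 : l * (t : ℝ) = l' * t' := h2.symm.trans h2'
  have e2 : -2 * (1 - l) - l * (t : ℝ) ^ 2 = -2 * (1 - l') - l' * (t' : ℝ) ^ 2 :=
    h3.symm.trans h3'
  have e3 : l * (((t : ℝ) - t') * (-2 - t * t')) = 0 := by
    linear_combination (-2 + (t' : ℝ) ^ 2) * e1 + (t' : ℝ) * e2
  have n1 : (t : ℝ) - t' ≠ 0 := sub_ne_zero.mpr (by exact_mod_cast hne)
  have n2 : -2 - (t : ℝ) * t' ≠ 0 := by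
    intro hh
    have : -2 - t * t' = 0 := by exact_mod_cast hh
    have h4 : (t * t') % 2 = 1 := by rw [Int.mul_emod, ht, ht']; rfl
    omega
  exact mul_ne_zero h0.ne' (mul_ne_zero n1 n2) e3

theorem onY_onP {X Y : ℝ} {t s : ℤ} (ht : t % 2 = 1) (hs : s % 2 = 1)
    (h : onY t X Y) (h' : onP s X Y) : False := by
  obtain ⟨l, h0, h1, rfl, rfl⟩ := h
  obtain ⟨-, -, h2⟩ := h'
  have hz : 0 ≤ (t - s) * (t - s - 2) := by
    rcases le_or_gt t s with h | h
    · nlinarith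
    · have : s + 2 ≤ t := by omega
      exact mul_nonneg (by linarith) (by linarith)
  have hz' : (0 : ℝ) ≤ (t - s) * (t - s - 2) := by exact_mod_cast hz
  have a : 0 ≤ l * (((t : ℝ) - s) * (t - s - 2)) := mul_nonneg h0.le hz'
  have b : 0 < (1 - l) * (1 + ((s : ℝ) + 1) ^ 2) := mul_pos (by linarith) (by positivity)
  nlinarith

theorem onY_onLR {T X Y : ℝ} {t : ℤ} (hT : 2 ≤ T) (ht : (t : ℝ) ^ 2 ≤ T ^ 2)
    (h : onY t X Y) (h' : onLR T X Y) : False := by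
  obtain ⟨l, h0, h1, rfl, rfl⟩ := h
  obtain ⟨h2, -, -⟩ := h'
  have a : 0 ≤ l * (T ^ 2 - (t : ℝ) ^ 2) := mul_nonneg h0.le (by linarith)
  have b : 0 < (1 - l) * (T ^ 2 - 2) := mul_pos (by linarith) (by nlinarith)
  nlinarith

theorem onP_onP {X Y : ℝ} {t s : ℤ} (hne : t ≠ s) (ht : t % 2 = 1) (hs : s % 2 = 1)
    (h : onP t X Y) (h' : onP s X Y) : False := by
  obtain ⟨h0, h1, -⟩ := h
  obtain ⟨h2, h3, -⟩ := h'
  have a : t < s + 2 := by exact_mod_cast h0.trans h3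
  have b : s < t + 2 := by exact_mod_cast h2.trans h1
  omega

theorem onP_onLR {T X Y : ℝ} {s : ℤ} (ht : (s : ℝ) ^ 2 ≤ T ^ 2)
    (ht' : ((s : ℝ) + 2) ^ 2 ≤ T ^ 2) (hne : s ≠ -1 ∨ (s : ℝ) ^ 2 < T ^ 2)
    (h : onP s X Y) (h' : onLR T X Y) : False := by
  obtain ⟨h0, h1, h2⟩ := h
  obtain ⟨h3, -, -⟩ := h'
  have e : Y + T ^ 2 = ((s + 2 - X) * (T ^ 2 - s ^ 2) + (X - s) * (T ^ 2 - (s + 2) ^ 2)) / 2 := by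
    linear_combination h2
  rw [h3] at e
  have a : 0 ≤ (s + 2 - X) * (T ^ 2 - s ^ 2) := mul_nonneg (by linarith) (by linarith)
  have b : 0 ≤ (X - s) * (T ^ 2 - ((s : ℝ) + 2) ^ 2) := mul_nonneg (by linarith) (by linarith)
  have a' : (s + 2 - X) * (T ^ 2 - s ^ 2) = 0 := by linarith
  have b' : (X - s) * (T ^ 2 - ((s : ℝ) + 2) ^ 2) = 0 := by linarith
  have a2 : T ^ 2 - (s : ℝ) ^ 2 = 0 :=
    (mul_eq_zero.mp a').resolve_left (by intro hh; linarith)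
  have b2 : T ^ 2 - ((s : ℝ) + 2) ^ 2 = 0 :=
    (mul_eq_zero.mp b').resolve_left (by intro hh; linarith)
  rcases hne with hne | hne
  · apply hne
    have : (s : ℝ) = -1 := by nlinarith
    exact_mod_cast this
  · linarith

/-- abscissa of the rim vertices -/
def tv (k r : ℕ) : ℤ := 2 * r + 1 - 2 * k

/-- positions of the vertices -/
def bpos (k : ℕ) (v : Fin (2 * k + 2)) : Plane :=
  if v.val < 2 * k then ((tv k v.val : ℝ), -(tv k v.val : ℝ) ^ 2)
  else if v.val = 2 * k then (0, ((2 * k : ℝ)) ^ 2) else (0, -2)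

theorem tv_odd (k r : ℕ) : tv k r % 2 = 1 := by unfold tv; omega

theorem tv_ne (k r : ℕ) : tv k r ≠ 0 := by unfold tv; omega

theorem tv_inj {k r r' : ℕ} (h : r ≠ r') : tv k r ≠ tv k r' := by unfold tv; omega

theorem tv_succ (k r : ℕ) : ((tv k (r + 1) : ℤ) : ℝ) = tv k r + 2 := by
  unfold tv; push_cast; ring

theorem tv_sq (k r : ℕ) (h : r < 2 * k) : (tv k r : ℝ) ^ 2 ≤ (2 * k - 1 : ℝ) ^ 2 := by
  have h1 : tv k r ≤ 2 * k - 1 := by unfold tv; omega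
  have h2 : -(2 * k - 1) ≤ tv k r := by unfold tv; omega
  have h1' : (tv k r : ℝ) ≤ 2 * k - 1 := by exact_mod_cast h1
  have h2' : -(2 * k - 1 : ℝ) ≤ tv k r := by exact_mod_cast h2
  exact sq_le_sq' h2' h1'

theorem tv_sq' (k r : ℕ) (hk : 3 ≤ k) (h : r < 2 * k) : (tv k r : ℝ) ^ 2 < (2 * k : ℝ) ^ 2 := by
  have := tv_sq k r h
  have hk' : (3 : ℝ) ≤ k := by exact_mod_cast hk
  nlinarith

theorem bpos_rim (k : ℕ) (hm : 0 < 2 * k) (r : ℕ) (hr : r < 2 * k) :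
    bpos k (rimV (2 * k) hm r) = ((tv k r : ℝ), -(tv k r : ℝ) ^ 2) := by
  have := rimV_val' (2 * k) hm r hr
  unfold bpos
  rw [this, if_pos hr]

theorem bpos_x (k : ℕ) : bpos k ⟨2 * k, by omega⟩ = (0, ((2 * k : ℝ)) ^ 2) := by
  simp [bpos]

theorem bpos_y (k : ℕ) : bpos k ⟨2 * k + 1, by omega⟩ = (0, -2) := by
  simp [bpos]

theorem mem_openSeg {a b p : Plane} (h : p ∈ openSegment ℝ a b) :
    ∃ l : ℝ, 0 < l ∧ l < 1 ∧ p.1 = (1 - l) * a.1 + l * b.1 ∧ p.2 = (1 - l) * a.2 + l * b.2 := by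
  obtain ⟨c, d, hc, hd, hcd, rfl⟩ := h
  have : c = 1 - d := by linarith
  subst this
  exact ⟨d, hd, by linarith, by simp, by simp⟩

theorem seg_xy (k : ℕ) {p : Plane}
    (h : p ∈ oseg (bpos k) s(⟨2 * k, by omega⟩, ⟨2 * k + 1, by omega⟩)) :
    onXY ((2 * k : ℝ) ^ 2) p.1 p.2 := by
  obtain ⟨l, h0, h1, h2, h3⟩ := mem_openSeg (show p ∈ openSegment ℝ _ _ from h)
  rw [bpos_x, bpos_y] at h2 h3
  simp only at h2 h3
  have : 0 ≤ (2 * k : ℝ) ^ 2 := by positivity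
  refine ⟨by rw [h2]; ring, by nlinarith, by nlinarith⟩

theorem seg_x (k : ℕ) (hm : 0 < 2 * k) (r : ℕ) (hr : r < 2 * k) {p : Plane}
    (h : p ∈ oseg (bpos k) s(⟨2 * k, by omega⟩, rimV (2 * k) hm r)) :
    onX ((2 * k : ℝ) ^ 2) (tv k r) p.1 p.2 := by
  obtain ⟨l, h0, h1, h2, h3⟩ := mem_openSeg (show p ∈ openSegment ℝ _ _ from h)
  rw [bpos_x, bpos_rim k hm r hr] at h2 h3
  exact ⟨l, h0, h1, by rw [h2]; ring, by rw [h3]; ring⟩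

theorem seg_y (k : ℕ) (hm : 0 < 2 * k) (r : ℕ) (hr : r < 2 * k) {p : Plane}
    (h : p ∈ oseg (bpos k) s(⟨2 * k + 1, by omega⟩, rimV (2 * k) hm r)) :
    onY (tv k r) p.1 p.2 := by
  obtain ⟨l, h0, h1, h2, h3⟩ := mem_openSeg (show p ∈ openSegment ℝ _ _ from h)
  rw [bpos_y, bpos_rim k hm r hr] at h2 h3
  exact ⟨l, h0, h1, by rw [h2]; ring, by rw [h3]; ring⟩

theorem seg_p (k : ℕ) (hm : 0 < 2 * k) (r : ℕ) (hr : r + 1 < 2 * k) {p : Plane}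
    (h : p ∈ oseg (bpos k) s(rimV (2 * k) hm r, rimV (2 * k) hm (r + 1))) :
    onP (tv k r) p.1 p.2 := by
  obtain ⟨l, h0, h1, h2, h3⟩ := mem_openSeg (show p ∈ openSegment ℝ _ _ from h)
  rw [bpos_rim k hm r (by omega), bpos_rim k hm _ hr, tv_succ] at h2 h3
  simp only at h2 h3
  exact ⟨by rw [h2]; linarith, by rw [h2]; linarith, by rw [h2, h3]; ring⟩

theorem seg_lr (k : ℕ) (hm : 0 < 2 * k) {p : Plane}
    (h : p ∈ oseg (bpos k) s(rimV (2 * k) hm (2 * k - 1), rimV (2 * k) hm 0)) :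
    onLR (2 * k - 1) p.1 p.2 := by
  obtain ⟨l, h0, h1, h2, h3⟩ := mem_openSeg (show p ∈ openSegment ℝ _ _ from h)
  have e1 : (tv k (2 * k - 1) : ℝ) = 2 * k - 1 := by
    have : tv k (2 * k - 1) = 2 * k - 1 := by unfold tv; omega
    rw [this]; push_cast; ring
  have e2 : (tv k 0 : ℝ) = -(2 * k - 1) := by
    have : tv k 0 = -(2 * k - 1) := by unfold tv; omega
    rw [this]; push_cast; ring
  rw [bpos_rim k hm _ (by omega), bpos_rim k hm _ hm, e1, e2] at h2 h3
  simp only at h2 h3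
  have hk : (1 : ℝ) ≤ k := by exact_mod_cast (by omega : 1 ≤ k)
  exact ⟨by rw [h3]; ring, by rw [h2]; nlinarith, by rw [h2]; nlinarith⟩

theorem bpos_cases (k : ℕ) (v : Fin (2 * k + 2)) :
    (v.val < 2 * k ∧ bpos k v = ((tv k v.val : ℝ), -(tv k v.val : ℝ) ^ 2)) ∨
    (v.val = 2 * k ∧ bpos k v = (0, ((2 * k : ℝ)) ^ 2)) ∨
    (v.val = 2 * k + 1 ∧ bpos k v = (0, -2)) := by
  unfold bpos
  split_ifs with h1 h2
  · exact Or.inl ⟨h1, rfl⟩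
  · exact Or.inr (Or.inl ⟨h2, rfl⟩)
  · exact Or.inr (Or.inr ⟨by omega, rfl⟩)

theorem bpos_inj (k : ℕ) : Function.Injective (bpos k) := by
  intro u v h
  have hp : (-2 : ℝ) ≠ (2 * k : ℝ) ^ 2 := by
    have : 0 ≤ (2 * k : ℝ) ^ 2 := by positivity
    intro hh; linarith
  have hz : ∀ r, (tv k r : ℝ) ≠ 0 := fun r => by exact_mod_cast tv_ne k r
  apply Fin.ext
  rcases bpos_cases k u with ⟨a, b⟩ | ⟨a, b⟩ | ⟨a, b⟩ <;>
  rcases bpos_cases k v with ⟨c, d⟩ | ⟨c, d⟩ | ⟨c, d⟩ <;> rw [b, d] at h <;>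
  have h1 := congrArg Prod.fst h <;> have h2 := congrArg Prod.snd h <;> simp only at h1 h2
  · by_contra hne
    exact tv_inj hne (by exact_mod_cast h1)
  · exact absurd h1 (hz _)
  · exact absurd h1 (hz _)
  · exact absurd h1.symm (hz _)
  · omega
  · exact absurd h2.symm hp
  · exact absurd h1.symm (hz _)
  · exact absurd h2 hp
  · omega

theorem biWheel_icplanar (k : ℕ) (hk : 3 ≤ k) : ICPlanar (biWheel (2 * k)) := by
  have hm : 0 < 2 * k := by omega
  have hkr : (3 : ℝ) ≤ k := by exact_mod_cast hk
  have hT : (2 : ℝ) ≤ 2 * k - 1 := by linarith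
  have hplr : ∀ r, r + 1 < 2 * k → ∀ X Y : ℝ, onP (tv k r) X Y → onLR (2 * k - 1) X Y → False := by
    intro r hr X Y h h'
    refine onP_onLR (tv_sq k r (by omega)) ?_ ?_ h h'
    · rw [← tv_succ]; exact tv_sq k _ hr
    · by_cases hh : tv k r = -1
      · right; rw [hh]; push_cast; nlinarith
      · exact Or.inl hh
  refine icplanar_of_straight _ (bpos k) (bpos_inj k) ?_
    s(⟨2 * k, by omega⟩, ⟨2 * k + 1, by omega⟩)
    s(rimV (2 * k) hm (k - 1), rimV (2 * k) hm (k - 1 + 1)) ?_ ?_ ?_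
  · intro s hs w hw
    have hz : ∀ r, (tv k r : ℝ) ≠ 0 := fun r => by exact_mod_cast tv_ne k r
    rcases biWheel_edges _ hm s hs with rfl | ⟨r, hr, rfl⟩ | ⟨r, hr, rfl⟩ | ⟨r, hr, rfl⟩ | rfl
    · have h := seg_xy k hw
      rcases bpos_cases k w with ⟨a, b⟩ | ⟨a, b⟩ | ⟨a, b⟩ <;> rw [b] at h
      · exact hz _ h.1
      · exact lt_irrefl _ h.2.2
      · exact lt_irrefl _ h.2.1
    · have h := seg_x k hm r hr hw
      have h1 := onX_h (tv_sq' k r hk hr) h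
      have h2 := onX_ne (tv_ne k r) h
      rcases bpos_cases k w with ⟨a, b⟩ | ⟨a, b⟩ | ⟨a, b⟩ <;> rw [b] at h1 h2 <;> simp at h1 h2
    · have h := seg_y k hm r hr hw
      have h1 := onY_h h
      have h2 := onY_ne (tv_ne k r) h
      rcases bpos_cases k w with ⟨a, b⟩ | ⟨a, b⟩ | ⟨a, b⟩ <;> rw [b] at h1 h2 <;> simp at h1 h2
    · have h := seg_p k hm r hr hw
      have h1 := onP_h h
      rcases bpos_cases k w with ⟨a, b⟩ | ⟨a, b⟩ | ⟨a, b⟩ <;> rw [b] at h1 h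
      · simp at h1
      · simp only at h1; nlinarith
      · have := h.2.2
        simp only at this
        nlinarith [sq_nonneg ((tv k r : ℝ) + 1)]
    · have h := seg_lr k hm hw
      have h1 := onLR_h h
      rcases bpos_cases k w with ⟨a, b⟩ | ⟨a, b⟩ | ⟨a, b⟩ <;> rw [b] at h1 h
      · simp at h1
      · simp only at h1; nlinarith
      · have := h.1
        simp only at this
        nlinarith
  · intro x hx hx'
    have h1 := rimV_val_lt (2 * k) hm (k - 1)
    have h2 := rimV_val_lt (2 * k) hm (k - 1 + 1)
    rw [Sym2.mem_iff] at hx hx'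
    rcases hx with rfl | rfl <;> rcases hx' with h | h <;>
      have h3 := congrArg Fin.val h <;> simp only at h3 <;> omega
  · rintro p ⟨hp1, hp2⟩ q ⟨hq1, hq2⟩
    have a := seg_xy k hp1
    have b := seg_p k hm (k - 1) (by omega) hp2
    have c := seg_xy k hq1
    have d := seg_p k hm (k - 1) (by omega) hq2
    exact Prod.ext (a.1.trans c.1.symm) ((onXY_onP a b).2.trans (onXY_onP c d).2.symm)
  · have hxp : ∀ r, tv k r = -1 → r = k - 1 := by intro r h; unfold tv at h; omega
    rintro s hs t ht hne ⟨p, hp, hq⟩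
    rcases biWheel_edges _ hm s hs with rfl | ⟨r, hr, rfl⟩ | ⟨r, hr, rfl⟩ | ⟨r, hr, rfl⟩ | rfl <;>
    rcases biWheel_edges _ hm t ht with rfl | ⟨q, hr', rfl⟩ | ⟨q, hr', rfl⟩ | ⟨q, hr', rfl⟩ | rfl
    · exact absurd rfl hne
    · exact absurd (seg_xy k hp).1 (onX_ne (tv_ne k q) (seg_x k hm q hr' hq))
    · exact absurd (seg_xy k hp).1 (onY_ne (tv_ne k q) (seg_y k hm q hr' hq))
    · left
      obtain rfl := hxp q (onXY_onP (seg_xy k hp) (seg_p k hm q hr' hq)).1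
      exact ⟨rfl, rfl⟩
    · exact (onXY_onLR hT (seg_xy k hp) (seg_lr k hm hq)).elim
    · exact absurd (seg_xy k hq).1 (onX_ne (tv_ne k r) (seg_x k hm r hr hp))
    · have : r ≠ q := by rintro rfl; exact hne rfl
      exact (onX_onX (tv_inj this) (tv_sq' k r hk hr) (tv_sq' k q hk hr')
        (seg_x k hm r hr hp) (seg_x k hm q hr' hq)).elim
    · exact (lt_asymm (onX_h (tv_sq' k r hk hr) (seg_x k hm r hr hp))
        (onY_h (seg_y k hm q hr' hq))).elim
    · exact (lt_asymm (onX_h (tv_sq' k r hk hr) (seg_x k hm r hr hp))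
        (onP_h (seg_p k hm q hr' hq))).elim
    · exact (lt_asymm (onX_h (tv_sq' k r hk hr) (seg_x k hm r hr hp))
        (onLR_h (seg_lr k hm hq))).elim
    · exact absurd (seg_xy k hq).1 (onY_ne (tv_ne k r) (seg_y k hm r hr hp))
    · exact (lt_asymm (onX_h (tv_sq' k q hk hr') (seg_x k hm q hr' hq))
        (onY_h (seg_y k hm r hr hp))).elim
    · have : r ≠ q := by rintro rfl; exact hne rfl
      exact (onY_onY (tv_inj this) (tv_odd k r) (tv_odd k q)
        (seg_y k hm r hr hp) (seg_y k hm q hr' hq)).elim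
    · exact (onY_onP (tv_odd k r) (tv_odd k q) (seg_y k hm r hr hp) (seg_p k hm q hr' hq)).elim
    · exact (onY_onLR hT (tv_sq k r hr) (seg_y k hm r hr hp) (seg_lr k hm hq)).elim
    · right
      obtain rfl := hxp r (onXY_onP (seg_xy k hq) (seg_p k hm r hr hp)).1
      exact ⟨rfl, rfl⟩
    · exact (lt_asymm (onX_h (tv_sq' k q hk hr') (seg_x k hm q hr' hq))
        (onP_h (seg_p k hm r hr hp))).elim
    · exact (onY_onP (tv_odd k q) (tv_odd k r) (seg_y k hm q hr' hq) (seg_p k hm r hr hp)).elim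
    · have : r ≠ q := by rintro rfl; exact hne rfl
      exact (onP_onP (tv_inj this) (tv_odd k r) (tv_odd k q)
        (seg_p k hm r hr hp) (seg_p k hm q hr' hq)).elim
    · exact (hplr r hr _ _ (seg_p k hm r hr hp) (seg_lr k hm hq)).elim
    · exact (onXY_onLR hT (seg_xy k hq) (seg_lr k hm hp)).elim
    · exact (lt_asymm (onX_h (tv_sq' k q hk hr') (seg_x k hm q hr' hq))
        (onLR_h (seg_lr k hm hp))).elim
    · exact (onY_onLR hT (tv_sq k q hr') (seg_y k hm q hr' hq) (seg_lr k hm hp)).elim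
    · exact (hplr q hr' _ _ (seg_p k hm q hr' hq) (seg_lr k hm hp)).elim
    · exact absurd rfl hne

/-- There are maximal IC-planar graphs on `n` vertices with
only `3n − 5` edges. -/
theorem sparse_maximal_ic_planar :
    {n : ℕ | ∃ G : SimpleGraph (Fin n), MaximalICPlanar G ∧
      G.edgeSet.ncard = 3 * n - 5}.Infinite := by
  refine Set.infinite_of_injective_forall_mem (f := fun k : ℕ => 2 * (k + 3) + 2) ?_ ?_
  · intro a b h
    simp only at h
    omega
  · intro k
    exact ⟨biWheel (2 * (k + 3)),
      ⟨biWheel_icplanar (k + 3) (by omega), biWheel_maximal _ (by omega)⟩,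
      biWheel_ncard _ (by omega)⟩
end
end
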